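/- arXiv:1507.04359 — 2 statements merged into one kernel-verified Lean document; each statement's English description precedes it below -/
import Mathlib

section
/- For each integer n ≥ 1 and each natural number N, there exists a finite simplicial graph Γ with more than N vertices such that |Out(Aut(A_Γ))| > n and |Out(Out(A_Γ))| > n. In particular, for each n ≥ 1 there are infinitely many pairwise non-isomorphic graphs Γ satisfying both inequalities simultaneously. -/
noncomputable section

/-- The subgroup of inner automorphisms inside `MulAut G`. -/
def Inn (G : Type) [Group G] : Subgroup (MulAut G) :=
  (MulAut.conj : G →* MulAut G).range

instance Inn.normal (G : Type) [Group G] : (Inn G).Normal := by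
  constructor
  rintro x ⟨g, rfl⟩ φ
  refine ⟨φ g, ?_⟩
  ext h
  simp [MulAut.mul_apply, MulAut.conj_apply, map_mul, map_inv]

/-- The outer automorphism group of `G`. -/
abbrev Out (G : Type) [Group G] := MulAut G ⧸ Inn G

/-- The set of commutator relators defining the RAAG of a graph. -/
def raagRels {V : Type} (G : SimpleGraph V) : Set (FreeGroup V) :=
  {r | ∃ u v : V, G.Adj u v ∧
    r = FreeGroup.of u * FreeGroup.of v * (FreeGroup.of u)⁻¹ * (FreeGroup.of v)⁻¹}

/-- The right-angled Artin group of a graph. -/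
abbrev RAAG {V : Type} (G : SimpleGraph V) := PresentedGroup (raagRels G)

/-- The standard generator of `RAAG G` corresponding to a vertex. -/
def gen {V : Type} (G : SimpleGraph V) (v : V) : RAAG G := PresentedGroup.of v

/-- The star of a vertex: the vertex together with its neighbours. -/
def star {V : Type} (G : SimpleGraph V) (v : V) : Set V := insert v (G.neighborSet v)

/-- `u` dominates `v` if `lk(v) ⊆ st(u)`. -/
def Dominates {V : Type} (G : SimpleGraph V) (u v : V) : Prop :=
  G.neighborSet v ⊆ star G u

/-- A graph has trivial automorphism group. -/
def TrivialAut {V : Type} (G : SimpleGraph V) : Prop := ∀ e : G ≃g G, ∀ v, e v = v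

/-- A graph is focused at a vertex `c`. -/
def Focused {V : Type} (G : SimpleGraph V) (c : V) : Prop :=
  (∀ u v : V, u ≠ v → Dominates G u v → u = c) ∧
  ∀ v : V, v ≠ c → (G.induce (star G v)ᶜ).Connected

/-- A graph is austere. -/
def Austere {V : Type} (G : SimpleGraph V) : Prop :=
  TrivialAut G ∧ (∀ u v : V, u ≠ v → ¬Dominates G u v) ∧
  ∀ v : V, (G.induce (star G v)ᶜ).Connected

/-- `P` is (the vertex set of) a connected component of the induced subgraph on `s`. -/
def IsCompOf {V : Type} (G : SimpleGraph V) (s : Set V) (P : Set V) : Prop :=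
  ∃ x : s, P = Subtype.val '' {y : s | (G.induce s).Reachable x y}

/-- `φ` is the inversion at the vertex `v`. -/
def IsInversion {V : Type} (G : SimpleGraph V) (φ : MulAut (RAAG G)) (v : V) : Prop :=
  φ (gen G v) = (gen G v)⁻¹ ∧ ∀ w : V, w ≠ v → φ (gen G w) = gen G w

/-- `φ` is the transvection `τ_{uv}` (`v ↦ uv`). -/
def IsTransvection {V : Type} (G : SimpleGraph V) (φ : MulAut (RAAG G)) (u v : V) : Prop :=
  u ≠ v ∧ Dominates G u v ∧ φ (gen G v) = gen G u * gen G v ∧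
    ∀ w : V, w ≠ v → φ (gen G w) = gen G w

/-- `φ` is the partial conjugation `χ_{v,P}`. -/
def IsPartialConj {V : Type} (G : SimpleGraph V) (φ : MulAut (RAAG G)) (v : V) (P : Set V) :
    Prop :=
  IsCompOf G (star G v)ᶜ P ∧ (∀ u ∈ P, φ (gen G u) = gen G v * gen G u * (gen G v)⁻¹) ∧
    ∀ w : V, w ∉ P → φ (gen G w) = gen G w

/-- The subgroup `I_Γ` of `Aut(A_Γ)` generated by the inversions. -/
def InvSubgroup {V : Type} (G : SimpleGraph V) : Subgroup (MulAut (RAAG G)) :=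
  Subgroup.closure {φ | ∃ v, IsInversion G φ v}

/-- The subgroup `PCT` of `Aut(A_Γ)` generated by transvections and partial conjugations. -/
def PCT {V : Type} (G : SimpleGraph V) : Subgroup (MulAut (RAAG G)) :=
  Subgroup.closure {φ | (∃ u v, IsTransvection G φ u v) ∨ ∃ v P, IsPartialConj G φ v P}

/-- The number `l` of vertices dominated by but not adjacent to `c`. -/
def lInv {V : Type} (G : SimpleGraph V) (c : V) : ℕ :=
  Nat.card {v : V | v ≠ c ∧ Dominates G c v ∧ ¬G.Adj c v}

/-- The number `m` of vertices (other than `c`) dominated by `c`. -/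
def mInv {V : Type} (G : SimpleGraph V) (c : V) : ℕ :=
  Nat.card {v : V | v ≠ c ∧ Dominates G c v}

/-- The number `k` of connected components of `Γ \ st(c)`. -/
def kInv {V : Type} (G : SimpleGraph V) (c : V) : ℕ :=
  Nat.card ((G.induce (star G c)ᶜ).ConnectedComponent)

/-- `GL_n(ℤ)`. -/
abbrev GLZ (n : ℕ) := Matrix.GeneralLinearGroup (Fin n) ℤ

/-- `PGL_n(ℤ)`, the quotient of `GL_n(ℤ)` by its centre `{±I}`. -/
abbrev PGLZ (n : ℕ) := GLZ n ⧸ Subgroup.center (GLZ n)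

/-- The principal level 2 congruence subgroup `Λ_l[2]` of `GL_l(ℤ)`. -/
def congr2 (l : ℕ) : Subgroup (GLZ l) :=
  (Matrix.GeneralLinearGroup.map (Int.castRingHom (ZMod 2)) :
    GLZ l →* Matrix.GeneralLinearGroup (Fin l) (ZMod 2)).ker

/-- The matrix `(1 1 / 0 -1)`. -/
def Bmat : Matrix (Fin 2) (Fin 2) ℤ := !![1, 1; 0, -1]

/-- A block-diagonal `2l × 2l` matrix whose `i`th `2 × 2` diagonal block is
`Bmat` if `ε i` and the identity otherwise. -/
def Lmat (l : ℕ) (ε : Fin l → Bool) : Matrix (Fin l × Fin 2) (Fin l × Fin 2) ℤ :=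
  fun a b =>
    if a.1 = b.1 then (if ε a.1 then Bmat a.2 b.2 else (1 : Matrix (Fin 2) (Fin 2) ℤ) a.2 b.2)
    else 0

/-- `GL_{2l}(ℤ)`, with rows and columns indexed by `Fin l × Fin 2`. -/
abbrev GL2l (l : ℕ) := Matrix.GeneralLinearGroup (Fin l × Fin 2) ℤ

/-- The subgroup `𝓛 ≤ GL_{2l}(ℤ)`. -/
def scriptL (l : ℕ) : Subgroup (GL2l l) :=
  Subgroup.closure {M : GL2l l |
    ∃ ε : Fin l → Bool, (M : Matrix (Fin l × Fin 2) (Fin l × Fin 2) ℤ) = Lmat l ε}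

/-- The index type realizing the block decomposition `d = 2l + p + q`. -/
abbrev BIdx (l p q : ℕ) := (Fin l × Fin 2) ⊕ (Fin p ⊕ Fin q)

/-- The block-diagonal matrix `Diag(D₁, D₂, ε·I_q)` with `D₁ ∈ 𝓛` given by `ε1`,
`D₂` diagonal with entries `d2`, and `ε = e`. -/
def Dmat (l p q : ℕ) (ε1 : Fin l → Bool) (d2 : Fin p → ℤˣ) (e : ℤˣ) :
    Matrix (BIdx l p q) (BIdx l p q) ℤ := fun a b =>
  match a, b with
  | Sum.inl a, Sum.inl b => Lmat l ε1 a b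
  | Sum.inr (Sum.inl i), Sum.inr (Sum.inl j) => if i = j then (d2 i : ℤ) else 0
  | Sum.inr (Sum.inr i), Sum.inr (Sum.inr j) => if i = j then (e : ℤ) else 0
  | _, _ => 0

/-- The subgroup `D ≤ GL_d(ℤ)` generated by `−I_d` and the block-diagonal matrices
`Diag(D₁, D₂, ε·I_q)`. -/
def DSub (l p q : ℕ) : Subgroup (Matrix.GeneralLinearGroup (BIdx l p q) ℤ) :=
  Subgroup.closure
    ({M | (M : Matrix (BIdx l p q) (BIdx l p q) ℤ) = -1} ∪
     {M | ∃ ε1 d2 e, (M : Matrix (BIdx l p q) (BIdx l p q) ℤ) = Dmat l p q ε1 d2 e})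

/-- A central element `z` of `A` that every automorphism fixes or inverts, together with a
retraction `e` of `A` onto the powers of `z`. -/
structure CentralRetraction (A : Type) [Group A] where
  z : A
  e : A → ℤ
  e_mul : ∀ g h, e (g * h) = e g + e h
  e_z : e z = 1
  central : ∀ g, Commute z g
  aut_z : ∀ φ : MulAut A, φ z = z ∨ φ z = z⁻¹

namespace CentralRetraction

variable {A : Type} [Group A] (D : CentralRetraction A)

/-- A homomorphism `A → ℤ` killing `z` whose reduction modulo `2` is fixed by every automorphism
of `A`. -/
structure ParityHom where
  v : A → ℤ
  v_mul : ∀ g h, v (g * h) = v g + v h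
  v_z : v D.z = 0
  v_aut : ∀ (φ : MulAut A) g, (2 : ℤ) ∣ v (φ g) - v g

variable {D}

theorem map_one_of_mul {f : A → ℤ} (hf : ∀ g h, f (g * h) = f g + f h) : f 1 = 0 := by
  have := hf 1 1
  simp only [mul_one] at this
  linarith

theorem map_inv_of_mul {f : A → ℤ} (hf : ∀ g h, f (g * h) = f g + f h) (g : A) :
    f g⁻¹ = -f g := by
  have := hf g g⁻¹
  rw [mul_inv_cancel, map_one_of_mul hf] at this
  linarith

theorem map_zpow_of_mul {f : A → ℤ} (hf : ∀ g h, f (g * h) = f g + f h) (g : A) (k : ℤ) :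
    f (g ^ k) = k * f g := by
  induction k with
  | zero => simpa using map_one_of_mul hf
  | succ k ih => rw [zpow_add_one, hf, ih]; ring
  | pred k ih => rw [zpow_sub_one, hf, ih, map_inv_of_mul hf]; ring

variable (D) in
/-- The exponent `±1` with which an automorphism acts on the central element. -/
def sgn (φ : MulAut A) : ℤ := D.e (φ D.z)

theorem sgn_eq (φ : MulAut A) : D.sgn φ = 1 ∨ D.sgn φ = -1 := by
  rcases D.aut_z φ with h | h
  · left; rw [sgn, h, D.e_z]
  · right; rw [sgn, h, map_inv_of_mul D.e_mul, D.e_z]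

theorem aut_z_eq (φ : MulAut A) : φ D.z = D.z ^ D.sgn φ := by
  rcases D.aut_z φ with h | h
  · rw [sgn, h, D.e_z, zpow_one]
  · rw [sgn, h, map_inv_of_mul D.e_mul, D.e_z, zpow_neg_one]

theorem sgn_mul (φ ψ : MulAut A) : D.sgn (φ * ψ) = D.sgn φ * D.sgn ψ := by
  rw [sgn, MulAut.mul_apply, aut_z_eq ψ, map_zpow, map_zpow_of_mul D.e_mul, mul_comm]; rfl

theorem sgn_one : D.sgn 1 = 1 := D.e_z

theorem sgn_conj (a : A) : D.sgn (MulAut.conj a) = 1 := by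
  rw [sgn, MulAut.conj_apply, D.e_mul, D.e_mul, map_inv_of_mul D.e_mul, D.e_z]; ring

namespace ParityHom

variable (t : D.ParityHom)

theorem two_dvd (φ : MulAut A) (g : A) : (2 : ℤ) ∣ t.v (φ g) - D.sgn φ * t.v g := by
  have h := t.v_aut φ g
  rcases sgn_eq (D := D) φ with hs | hs <;> rw [hs] <;> omega

theorem v_mul_zpow (g : A) (k : ℤ) : t.v (g * D.z ^ k) = t.v g := by
  rw [t.v_mul, map_zpow_of_mul t.v_mul, t.v_z]; ring

/-- Half the defect of equivariance of `v` under `φ`. -/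
def half (φ : MulAut A) (g : A) : ℤ := (t.v (φ g) - D.sgn φ * t.v g) / 2

theorem two_mul_half (φ : MulAut A) (g : A) :
    2 * t.half φ g = t.v (φ g) - D.sgn φ * t.v g :=
  Int.mul_ediv_cancel' (t.two_dvd φ g)

theorem half_mul_right (φ : MulAut A) (g h : A) :
    t.half φ (g * h) = t.half φ g + t.half φ h := by
  have h1 := t.two_mul_half φ g
  have h2 := t.two_mul_half φ h
  have h3 := t.two_mul_half φ (g * h)
  rw [map_mul, t.v_mul, t.v_mul] at h3
  linarith

theorem half_one (g : A) : t.half 1 g = 0 := by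
  have h := t.two_mul_half 1 g
  rw [sgn_one, MulAut.one_apply] at h
  linarith

/-- The map underlying the conjugate of `φ` by the formal square root of the transvection
`g ↦ g * z ^ v g`. -/
def twistFun (φ : MulAut A) (g : A) : A := φ g * D.z ^ t.half φ g

theorem twistFun_mul_right (φ : MulAut A) (g h : A) :
    t.twistFun φ (g * h) = t.twistFun φ g * t.twistFun φ h := by
  simp only [twistFun, half_mul_right, map_mul, zpow_add, mul_assoc]
  rw [((D.central (φ h)).zpow_left (t.half φ g)).left_comm]

theorem twistFun_comp (φ ψ : MulAut A) (g : A) :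
    t.twistFun φ (t.twistFun ψ g) = t.twistFun (φ * ψ) g := by
  simp only [twistFun]
  rw [map_mul, map_zpow, aut_z_eq φ, MulAut.mul_apply, ← zpow_mul, mul_assoc, ← zpow_add]
  congr 2
  have h1 := t.two_mul_half φ (ψ g * D.z ^ t.half ψ g)
  have h2 := t.two_mul_half ψ g
  have h3 := t.two_mul_half (φ * ψ) g
  rw [map_mul, map_zpow, aut_z_eq φ, ← zpow_mul, v_mul_zpow, v_mul_zpow] at h1
  rw [sgn_mul, MulAut.mul_apply] at h3
  have : 2 * (D.sgn φ * t.half ψ g + t.half φ (ψ g * D.z ^ t.half ψ g)) = 2 * t.half (φ * ψ) g := by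
    linear_combination D.sgn φ * h2 + h1 - h3
  linarith

theorem twistFun_one (g : A) : t.twistFun 1 g = g := by
  rw [twistFun, half_one, zpow_zero, mul_one, MulAut.one_apply]

/-- The conjugate of `φ` by the formal square root of the transvection `g ↦ g * z ^ v g`. -/
def twist (φ : MulAut A) : MulAut A where
  toFun := t.twistFun φ
  invFun := t.twistFun φ⁻¹
  left_inv g := by rw [twistFun_comp, inv_mul_cancel, twistFun_one]
  right_inv g := by rw [twistFun_comp, mul_inv_cancel, twistFun_one]
  map_mul' := t.twistFun_mul_right φ

theorem twist_apply (φ : MulAut A) (g : A) : t.twist φ g = φ g * D.z ^ t.half φ g := rfl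

theorem sgn_twist (φ : MulAut A) : D.sgn (t.twist φ) = D.sgn φ := by
  have h : t.half φ D.z = 0 := by
    have h := t.two_mul_half φ D.z
    rw [aut_z_eq φ, map_zpow_of_mul t.v_mul, t.v_z] at h
    linarith
  rw [sgn, twist_apply, h, zpow_zero, mul_one, sgn]

/-- The parity homomorphism with the opposite values. -/
def neg : D.ParityHom where
  v g := -t.v g
  v_mul g h := by rw [t.v_mul]; ring
  v_z := by rw [t.v_z, neg_zero]
  v_aut φ g := by have := t.v_aut φ g; omega

theorem half_neg (φ : MulAut A) (g : A) : t.neg.half φ g = -t.half φ g := by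
  have h1 := t.two_mul_half φ g
  have h2 : 2 * t.neg.half φ g = -t.v (φ g) - D.sgn φ * -t.v g := t.neg.two_mul_half φ g
  linarith

theorem half_twist (t' : D.ParityHom) (φ : MulAut A) (g : A) :
    t.half (t'.twist φ) g = t.half φ g := by
  have h1 := t.two_mul_half φ g
  have h2 := t.two_mul_half (t'.twist φ) g
  rw [sgn_twist, twist_apply, v_mul_zpow] at h2
  linarith

theorem neg_twist_twist (φ : MulAut A) : t.neg.twist (t.twist φ) = φ := by
  ext g
  rw [twist_apply, half_twist, twist_apply, half_neg, zpow_neg, mul_inv_cancel_right]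

theorem twist_neg_twist (φ : MulAut A) : t.twist (t.neg.twist φ) = φ := by
  ext g
  rw [twist_apply, half_twist, twist_apply, half_neg, zpow_neg, inv_mul_cancel_right]

/-- Conjugation by the formal square root of the transvection `g ↦ g * z ^ v g`, as an
automorphism of `MulAut A`. -/
def twistAut : MulAut (MulAut A) where
  toFun := t.twist
  invFun := t.neg.twist
  left_inv := t.neg_twist_twist
  right_inv := t.twist_neg_twist
  map_mul' φ ψ := by
    ext g
    exact (t.twistFun_comp φ ψ g).symm

theorem twist_conj (a : A) : t.twist (MulAut.conj a) = MulAut.conj a := by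
  have h (g : A) : t.half (MulAut.conj a) g = 0 := by
    have h := t.two_mul_half (MulAut.conj a) g
    rw [sgn_conj, MulAut.conj_apply, t.v_mul, t.v_mul, map_inv_of_mul t.v_mul] at h
    linarith
  ext g
  rw [twist_apply, h, zpow_zero, mul_one]

theorem map_inn : (Inn A).map (t.twistAut : MulAut A →* MulAut A) = Inn A := by
  rw [Inn, MonoidHom.map_range]
  congr 1
  ext1 a
  exact t.twist_conj a

/-- The automorphism of `Out A` induced by `twistAut`. -/
def twistOut : MulAut (Out A) :=
  QuotientGroup.congr (Inn A) (Inn A) t.twistAut t.map_inn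

theorem twistOut_mk (φ : MulAut A) :
    t.twistOut (φ : Out A) = ((t.twist φ : MulAut A) : Out A) := rfl

variable (D) in
/-- The map underlying `flip`. -/
def flipFun (g : A) : A := g * D.z ^ (-2 * D.e g)

theorem flipFun_flipFun (g : A) : flipFun D (flipFun D g) = g := by
  simp only [flipFun, D.e_mul, map_zpow_of_mul D.e_mul, D.e_z, mul_assoc, ← zpow_add]
  ring_nf
  rw [zpow_zero, mul_one]

variable (D) in
/-- The automorphism inverting the central element and fixing the kernel of the retraction. -/
def flip : MulAut A where
  toFun := flipFun D
  invFun := flipFun D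
  left_inv := flipFun_flipFun
  right_inv := flipFun_flipFun
  map_mul' g h := by
    rw [flipFun, D.e_mul, mul_add, zpow_add, flipFun, flipFun, mul_assoc, mul_assoc,
      ((D.central h).zpow_left _).left_comm]

theorem flip_apply (g : A) : flip D g = g * D.z ^ (-2 * D.e g) := rfl

theorem twist_flip_apply (g : A) : t.twist (flip D) g = g * D.z ^ (t.v g - 2 * D.e g) := by
  have hs : D.sgn (flip D) = -1 := by
    rw [sgn, flip_apply, D.e_mul, map_zpow_of_mul D.e_mul, D.e_z]
    norm_num
  have h := t.two_mul_half (flip D) g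
  rw [hs, flip_apply, v_mul_zpow] at h
  rw [twist_apply, flip_apply, mul_assoc, ← zpow_add]
  congr 2
  linarith

/-- If the images of `flip` under two twists are conjugate modulo inner automorphisms, then the
twists have the same parity. -/
theorem two_dvd_sub_of_conj (t' : D.ParityHom) (χ : MulAut A) (a : A)
    (h : χ * t.twist (flip D) = t'.twist (flip D) * χ * MulAut.conj a) (g : A) :
    (2 : ℤ) ∣ t.v g - t'.v g := by
  have h := congrArg (fun φ : MulAut A => D.e (φ g)) h
  simp only [MulAut.mul_apply, twist_flip_apply, MulAut.conj_apply, map_mul, map_zpow, map_inv,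
    D.e_mul, map_zpow_of_mul D.e_mul, map_inv_of_mul D.e_mul, D.e_z] at h
  have h1 := t'.v_aut χ g
  rw [← sgn] at h
  rcases sgn_eq (D := D) χ with hs | hs <;> rw [hs] at h <;> omega

theorem two_dvd_sub_of_twistAut (t' : D.ParityHom)
    (h : (t.twistAut : Out (MulAut A)) = (t'.twistAut : Out (MulAut A))) (g : A) :
    (2 : ℤ) ∣ t.v g - t'.v g := by
  rw [QuotientGroup.eq] at h
  obtain ⟨ψ, hψ⟩ := h
  rw [eq_inv_mul_iff_mul_eq] at hψ
  have h := DFunLike.congr_fun hψ (flip D)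
  rw [MulAut.mul_apply, MulAut.conj_apply, map_mul, map_mul, map_inv, mul_inv_eq_iff_eq_mul] at h
  refine t.two_dvd_sub_of_conj t' (t.twistAut ψ) 1 ?_ g
  rw [map_one, mul_one]
  exact h

theorem two_dvd_sub_of_twistOut (t' : D.ParityHom)
    (h : (t.twistOut : Out (Out A)) = (t'.twistOut : Out (Out A))) (g : A) :
    (2 : ℤ) ∣ t.v g - t'.v g := by
  rw [QuotientGroup.eq] at h
  obtain ⟨ψ, hψ⟩ := h
  rw [eq_inv_mul_iff_mul_eq] at hψ
  have h := DFunLike.congr_fun hψ (flip D : Out A)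
  rw [MulAut.mul_apply, MulAut.conj_apply, map_mul, map_mul, map_inv, mul_inv_eq_iff_eq_mul,
    twistOut_mk, twistOut_mk] at h
  obtain ⟨χ, hχ⟩ := QuotientGroup.mk_surjective (t.twistOut ψ)
  rw [← hχ, ← QuotientGroup.mk_mul, ← QuotientGroup.mk_mul, eq_comm, QuotientGroup.eq] at h
  obtain ⟨a, ha⟩ := h
  rw [eq_inv_mul_iff_mul_eq] at ha
  exact t.two_dvd_sub_of_conj t' χ a ha.symm g

end ParityHom

/-- A family of parity homomorphisms with pairwise distinct reductions modulo `2` bounds the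
size of both outer automorphism groups from below. -/
theorem card_le_card_out {T : Type} (t : T → D.ParityHom)
    (ht : ∀ i j, (∀ g, (2 : ℤ) ∣ (t i).v g - (t j).v g) → i = j) :
    Cardinal.mk T ≤ Cardinal.mk (Out (MulAut A)) ∧
      Cardinal.mk T ≤ Cardinal.mk (Out (Out A)) := by
  refine ⟨Cardinal.mk_le_of_injective (f := fun i => ((t i).twistAut : Out (MulAut A))) ?_,
    Cardinal.mk_le_of_injective (f := fun i => ((t i).twistOut : Out (Out A))) ?_⟩
  · exact fun i j h => ht i j ((t i).two_dvd_sub_of_twistAut (t j) h)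
  · exact fun i j h => ht i j ((t i).two_dvd_sub_of_twistOut (t j) h)

end CentralRetraction

open Monoid CoprodI in
theorem NeWord.sigma_head_eq {ι : Type} [DecidableEq ι] {M : ι → Type} [∀ i, Group (M i)]
    [∀ i, DecidableEq (M i)] {i j k l : ι}
    (w₁ : NeWord M i j) (w₂ : NeWord M k l) (h : w₁.prod = w₂.prod) :
    (⟨i, w₁.head⟩ : Σ i, M i) = ⟨k, w₂.head⟩ := by
  have h' : w₁.toWord = w₂.toWord := Word.equiv.symm.injective h
  have h'' := congrArg (fun w : Word M => w.toList.head?) h'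
  change w₁.toList.head? = w₂.toList.head? at h''
  rw [NeWord.toList_head?, NeWord.toList_head?] at h''
  exact Option.some.inj h''

open Monoid CoprodI in
/-- In a free product of two groups, only the identity commutes with an element of order at
least three of each factor. -/
theorem coprodI_eq_one_of_commute {M : Bool → Type} [∀ b, Group (M b)]
    (t : ∀ b, M b) (ht : ∀ b, t b ≠ 1) (ht2 : ∀ b, t b ^ 2 ≠ 1) (y : CoprodI M)
    (hy : ∀ b, Commute (of (t b)) y) : y = 1 := by
  classical
  by_contra hne
  obtain ⟨w, rfl⟩ := Word.equiv.symm.surjective y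
  have hw : w ≠ Word.empty := by
    rintro rfl
    exact hne Word.prod_empty
  obtain ⟨i, j, w, rfl⟩ := NeWord.of_word w hw
  change ∀ b, Commute (of (t b)) w.prod at hy
  by_cases hij : i = j
  · subst hij
    have hi : (!i) ≠ i := by cases i <;> decide
    let s : NeWord M (!i) (!i) := .singleton (t (!i)) (ht _)
    have h := NeWord.sigma_head_eq (.append s hi w) (.append w hi.symm s) (by
      rw [NeWord.append_prod, NeWord.append_prod, NeWord.prod_singleton]
      exact (hy _).eq)
    exact hi (congrArg Sigma.fst h)
  · have key (a : M i) (ha : a ≠ 1) (hc : Commute (of a) w.prod) : w.head = a := by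
      let s : NeWord M i j := .append (.singleton a ha) hij (.singleton (t j) (ht j))
      have h := NeWord.sigma_head_eq (.append w (Ne.symm hij) s) (.append s (Ne.symm hij) w) (by
        simp only [s, NeWord.append_prod, NeWord.prod_singleton]
        exact ((hc.mul_left (hy j)).eq).symm)
      exact eq_of_heq (Sigma.mk.inj h).2
    have h1 := key (t i) (ht i) (hy i)
    have h2 := key (t i ^ 2) (ht2 i) (by rw [map_pow]; exact (hy i).pow_left 2)
    rw [h1, pow_two] at h2
    exact ht i (left_eq_mul.mp h2)

section RAAG

variable {V : Type} {G : SimpleGraph V} {H : Type} [Group H]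

/-- The homomorphism out of a right-angled Artin group determined by its values on vertices. -/
def raagLift (f : V → H) (hf : ∀ u v, G.Adj u v → Commute (f u) (f v)) : RAAG G →* H :=
  PresentedGroup.toGroup (f := f) (by
    rintro r ⟨u, v, huv, rfl⟩
    simp only [map_mul, map_inv, FreeGroup.lift_apply_of]
    rw [(hf u v huv).eq, mul_inv_cancel_right, mul_inv_cancel])

theorem raagLift_gen (f : V → H) (hf : ∀ u v, G.Adj u v → Commute (f u) (f v)) (v : V) :
    raagLift f hf (gen G v) = f v :=
  PresentedGroup.toGroup.of _

theorem commute_gen {u v : V} (h : G.Adj u v) : Commute (gen G u) (gen G v) := by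
  have h1 : (PresentedGroup.mk (raagRels G)) (FreeGroup.of u * FreeGroup.of v *
      (FreeGroup.of u)⁻¹ * (FreeGroup.of v)⁻¹) = 1 :=
    PresentedGroup.one_of_mem ⟨u, v, h, rfl⟩
  simp only [map_mul, map_inv] at h1
  rw [mul_inv_eq_one, mul_inv_eq_iff_eq_mul] at h1
  exact h1

theorem raag_mem_of_gen_mem (K : Subgroup (RAAG G)) (h : ∀ v, gen G v ∈ K) (x : RAAG G) :
    x ∈ K :=
  PresentedGroup.generated_by (raagRels G) K h x

variable [DecidableEq V]

variable (G) in
/-- The exponent sum of a vertex. -/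
def expSum (v : V) : RAAG G →* Multiplicative ℤ :=
  raagLift (fun w => Multiplicative.ofAdd (if v = w then 1 else 0)) fun _ _ _ => Commute.all _ _

theorem expSum_gen (v w : V) :
    (expSum G v (gen G w)).toAdd = if v = w then 1 else 0 := by
  rw [expSum, raagLift_gen, toAdd_ofAdd]

variable (G) in
/-- The first homology class modulo `2`. -/
def homologyHom : RAAG G →* Multiplicative (V → ZMod 2) :=
  raagLift (fun w => Multiplicative.ofAdd (Pi.single w 1)) fun _ _ _ => Commute.all _ _

/-- The first homology class modulo `2`, as a vector. -/
def homology (x : RAAG G) : V → ZMod 2 := (homologyHom G x).toAdd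

theorem homology_gen (v : V) : homology (gen G v) = Pi.single v 1 := by
  rw [homology, homologyHom, raagLift_gen, toAdd_ofAdd]

theorem homology_inv (x : RAAG G) : homology x⁻¹ = -homology x := by
  rw [homology, map_inv, toAdd_inv, homology]

theorem expSum_cast (v : V) (x : RAAG G) :
    (((expSum G v x).toAdd : ℤ) : ZMod 2) = homology x v := by
  have h : (AddMonoidHom.toMultiplicative (Int.castAddHom (ZMod 2))).comp (expSum G v) =
      (AddMonoidHom.toMultiplicative (Pi.evalAddMonoidHom (fun _ : V => ZMod 2) v)).comp
        (homologyHom G) := by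
    refine PresentedGroup.ext fun w => ?_
    change Multiplicative.ofAdd (((expSum G v (gen G w)).toAdd : ℤ) : ZMod 2) =
      Multiplicative.ofAdd (homology (gen G w) v)
    rw [expSum_gen, homology_gen, Pi.single_apply]
    push_cast
    rfl
  exact congrArg Multiplicative.toAdd (DFunLike.congr_fun h x)

/-- The abelianization modulo `2` of the dihedral group of order eight. -/
def dihedralAb : DihedralGroup 4 →* Multiplicative (ZMod 2 × ZMod 2) where
  toFun
    | .r i => Multiplicative.ofAdd ((i.val : ZMod 2), (i.val : ZMod 2))
    | .sr i => Multiplicative.ofAdd ((i.val : ZMod 2) + 1, (i.val : ZMod 2))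
  map_one' := by decide
  map_mul' := by
    rintro (i | i) (j | j) <;> revert i j <;> decide

theorem dihedralAb_of_commute (x y : DihedralGroup 4) (h : Commute x y) :
    (dihedralAb x).toAdd.1 * (dihedralAb y).toAdd.2 =
      (dihedralAb x).toAdd.2 * (dihedralAb y).toAdd.1 := by
  replace h := h.eq
  rcases x with i | i <;> rcases y with j | j <;> revert i j <;> decide

/-- The homology classes of commuting elements are proportional on every pair of nonadjacent
vertices. -/
theorem homology_of_commute {u v : V} (hne : u ≠ v) (huv : ¬G.Adj u v) {x y : RAAG G}
    (h : Commute x y) : homology x u * homology y v = homology x v * homology y u := by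
  let f : RAAG G →* DihedralGroup 4 :=
    raagLift (fun w => if w = u then .sr 0 else if w = v then .sr 1 else 1) (by
      intro a b hab
      have hvu : ¬G.Adj v u := fun h => huv h.symm
      split_ifs <;> subst_vars <;> first
        | exact Commute.one_right _
        | exact Commute.one_left _
        | exact Commute.refl _
        | contradiction)
  have hf (x : RAAG G) : (dihedralAb (f x)).toAdd = (homology x u, homology x v) := by
    have h : dihedralAb.comp f = (AddMonoidHom.toMultiplicative
        ((Pi.evalAddMonoidHom (fun _ : V => ZMod 2) u).prod
          (Pi.evalAddMonoidHom (fun _ : V => ZMod 2) v))).comp (homologyHom G) := by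
      refine PresentedGroup.ext fun w => ?_
      change dihedralAb (f (gen G w)) =
        Multiplicative.ofAdd (homology (gen G w) u, homology (gen G w) v)
      rw [raagLift_gen, homology_gen]
      by_cases h1 : w = u
      · subst h1
        rw [if_pos rfl, Pi.single_eq_same, Pi.single_eq_of_ne hne.symm]
        decide
      · by_cases h2 : w = v
        · subst h2
          rw [if_neg h1, if_pos rfl, Pi.single_eq_same, Pi.single_eq_of_ne hne]
          decide
        · rw [if_neg h1, if_neg h2, Pi.single_eq_of_ne (Ne.symm h1),
            Pi.single_eq_of_ne (Ne.symm h2)]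
          exact map_one _
    exact congrArg Multiplicative.toAdd (DFunLike.congr_fun h x)
  have := dihedralAb_of_commute _ _ (h.map f)
  rwa [hf, hf] at this

variable [Fintype V]

/-- The linear map induced on the first homology modulo `2`. -/
def homologyMap (φ : RAAG G →* RAAG G) : (V → ZMod 2) →ₗ[ZMod 2] (V → ZMod 2) :=
  Fintype.linearCombination (ZMod 2) fun v => homology (φ (gen G v))

theorem homologyMap_single (φ : RAAG G →* RAAG G) (v : V) :
    homologyMap φ (Pi.single v 1) = homology (φ (gen G v)) := by
  rw [homologyMap, Fintype.linearCombination_apply_single, one_smul]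

theorem homologyMap_homology (φ : RAAG G →* RAAG G) (x : RAAG G) :
    homologyMap φ (homology x) = homology (φ x) := by
  have h : (AddMonoidHom.toMultiplicative (homologyMap φ).toAddMonoidHom).comp (homologyHom G) =
      (homologyHom G).comp φ := by
    refine PresentedGroup.ext fun w => ?_
    change Multiplicative.ofAdd (homologyMap φ (homology (gen G w))) =
      Multiplicative.ofAdd (homology (φ (gen G w)))
    rw [homology_gen, homologyMap_single]
  exact congrArg Multiplicative.toAdd (DFunLike.congr_fun h x)

/-- The linear automorphism induced on the first homology modulo `2`. -/
def homologyEquiv (φ : MulAut (RAAG G)) : (V → ZMod 2) ≃ₗ[ZMod 2] (V → ZMod 2) :=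
  LinearEquiv.ofLinearMap (homologyMap φ.toMonoidHom) (homologyMap (φ⁻¹).toMonoidHom)
    (by
      refine LinearMap.pi_ext' fun v => LinearMap.ext_ring ?_
      change homologyMap φ.toMonoidHom (homologyMap (φ⁻¹).toMonoidHom (Pi.single v 1)) =
        Pi.single v 1
      rw [homologyMap_single, homologyMap_homology]
      exact (congrArg homology (MulAut.apply_inv_self _ φ _)).trans (homology_gen v))
    (by
      refine LinearMap.pi_ext' fun v => LinearMap.ext_ring ?_
      change homologyMap (φ⁻¹).toMonoidHom (homologyMap φ.toMonoidHom (Pi.single v 1)) =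
        Pi.single v 1
      rw [homologyMap_single, homologyMap_homology]
      exact (congrArg homology (MulAut.inv_apply_self _ φ _)).trans (homology_gen v))

theorem homologyEquiv_homology (φ : MulAut (RAAG G)) (x : RAAG G) :
    homologyEquiv φ (homology x) = homology (φ x) :=
  homologyMap_homology φ.toMonoidHom x

theorem homologyEquiv_single (φ : MulAut (RAAG G)) (v : V) :
    homologyEquiv φ (Pi.single v 1) = homology (φ (gen G v)) :=
  homologyMap_single φ.toMonoidHom v

end RAAG

/-- The sizes of the two cliques in each join factor. -/
def blockSize : ℕ → Bool → ℕ
  | _, true => 1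
  | i, false => i + 2

theorem blockSize_pos (i : ℕ) (b : Bool) : 0 < blockSize i b := by
  cases b <;> simp [blockSize]

/-- The vertices of `coneGraph`. -/
abbrev Vtx (m : ℕ) := Option (Σ i : Fin m, Σ b : Bool, Fin (blockSize i b))

/-- The nonadjacent pairs of distinct vertices of `coneGraph`. -/
def Opposed {m : ℕ} : Vtx m → Vtx m → Prop
  | some ⟨i, b, _⟩, some ⟨k, c, _⟩ => i = k ∧ b ≠ c
  | _, _ => False

/-- The cone over the join, for `i < m`, of the disjoint unions of a vertex and a complete graph
on `i + 2` vertices. -/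
def coneGraph (m : ℕ) : SimpleGraph (Vtx m) where
  Adj v w := v ≠ w ∧ ¬Opposed v w
  symm := ⟨by
    rintro (_ | ⟨i, b, j⟩) (_ | ⟨k, c, l⟩) ⟨h1, h2⟩ <;> refine ⟨h1.symm, fun h => h2 ?_⟩
    · exact h
    · exact h
    · exact h
    · exact ⟨h.1.symm, h.2.symm⟩⟩
  loopless := ⟨fun _ h => h.1 rfl⟩

/-- The isolated vertex of the `i`th join factor. -/
def hub {m : ℕ} (i : Fin m) : Vtx m := some ⟨i, true, ⟨0, blockSize_pos i true⟩⟩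

/-- The vertices of the complete graph in the `i`th join factor. -/
def leaf {m : ℕ} (i : Fin m) (j : Fin (i + 2)) : Vtx m := some ⟨i, false, j⟩

theorem Vtx.cases {m : ℕ} {P : Vtx m → Prop} (apex : P none) (hub : ∀ i, P (hub i))
    (leaf : ∀ i j, P (leaf i j)) (v : Vtx m) : P v := by
  rcases v with _ | ⟨i, _ | _, j⟩
  · exact apex
  · exact leaf i j
  · have hj : j = ⟨0, blockSize_pos i true⟩ := Fin.ext (Nat.lt_one_iff.mp j.isLt)
    rw [hj]
    exact hub i

theorem hub_injective {m : ℕ} : Function.Injective (hub (m := m)) := fun _ _ h =>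
  congrArg Sigma.fst (Option.some.inj h)

theorem leaf_injective {m : ℕ} (i : Fin m) : Function.Injective (leaf i) := by
  intro j k h
  have h1 := eq_of_heq (Sigma.mk.inj (Option.some.inj h)).2
  exact eq_of_heq (Sigma.mk.inj h1).2

theorem hub_ne_leaf {m : ℕ} (i k : Fin m) (j : Fin (k + 2)) : hub i ≠ leaf k j := by
  intro h
  obtain ⟨rfl, h1⟩ := Sigma.mk.inj (Option.some.inj h)
  exact Bool.noConfusion (Sigma.mk.inj (eq_of_heq h1)).1

theorem opposed_hub_leaf {m : ℕ} (i : Fin m) (j : Fin (i + 2)) : Opposed (hub i) (leaf i j) :=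
  ⟨rfl, Bool.noConfusion⟩

theorem adj_leaf_of_ne_hub {m : ℕ} {i : Fin m} {j : Fin (i + 2)} {v : Vtx m}
    (h1 : v ≠ hub i) (h2 : v ≠ leaf i j) : (coneGraph m).Adj (leaf i j) v := by
  refine ⟨h2.symm, ?_⟩
  induction v using Vtx.cases with
  | apex => exact id
  | hub k => rintro ⟨rfl, -⟩; exact h1 rfl
  | leaf k l => exact fun h => h.2 rfl

theorem adj_none {m : ℕ} {v : Vtx m} (h : v ≠ none) : (coneGraph m).Adj none v :=
  ⟨h.symm, id⟩

section LinearAlgebra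

variable {m : ℕ} (P : (Vtx m → ZMod 2) ≃ₗ[ZMod 2] (Vtx m → ZMod 2))

/-- A linear automorphism preserving the infinitesimal commutation relation of a cone graph. -/
def PreservesComm : Prop :=
  ∀ v w : Vtx m, v = w ∨ (coneGraph m).Adj v w → ∀ k l,
    P (Pi.single v 1) (hub k) * P (Pi.single w 1) (leaf k l) =
      P (Pi.single v 1) (leaf k l) * P (Pi.single w 1) (hub k)

variable {P}

theorem zmod_two_eq_one {c : ZMod 2} (h : c ≠ 0) : c = 1 := by
  revert h; revert c; decide

theorem functional_eq_of_vanish {i : Fin m} (f : (Vtx m → ZMod 2) →ₗ[ZMod 2] ZMod 2) (hf : f ≠ 0)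
    (h : ∀ v, v ≠ hub i → f (P (Pi.single v 1)) = 0) (y : Vtx m → ZMod 2) :
    f (P y) = y (hub i) := by
  have key (c : ZMod 2) (hc : f (P (Pi.single (hub i) 1)) = c) :
      f ∘ₗ P.toLinearMap = c • LinearMap.proj (hub i) := by
    refine LinearMap.pi_ext' fun v => LinearMap.ext_ring ?_
    change f (P (Pi.single v 1)) = c • (Pi.single v 1 : Vtx m → ZMod 2) (hub i)
    by_cases hv : v = hub i
    · subst hv
      rw [hc, Pi.single_eq_same, smul_eq_mul, mul_one]
    · rw [h v hv, Pi.single_eq_of_ne (Ne.symm hv), smul_zero]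
  by_cases hc : f (P (Pi.single (hub i) 1)) = 0
  · refine absurd (LinearMap.ext fun x => ?_) hf
    have := LinearMap.congr_fun (key 0 hc) (P.symm x)
    simpa using this
  · have := LinearMap.congr_fun (key 1 (zmod_two_eq_one hc)) y
    simpa using this

theorem PreservesComm.functional (hP : PreservesComm P) (i : Fin m) (j : Fin (i + 2)) (k : Fin m)
    (l : Fin (k + 2)) (v : Vtx m) (hv : v ≠ hub i) :
    (P (Pi.single (leaf i j) 1) (hub k) • LinearMap.proj (leaf k l) -
      P (Pi.single (leaf i j) 1) (leaf k l) • LinearMap.proj (hub k) :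
        (Vtx m → ZMod 2) →ₗ[ZMod 2] ZMod 2) (P (Pi.single v 1)) = 0 := by
  have h := hP (leaf i j) v (by
    by_cases h : v = leaf i j
    · exact .inl h.symm
    · exact .inr (adj_leaf_of_ne_hub hv h)) k l
  simpa [sub_eq_zero] using h

theorem PreservesComm.leaf_hub (hP : PreservesComm P) (i : Fin m) (j : Fin (i + 2)) (k : Fin m) :
    P (Pi.single (leaf i j) 1) (hub k) = 0 := by
  by_contra hne
  have key (l : Fin (k + 2)) := functional_eq_of_vanish
    (P (Pi.single (leaf i j) 1) (hub k) • LinearMap.proj (leaf k l) -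
      P (Pi.single (leaf i j) 1) (leaf k l) • LinearMap.proj (hub k)) (fun h => hne (by
        have := LinearMap.congr_fun h (Pi.single (leaf k l) 1)
        simpa [hub_ne_leaf] using this)) (hP.functional i j k l)
  have h := (key 0 (P.symm (Pi.single (leaf k 0) 1))).trans
    (key 1 (P.symm (Pi.single (leaf k 0) 1))).symm
  have h01 : leaf k 1 ≠ leaf k 0 := (leaf_injective k).ne (by simp)
  simp [hub_ne_leaf, h01] at h
  exact hne h

theorem PreservesComm.hub_of_leaf (hP : PreservesComm P) {i : Fin m} {j : Fin (i + 2)} {k : Fin m}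
    {l : Fin (k + 2)} (hne : P (Pi.single (leaf i j) 1) (leaf k l) ≠ 0) (y : Vtx m → ZMod 2) :
    P y (hub k) = y (hub i) := by
  have h := functional_eq_of_vanish (i := i) (P := P)
    (P (Pi.single (leaf i j) 1) (hub k) • LinearMap.proj (leaf k l) -
      P (Pi.single (leaf i j) 1) (leaf k l) • LinearMap.proj (hub k)) (fun h => hne (by
        have := LinearMap.congr_fun h (Pi.single (hub k) 1)
        simpa [(hub_ne_leaf k k l).symm] using this)) (hP.functional i j k l) y
  rw [hP.leaf_hub, zmod_two_eq_one hne] at h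
  rw [← h]
  simp [ZModModule.neg_eq_self]

/-- The first homology class of a product of powers of leaves. -/
def leafComb (i : Fin m) : (Fin (i + 2) → ZMod 2) →ₗ[ZMod 2] (Vtx m → ZMod 2) :=
  Fintype.linearCombination (ZMod 2) fun j => Pi.single (leaf i j) 1

theorem leafComb_leaf (i : Fin m) (c : Fin (i + 2) → ZMod 2) (j : Fin (i + 2)) :
    leafComb i c (leaf i j) = c j := by
  simp [leafComb, Fintype.linearCombination_apply, Pi.single_apply, (leaf_injective i).eq_iff]

theorem map_leafComb (i : Fin m) (c : Fin (i + 2) → ZMod 2) (v : Vtx m) :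
    P (leafComb i c) v = ∑ j, c j * P (Pi.single (leaf i j) 1) v := by
  simp [leafComb, Fintype.linearCombination_apply, map_sum]

theorem eq_zero_of_map_eq_zero (hz : P (Pi.single none 1) = Pi.single none 1) {i : Fin m}
    {c : Fin (i + 2) → ZMod 2} (h : ∀ v, v ≠ none → P (leafComb i c) v = 0) : c = 0 := by
  have h1 : P (leafComb i c) = P (P (leafComb i c) none • Pi.single none 1) := by
    rw [map_smul, hz]
    ext v
    by_cases hv : v = none
    · subst hv; simp
    · simp [h v hv, Pi.single_eq_of_ne hv]
  ext j
  rw [← leafComb_leaf i c j, P.injective h1]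
  simp [leaf]

theorem PreservesComm.exists_hub (hP : PreservesComm P)
    (hz : P (Pi.single none 1) = Pi.single none 1) (i : Fin m) :
    ∃ k, i ≤ k ∧ ∀ y, P y (hub k) = y (hub i) := by
  have h1 : ∃ k l, P (Pi.single (leaf i 0) 1) (leaf k l) ≠ 0 := by
    by_contra! h
    have h2 := eq_zero_of_map_eq_zero (P := P) hz (i := i) (c := Pi.single 0 1) (by
      intro v hv
      rw [leafComb, Fintype.linearCombination_apply_single, one_smul]
      induction v using Vtx.cases with
      | apex => exact absurd rfl hv
      | hub k => exact hP.leaf_hub i 0 k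
      | leaf k l => exact h k l)
    simpa using congrFun h2 0
  obtain ⟨k, l, hkl⟩ := h1
  have hk := hP.hub_of_leaf hkl
  refine ⟨k, ?_, hk⟩
  have hother (k' : Fin m) (hk' : k' ≠ k) (j : Fin (i + 2)) (l' : Fin (k' + 2)) :
      P (Pi.single (leaf i j) 1) (leaf k' l') = 0 := by
    by_contra hne
    have h := (hP.hub_of_leaf hne (P.symm (Pi.single (hub k) 1))).trans (hk _).symm
    simp [Pi.single_eq_of_ne (hub_injective.ne hk')] at h
  let f : (Fin (i + 2) → ZMod 2) →ₗ[ZMod 2] (Fin (k + 2) → ZMod 2) :=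
    LinearMap.funLeft (ZMod 2) (ZMod 2) (leaf k) ∘ₗ P.toLinearMap ∘ₗ leafComb i
  have hf : Function.Injective f := by
    rw [injective_iff_map_eq_zero]
    intro c hc
    refine eq_zero_of_map_eq_zero hz fun v hv => ?_
    induction v using Vtx.cases with
    | apex => exact absurd rfl hv
    | hub k' => simp [map_leafComb, hP.leaf_hub]
    | leaf k' l' =>
      by_cases h : k' = k
      · subst h; exact congrFun hc l'
      · simp [map_leafComb, hother k' h]
  have h := LinearMap.finrank_le_finrank_of_injective hf
  simp only [Module.finrank_fin_fun] at h
  exact Fin.le_def.mpr (by omega)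

/-- A linear automorphism that, together with its inverse, preserves the infinitesimal commutation
relation fixes every hub coordinate. -/
theorem PreservesComm.map_hub (hP : PreservesComm P) (hP' : PreservesComm P.symm)
    (hz : P (Pi.single none 1) = Pi.single none 1) (i : Fin m) (y : Vtx m → ZMod 2) :
    P y (hub i) = y (hub i) := by
  obtain ⟨k, hik, hk⟩ := hP.exists_hub hz i
  obtain ⟨l, hkl, hl⟩ := hP'.exists_hub ((LinearEquiv.symm_apply_eq P).mpr hz.symm) k
  have hli : l = i := by
    by_contra hne
    have h := (hl (P (Pi.single (hub i) 1))).trans (hk _)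
    simp [Pi.single_eq_of_ne (hub_injective.ne hne)] at h
  have : k = i := le_antisymm (hli ▸ hkl) hik
  rw [← this, hk, this]

end LinearAlgebra

theorem commute_gen_none {m : ℕ} (x : RAAG (coneGraph m)) :
    Commute (gen (coneGraph m) none) x := by
  have h := raag_mem_of_gen_mem (Subgroup.centralizer {gen (coneGraph m) none}) (fun v => by
    rw [Subgroup.mem_centralizer_singleton_iff]
    by_cases hv : v = none
    · rw [hv]
    · exact (commute_gen (adj_none hv)).symm.eq) x
  exact (Subgroup.mem_centralizer_singleton_iff.mp h).symm

theorem commute_gen_some {m : ℕ} {i k : Fin m} {b c : Bool} (j : Fin (blockSize i b))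
    (l : Fin (blockSize k c)) (h : ¬(i = k ∧ b ≠ c)) :
    Commute (gen (coneGraph m) (some ⟨i, b, j⟩)) (gen (coneGraph m) (some ⟨k, c, l⟩)) := by
  by_cases he : (some ⟨i, b, j⟩ : Vtx m) = some ⟨k, c, l⟩
  · rw [he]
  · exact commute_gen ⟨he, h⟩

section

open Monoid

/-- The free product of the free abelian groups on the two cliques of a join factor. -/
abbrev BlockGroup (i : ℕ) := CoprodI fun b => Fin (blockSize i b) → Multiplicative ℤ

/-- The projection of the right-angled Artin group of a cone graph modulo the cone vertex. -/
def toBlocks (m : ℕ) : RAAG (coneGraph m) →* (∀ i : Fin m, BlockGroup i) :=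
  raagLift (fun
    | none => 1
    | some ⟨i, _, j⟩ =>
      Pi.mulSingle i (CoprodI.of (Pi.mulSingle j (Multiplicative.ofAdd 1)))) (by
    rintro (_ | ⟨i, b, j⟩) (_ | ⟨k, c, l⟩) ⟨h1, h2⟩
    · exact Commute.one_left _
    · exact Commute.one_left _
    · exact Commute.one_right _
    · by_cases hik : i = k
      · subst hik
        obtain rfl : b = c := by
          by_contra h
          exact h2 ⟨rfl, h⟩
        have h : Commute (CoprodI.of (M := fun b => Fin (blockSize i b) → Multiplicative ℤ)
            (Pi.mulSingle j (Multiplicative.ofAdd 1)))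
            (CoprodI.of (Pi.mulSingle l (Multiplicative.ofAdd 1))) := (Commute.all _ _).map _
        exact h.map (MonoidHom.mulSingle (fun i : Fin m => BlockGroup i) i)
      · exact Pi.mulSingle_commute hik _ _)

theorem toBlocks_none (m : ℕ) : toBlocks m (gen _ none) = 1 := raagLift_gen _ _ _

theorem toBlocks_some {m : ℕ} (i : Fin m) (b : Bool) (j : Fin (blockSize i b)) :
    toBlocks m (gen _ (some ⟨i, b, j⟩)) =
      Pi.mulSingle i (CoprodI.of (Pi.mulSingle j (Multiplicative.ofAdd 1))) :=
  raagLift_gen _ _ _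

theorem pairwise_commute_zpowersHom {m : ℕ} (i : Fin m) (b : Bool) :
    Pairwise fun j k : Fin (blockSize i b) => ∀ x y : Multiplicative ℤ,
      Commute (zpowersHom _ (gen (coneGraph m) (some ⟨i, b, j⟩)) x)
        (zpowersHom _ (gen (coneGraph m) (some ⟨i, b, k⟩)) y) :=
  fun _ _ _ _ _ => (commute_gen_some _ _ fun h => h.2 rfl).zpow_zpow _ _

/-- The inclusion of a join factor. -/
def ofBlock {m : ℕ} (i : Fin m) : BlockGroup i →* RAAG (coneGraph m) :=
  CoprodI.lift fun b => MonoidHom.noncommPiCoprod _ (pairwise_commute_zpowersHom i b)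

theorem ofBlock_of {m : ℕ} (i : Fin m) (b : Bool) (j : Fin (blockSize i b)) :
    ofBlock i (CoprodI.of (Pi.mulSingle j (Multiplicative.ofAdd 1))) =
      gen (coneGraph m) (some ⟨i, b, j⟩) := by
  rw [ofBlock, CoprodI.lift_of, MonoidHom.noncommPiCoprod_mulSingle, zpowersHom_apply,
    toAdd_ofAdd, zpow_one]

theorem commute_ofBlock {m : ℕ} {i : Fin m} {x : RAAG (coneGraph m)}
    (h : ∀ b j, Commute x (gen _ (some ⟨i, b, j⟩))) (y : BlockGroup i) :
    Commute x (ofBlock i y) := by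
  induction y using CoprodI.induction_on with
  | one => rw [map_one]; exact Commute.one_right x
  | of b g =>
    rw [ofBlock, CoprodI.lift_of]
    exact MonoidHom.commute_noncommPiCoprod _ (fun j y => (h b j).zpow_right _) _
  | mul y z hy hz => rw [map_mul]; exact hy.mul_right hz

theorem pairwise_commute_ofBlock (m : ℕ) :
    Pairwise fun i k : Fin m => ∀ (x : BlockGroup i) (y : BlockGroup k),
      Commute (ofBlock i x) (ofBlock k y) :=
  fun _ _ hij x _ => commute_ofBlock (fun _ _ => (commute_ofBlock (fun _ _ =>
    commute_gen_some _ _ fun h => hij h.1.symm) x).symm) _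

/-- The inclusion of the product of the join factors. -/
def ofBlocks (m : ℕ) : (∀ i : Fin m, BlockGroup i) →* RAAG (coneGraph m) :=
  MonoidHom.noncommPiCoprod ofBlock (pairwise_commute_ofBlock m)

theorem exists_eq_zpow_mul_ofBlocks {m : ℕ} (x : RAAG (coneGraph m)) :
    ∃ k : ℤ, x = gen _ none ^ k * ofBlocks m (toBlocks m x) := by
  let f := (ofBlocks m).comp (toBlocks m)
  let K : Subgroup (RAAG (coneGraph m)) :=
    { carrier := {x | ∃ k : ℤ, x = gen _ none ^ k * f x}
      one_mem' := ⟨0, by rw [map_one, zpow_zero, mul_one]⟩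
      mul_mem' := by
        rintro x y ⟨k, hk⟩ ⟨l, hl⟩
        refine ⟨k + l, ?_⟩
        rw [map_mul, zpow_add, mul_assoc, ((commute_gen_none (f x)).zpow_left l).left_comm, ← hl,
          ← mul_assoc, ← hk]
      inv_mem' := by
        rintro x ⟨k, hk⟩
        refine ⟨-k, ?_⟩
        rw [map_inv, zpow_neg, ← mul_inv_rev, ← ((commute_gen_none (f x)).zpow_left k).eq, ← hk] }
  refine raag_mem_of_gen_mem K (fun v => ?_) x
  rcases v with _ | ⟨i, b, j⟩
  · exact ⟨1, by rw [MonoidHom.comp_apply, toBlocks_none, map_one, zpow_one, mul_one]⟩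
  · exact ⟨0, by rw [MonoidHom.comp_apply, toBlocks_some, ofBlocks,
      MonoidHom.noncommPiCoprod_mulSingle, ofBlock_of, zpow_zero, one_mul]⟩

theorem toBlocks_eq_one_of_central {m : ℕ} {x : RAAG (coneGraph m)} (hx : ∀ y, Commute y x) :
    toBlocks m x = 1 := by
  ext1 i
  have hne (b : Bool) (n : ℤ) (hn : n ≠ 0) :
      (Pi.mulSingle ⟨0, blockSize_pos i b⟩ (Multiplicative.ofAdd n) :
        Fin (blockSize i b) → Multiplicative ℤ) ≠ 1 := by
    rw [Ne, Pi.mulSingle_eq_one_iff]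
    exact hn
  refine coprodI_eq_one_of_commute
    (fun b => Pi.mulSingle ⟨0, blockSize_pos i b⟩ (Multiplicative.ofAdd 1))
    (fun b => hne b 1 one_ne_zero) (fun b => ?_) _ (fun b => ?_)
  · rw [← Pi.mulSingle_pow]
    exact hne b 2 two_ne_zero
  · have h := ((hx (gen _ (some ⟨i, b, ⟨0, blockSize_pos i b⟩⟩))).map (toBlocks m)).map
      (Pi.evalMonoidHom _ i)
    rw [toBlocks_some] at h
    simpa using h

end

theorem exists_eq_zpow_of_central {m : ℕ} {x : RAAG (coneGraph m)} (hx : ∀ y, Commute y x) :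
    ∃ k : ℤ, x = gen _ none ^ k := by
  obtain ⟨k, hk⟩ := exists_eq_zpow_mul_ofBlocks x
  exact ⟨k, by rwa [toBlocks_eq_one_of_central hx, map_one, mul_one] at hk⟩

theorem aut_gen_none {m : ℕ} (φ : MulAut (RAAG (coneGraph m))) :
    φ (gen _ none) = gen _ none ∨ φ (gen _ none) = (gen _ none)⁻¹ := by
  have h (ψ : MulAut (RAAG (coneGraph m))) : ∃ k : ℤ, ψ (gen _ none) = gen _ none ^ k := by
    refine exists_eq_zpow_of_central fun y => ?_
    have := (commute_gen_none (ψ⁻¹ y)).symm.map ψ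
    rwa [MulAut.apply_inv_self] at this
  obtain ⟨k, hk⟩ := h φ
  obtain ⟨l, hl⟩ := h φ⁻¹
  have h1 : gen (coneGraph m) none = gen _ none ^ (l * k) := by
    rw [zpow_mul, ← hl, ← map_zpow, ← hk, MulAut.inv_apply_self]
  have h2 := congrArg (fun x => (expSum _ none x).toAdd) h1
  simp only [map_zpow, toAdd_zpow, expSum_gen, if_pos, smul_eq_mul, mul_one] at h2
  rcases Int.isUnit_iff.mp (IsUnit.of_mul_eq_one l (by linarith : k * l = 1)) with rfl | rfl
  · left; rw [hk, zpow_one]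
  · right; rw [hk, zpow_neg_one]

/-- The cone vertex together with its exponent sum. -/
def coneRetraction (m : ℕ) : CentralRetraction (RAAG (coneGraph m)) where
  z := gen _ none
  e x := (expSum _ none x).toAdd
  e_mul g h := by rw [map_mul, toAdd_mul]
  e_z := by rw [expSum_gen, if_pos rfl]
  central := commute_gen_none
  aut_z := aut_gen_none

theorem preservesComm_homologyEquiv {m : ℕ} (φ : MulAut (RAAG (coneGraph m))) :
    PreservesComm (homologyEquiv φ) := by
  intro v w hvw k l
  rw [homologyEquiv_single, homologyEquiv_single]
  refine homology_of_commute (hub_ne_leaf k k l)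
    (fun h : (coneGraph m).Adj _ _ => h.2 (opposed_hub_leaf k l)) ?_
  rcases hvw with rfl | hvw
  · exact Commute.refl _
  · exact (commute_gen hvw).map φ

theorem homologyEquiv_none {m : ℕ} (φ : MulAut (RAAG (coneGraph m))) :
    homologyEquiv φ (Pi.single none 1) = Pi.single none 1 := by
  rw [homologyEquiv_single, ← homology_gen (G := coneGraph m)]
  rcases aut_gen_none φ with h | h
  · rw [h]
  · rw [h, homology_inv, ZModModule.neg_eq_self]

/-- The exponent sum of a hub. -/
def hubParity {m : ℕ} (i : Fin m) : (coneRetraction m).ParityHom where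
  v x := (expSum _ (hub i) x).toAdd
  v_mul g h := by rw [map_mul, toAdd_mul]
  v_z := (expSum_gen _ _).trans (if_neg (Option.some_ne_none _))
  v_aut φ g := by
    have h : homology (φ g) (hub i) = homology g (hub i) := by
      rw [← homologyEquiv_homology]
      exact (preservesComm_homologyEquiv φ).map_hub (preservesComm_homologyEquiv φ⁻¹)
        (homologyEquiv_none φ) i _
    rw [← expSum_cast, ← expSum_cast] at h
    exact (ZMod.intCast_eq_intCast_iff_dvd_sub _ _ 2).mp h.symm

theorem eq_of_hubParity {m : ℕ} (i j : Fin m)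
    (h : ∀ g, (2 : ℤ) ∣ (hubParity i).v g - (hubParity j).v g) : i = j := by
  by_contra hne
  have h1 : (hubParity i).v (gen _ (hub i)) = 1 := (expSum_gen _ _).trans (if_pos rfl)
  have h2 : (hubParity j).v (gen _ (hub i)) = 0 :=
    (expSum_gen _ _).trans (if_neg (hub_injective.ne (Ne.symm hne)))
  have := h (gen _ (hub i))
  rw [h1, h2] at this
  omega

/-- For each `n ≥ 1` there are graphs with arbitrarily many vertices for which
both `|Out(Aut(A_Γ))| > n` and `|Out(Out(A_Γ))| > n`. -/
theorem stmt2 (n : ℕ) (hn : 1 ≤ n) (N : ℕ) :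
    ∃ (V : Type) (_ : Fintype V) (G : SimpleGraph V),
      N < Nat.card V ∧
      (n : Cardinal) < Cardinal.mk (Out (MulAut (RAAG G))) ∧
      (n : Cardinal) < Cardinal.mk (Out (Out (RAAG G))) := by
  obtain ⟨h1, h2⟩ := CentralRetraction.card_le_card_out
    (hubParity (m := n + N + 1)) eq_of_hubParity
  have hlt : (n : Cardinal) < Cardinal.mk (Fin (n + N + 1)) := by
    rw [Cardinal.mk_fin, Nat.cast_lt]
    omega
  refine ⟨Vtx (n + N + 1), inferInstance, coneGraph _, ?_, hlt.trans_le h1, hlt.trans_le h2⟩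
  have := Nat.card_le_card_of_injective _ (hub_injective (m := n + N + 1))
  rw [Nat.card_fin] at this
  omega
end
end

section
/- Let Γ be a finite simplicial graph focused at a vertex c, with trivial graph automorphism group, n = |V| vertices, and with V \ st(c) nonempty (so k ≥ 1). Then Out(A_Γ) ≅ ℤ^{k+m−1} ⋊ (ℤ/2ℤ)^n. Precisely: the image of PCT in Out(A_Γ) is a normal subgroup isomorphic to the free abelian group ℤ^{k+m−1}, the image of I_Γ in Out(A_Γ) is a subgroup isomorphic to (ℤ/2ℤ)^n, these two subgroups intersect trivially, and together they generate Out(A_Γ). -/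
noncomputable section

namespace RAAG

variable {V : Type} {G : SimpleGraph V}

section Basic

theorem commute_gen {u v : V} (h : G.Adj u v) : Commute (gen G u) (gen G v) := by
  have : PresentedGroup.mk (raagRels G) (FreeGroup.of u * FreeGroup.of v *
      (FreeGroup.of u)⁻¹ * (FreeGroup.of v)⁻¹) = 1 :=
    PresentedGroup.one_of_mem ⟨u, v, h, rfl⟩
  rw [map_mul, map_mul, map_mul, map_inv, map_inv, mul_inv_eq_one, mul_inv_eq_iff_eq_mul] at this
  exact this

/-- The universal property of a right-angled Artin group. -/
def lift {H : Type*} [Group H] (f : V → H) (hf : ∀ u v, G.Adj u v → Commute (f u) (f v)) :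
    RAAG G →* H :=
  PresentedGroup.toGroup (f := f) (by
    rintro _ ⟨u, v, h, rfl⟩
    simp only [map_mul, map_inv, FreeGroup.lift_apply_of]
    rw [(hf u v h).eq]
    group)

@[simp]
theorem lift_gen {H : Type*} [Group H] (f : V → H)
    (hf : ∀ u v, G.Adj u v → Commute (f u) (f v)) (v : V) : lift f hf (gen G v) = f v :=
  PresentedGroup.toGroup.of _

theorem hom_ext {H : Type*} [Group H] {f g : RAAG G →* H}
    (h : ∀ v, f (gen G v) = g (gen G v)) : f = g :=
  PresentedGroup.ext h

theorem mulAut_ext {f g : MulAut (RAAG G)} (h : ∀ v, f (gen G v) = g (gen G v)) : f = g := by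
  have : f.toMonoidHom = g.toMonoidHom := hom_ext h
  ext x
  exact DFunLike.congr_fun this x

theorem closure_range_gen : Subgroup.closure (Set.range (gen G)) = ⊤ :=
  PresentedGroup.closure_range_of _

theorem induction_right {p : RAAG G → Prop} (one : p 1)
    (mul : ∀ x v, p x → p (x * gen G v)) (inv : ∀ x v, p x → p (x * (gen G v)⁻¹))
    (x : RAAG G) : p x := by
  have hx : x ∈ Subgroup.closure (Set.range (gen G)) := by
    rw [closure_range_gen]; trivial
  induction hx using Subgroup.closure_induction_right with
  | one => exact one
  | mul_right x hx y hy ih => obtain ⟨v, rfl⟩ := hy; exact mul x v ih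
  | mul_inv_cancel x hx y hy ih => obtain ⟨v, rfl⟩ := hy; exact inv x v ih

theorem induction_left {p : RAAG G → Prop} (one : p 1)
    (mul : ∀ v x, p x → p (gen G v * x)) (inv : ∀ v x, p x → p ((gen G v)⁻¹ * x))
    (x : RAAG G) : p x := by
  have hx : x ∈ Subgroup.closure (Set.range (gen G)) := by
    rw [closure_range_gen]; trivial
  induction hx using Subgroup.closure_induction_left with
  | one => exact one
  | mul_left y hy x hx ih => obtain ⟨v, rfl⟩ := hy; exact mul v x ih
  | inv_mul_cancel y hy x hx ih => obtain ⟨v, rfl⟩ := hy; exact inv v x ih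

end Basic

section Exponent

open Classical in
/-- The exponent sum of the generator `a`. -/
def expo (a : V) : RAAG G →* Multiplicative ℤ :=
  lift (fun v => Multiplicative.ofAdd (if v = a then 1 else 0)) fun _ _ _ => Commute.all _ _

/-- The exponent sum of the generator `a`, as an integer. -/
def ex (a : V) (x : RAAG G) : ℤ := Multiplicative.toAdd (expo a x)

@[simp] theorem ex_one (a : V) : ex a (1 : RAAG G) = 0 := by simp [ex]

@[simp] theorem ex_mul (a : V) (x y : RAAG G) : ex a (x * y) = ex a x + ex a y := by simp [ex]

@[simp] theorem ex_inv (a : V) (x : RAAG G) : ex a x⁻¹ = -ex a x := by simp [ex]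

@[simp] theorem ex_zpow (a : V) (x : RAAG G) (n : ℤ) : ex a (x ^ n) = n * ex a x := by simp [ex]

@[simp] theorem ex_pow (a : V) (x : RAAG G) (n : ℕ) : ex a (x ^ n) = n * ex a x := by simp [ex]

open Classical in
theorem ex_gen (a v : V) : ex a (gen G v) = if v = a then 1 else 0 := by simp [ex, expo]

@[simp] theorem ex_gen_self (a : V) : ex a (gen G a) = 1 := by simp [ex_gen]

theorem ex_gen_ne {a v : V} (h : v ≠ a) : ex a (gen G v) = 0 := by simp [ex_gen, h]

theorem gen_ne_one (v : V) : gen G v ≠ 1 := fun h => by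
  have := ex_gen_self (G := G) v
  simp [h] at this

theorem ex_hom [Fintype V] (f : RAAG G →* RAAG G) (a : V) (x : RAAG G) :
    ex a (f x) = ∑ v, ex a (f (gen G v)) * ex v x := by
  classical
  induction x using induction_right with
  | one => simp
  | mul x v ih => simp [ih, mul_add, Finset.sum_add_distrib, ex_gen]
  | inv x v ih => simp [ih, mul_add, Finset.sum_add_distrib, ex_gen]

theorem ex_eq_zero_of_mem_closure {S : Set V} {a : V} (ha : a ∉ S) {x : RAAG G}
    (hx : x ∈ Subgroup.closure (gen G '' S)) : ex a x = 0 := by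
  have : Subgroup.closure (gen G '' S) ≤ (expo a).ker := by
    rw [Subgroup.closure_le]
    rintro _ ⟨v, hv, rfl⟩
    have : v ≠ a := fun h => ha (h ▸ hv)
    simpa [ex] using ex_gen_ne (G := G) this
  have := this hx
  rw [MonoidHom.mem_ker] at this
  simp [ex, this]

/-- Commuting elements satisfy the relations coming from the Heisenberg quotients. -/
theorem ex_mul_ex_of_commute {a b : V} (hab : a ≠ b) (hadj : ¬G.Adj a b) {x y : RAAG G}
    (h : Commute x y) : ex a x * ex b y = ex a y * ex b x := by
  classical
  let P : V → Equiv.Perm (ℤ × ℤ) := fun v =>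
    { toFun := fun p => (p.1 + (if v = a then 1 else 0), p.2 + (if v = b then p.1 else 0))
      invFun := fun p => (p.1 - (if v = a then 1 else 0), p.2 - (if v = b then p.1 else 0))
      left_inv := by
        rintro ⟨p, q⟩
        by_cases h1 : v = a <;> by_cases h2 : v = b <;> simp_all
      right_inv := by
        rintro ⟨p, q⟩
        by_cases h1 : v = a <;> by_cases h2 : v = b <;> simp_all }
  have hP : ∀ u v, G.Adj u v → Commute (P u) (P v) := by
    intro u v huv
    have h1 : ¬(u = a ∧ v = b) := by rintro ⟨rfl, rfl⟩; exact hadj huv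
    have h2 : ¬(v = a ∧ u = b) := by rintro ⟨rfl, rfl⟩; exact hadj huv.symm
    have h3 : ¬(u = a ∧ u = b) := by rintro ⟨rfl, rfl⟩; exact hab rfl
    have h4 : ¬(v = a ∧ v = b) := by rintro ⟨rfl, rfl⟩; exact hab rfl
    refine Equiv.ext ?_
    rintro ⟨p, q⟩
    by_cases hua : u = a <;> by_cases hub : u = b <;> by_cases hva : v = a <;>
      by_cases hvb : v = b <;> simp_all [P, Equiv.Perm.mul_apply]
  let T := lift P hP
  have key : ∀ x : RAAG G, ∃ k : ℤ, ∀ p : ℤ × ℤ,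
      T x p = (p.1 + ex a x, p.2 + k + ex b x * p.1) := by
    intro x
    induction x using induction_left with
    | one => exact ⟨0, fun p => by simp⟩
    | mul v x ih =>
      obtain ⟨k, hk⟩ := ih
      refine ⟨k + (if v = b then ex a x else 0), fun p => ?_⟩
      rw [map_mul, Equiv.Perm.mul_apply, hk]
      clear hk
      rcases eq_or_ne v a with rfl | hva
      · simp [T, P, ex_gen, hab]; ring
      · rcases eq_or_ne v b with rfl | hvb
        · simp [T, P, ex_gen, hab.symm]; ring
        · simp [T, P, ex_gen, hva, hvb]
    | inv v x ih =>
      obtain ⟨k, hk⟩ := ih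
      refine ⟨k - (if v = b then ex a x else 0), fun p => ?_⟩
      rw [map_mul, Equiv.Perm.mul_apply, hk, map_inv, Equiv.Perm.inv_eq_iff_eq]
      clear hk
      rcases eq_or_ne v a with rfl | hva
      · simp [T, P, ex_gen, hab]; ring
      · rcases eq_or_ne v b with rfl | hvb
        · simp [T, P, ex_gen, hab.symm]; ring
        · simp [T, P, ex_gen, hva, hvb]
  obtain ⟨k, hk⟩ := key x
  obtain ⟨l, hl⟩ := key y
  have h1 : T (x * y) (0, 0) = T (y * x) (0, 0) := by rw [h.eq]
  rw [map_mul, map_mul, Equiv.Perm.mul_apply, Equiv.Perm.mul_apply, hl, hk, hk, hl] at h1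
  simp only [Prod.mk.injEq] at h1
  linarith [h1.2]

end Exponent

section Homology

theorem adj_of_perm_adj [Finite V] (σ : Equiv.Perm V) (h : ∀ u v, G.Adj u v → G.Adj (σ u) (σ v))
    {u v : V} (huv : G.Adj (σ u) (σ v)) : G.Adj u v := by
  have key : ∀ (n : ℕ) (u v : V), G.Adj u v → G.Adj ((σ ^ n) u) ((σ ^ n) v) := by
    intro n
    induction n with
    | zero => intro u v h; simpa using h
    | succ n ih => intro u v huv; rw [pow_succ']; exact h _ _ (ih u v huv)
  have h1 := key (orderOf σ - 1) _ _ huv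
  have h2 : ∀ x, (σ ^ (orderOf σ - 1)) (σ x) = x := fun x => by
    rw [← Equiv.Perm.mul_apply, ← pow_succ, Nat.sub_add_cancel (orderOf_pos σ), pow_orderOf_eq_one,
      Equiv.Perm.one_apply]
  rwa [h2, h2] at h1

theorem mem_star_iff {u v : V} : u ∈ star G v ↔ u = v ∨ G.Adj v u := Iff.rfl

theorem mem_star_self (v : V) : v ∈ star G v := Or.inl rfl

theorem mem_star_comm {u v : V} : u ∈ star G v ↔ v ∈ star G u := by
  simp only [mem_star_iff, G.adj_comm, eq_comm]

/-- An invertible integer matrix whose columns at adjacent vertices satisfy the Heisenberg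
relations is, for a focused graph without symmetries, diagonal up to the row of the focus. -/
theorem matrix_support [Fintype V] [DecidableEq V] {c : V} (hF : Focused G c) (hT : TrivialAut G)
    {M N : Matrix V V ℤ} (hNM : N * M = 1)
    (hM : ∀ v d, G.Adj v d → ∀ a b, a ≠ b → ¬G.Adj a b → M a v * M b d = M a d * M b v) :
    ∀ b v, M b v ≠ 0 → b = v ∨ b = c ∧ Dominates G c v := by
  classical
  have hdet : M.det ≠ 0 := by
    intro h0
    have := congrArg Matrix.det hNM
    simp [Matrix.det_mul, h0] at this
  obtain ⟨σ, hσ⟩ : ∃ σ : Equiv.Perm V, ∀ v, M (σ v) v ≠ 0 := by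
    by_contra! hcon
    apply hdet
    rw [Matrix.det_apply]
    refine Finset.sum_eq_zero fun σ _ => ?_
    obtain ⟨v, hv⟩ := hcon σ
    exact (congrArg _ (Finset.prod_eq_zero (f := fun i => M (σ i) i) (Finset.mem_univ v) hv)).trans
      (smul_zero _)
  -- the vectors supported on a star
  let Y : ∀ v, (star G v → ℚ) → V → ℚ := fun v l a => ∑ d : star G v, (M a d : ℚ) * l d
  have hY : ∀ v l a b, a ≠ b → ¬G.Adj a b → (M a v : ℚ) * Y v l b = Y v l a * M b v := by
    intro v l a b hab hadj
    simp only [Y, Finset.mul_sum, Finset.sum_mul]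
    refine Finset.sum_congr rfl fun d _ => ?_
    have h1 : (M a v : ℚ) * M b d = M a d * M b v := by
      rcases d.2 with h | h
      · rw [h]
      · exact_mod_cast hM v d h a b hab hadj
    linear_combination l d * h1
  have hYinj : ∀ v l, (∀ a, Y v l a = 0) → l = 0 := by
    intro v l h
    ext e
    have h1 : ∀ d : V, ∑ a, (N e a : ℚ) * M a d = if (e : V) = d then 1 else 0 := by
      intro d
      have := congrFun (congrFun hNM e) d
      rw [Matrix.mul_apply, Matrix.one_apply] at this
      exact_mod_cast this
    calc l e = ∑ d : star G v, (∑ a, (N e a : ℚ) * M a d) * l d := by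
          simp [h1, ← Subtype.ext_iff]
      _ = ∑ a, (N e a : ℚ) * Y v l a := by
          simp only [Y, Finset.mul_sum, Finset.sum_mul]
          rw [Finset.sum_comm]
          simp only [mul_assoc]
      _ = 0 := by simp [h]
  let T : ∀ v, (star G v → ℚ) →ₗ[ℚ] (star G (σ v) → ℚ) := fun v =>
    { toFun := fun l a => Y v l a
      map_add' := fun l l' => by ext a; simp [Y, mul_add, Finset.sum_add_distrib]
      map_smul' := fun r l => by
        ext a; simp only [Y, Pi.smul_apply, smul_eq_mul, RingHom.id_apply, Finset.mul_sum]
        exact Finset.sum_congr rfl fun _ _ => by ring }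
  have hTinj : ∀ v, Function.Injective (T v) := by
    intro v
    rw [← LinearMap.ker_eq_bot, LinearMap.ker_eq_bot']
    intro l hl
    refine hYinj v l fun b => ?_
    have h0 : ∀ a ∈ star G (σ v), Y v l a = 0 := fun a ha => congrFun hl ⟨a, ha⟩
    by_cases hb : b ∈ star G (σ v)
    · exact h0 b hb
    · have hb' := hb
      rw [mem_star_iff, not_or] at hb'
      have := hY v l (σ v) b (Ne.symm hb'.1) hb'.2
      rw [h0 _ (mem_star_self _), zero_mul] at this
      exact (mul_eq_zero.1 this).resolve_left (by exact_mod_cast hσ v)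
  have hle : ∀ v, Fintype.card (star G v) ≤ Fintype.card (star G (σ v)) := by
    intro v
    simpa using LinearMap.finrank_le_finrank_of_injective (hTinj v)
  have hcard : ∀ v, Fintype.card (star G v) = Fintype.card (star G (σ v)) := by
    have h1 : ∑ v, Fintype.card (star G v) = ∑ v, Fintype.card (star G (σ v)) :=
      (Equiv.sum_comp σ fun v => Fintype.card (star G v)).symm
    exact fun v => (Finset.sum_eq_sum_iff_of_le fun v _ => hle v).1 h1 v (Finset.mem_univ v)
  have hsurj : ∀ v, Function.Surjective (T v) := fun v =>
    (LinearMap.injective_iff_surjective_of_finrank_eq_finrank (by simpa using hcard v)).1 (hTinj v)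
  have hdom : ∀ b v, M b v ≠ 0 → b = σ v ∨ b = c ∧ Dominates G c (σ v) := by
    intro b v hbv
    by_cases hb : b = σ v
    · exact Or.inl hb
    have hd : Dominates G b (σ v) := by
      intro d hd
      by_contra hdb
      rw [mem_star_iff, not_or] at hdb
      have hdσ : G.Adj (σ v) d := hd
      obtain ⟨l, hl⟩ := hsurj v fun a => if (a : V) = d then 1 else 0
      have hl' : ∀ a ∈ star G (σ v), Y v l a = if a = d then 1 else 0 := fun a ha =>
        congrFun hl ⟨a, ha⟩
      have h1 := hY v l b d (Ne.symm hdb.1) hdb.2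
      rw [hl' d (Or.inr hd), if_pos rfl, mul_one] at h1
      have h2 : Y v l b = 0 := by
        by_cases hadj : G.Adj (σ v) b
        · rw [hl' b (Or.inr hadj), if_neg (Ne.symm hdb.1)]
        · have := hY v l (σ v) b (Ne.symm hb) hadj
          rw [hl' _ (mem_star_self _), if_neg hdσ.ne, zero_mul] at this
          exact (mul_eq_zero.1 this).resolve_left (by exact_mod_cast hσ v)
      rw [h2, zero_mul] at h1
      exact hbv (by exact_mod_cast h1)
    have := hF.1 b (σ v) hb hd
    subst this
    exact Or.inr ⟨rfl, hd⟩
  have hadj : ∀ u v, G.Adj u v → G.Adj (σ u) (σ v) := by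
    intro u v huv
    by_contra hn
    have hne : σ u ≠ σ v := fun h => huv.ne (σ.injective h)
    have h1 := hM u v huv _ _ hne hn
    have h2 : M (σ u) v * M (σ v) u ≠ 0 := h1 ▸ mul_ne_zero (hσ u) (hσ v)
    have h3 := (hdom _ _ (left_ne_zero_of_mul h2)).resolve_left hne
    have h4 := (hdom _ _ (right_ne_zero_of_mul h2)).resolve_left hne.symm
    exact hne (h3.1.trans h4.1.symm)
  have hσ1 : ∀ v, σ v = v :=
    hT ⟨σ, fun {u v} => ⟨adj_of_perm_adj σ hadj, hadj u v⟩⟩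
  intro b v h
  have := hdom b v h
  rwa [hσ1] at this

variable [Fintype V]

/-- The action of an automorphism on the abelianization. -/
def exMat (φ : MulAut (RAAG G)) : Matrix V V ℤ := fun a v => ex a (φ (gen G v))

theorem exMat_mul [DecidableEq V] (φ ψ : MulAut (RAAG G)) :
    exMat (φ * ψ) = exMat φ * exMat ψ := by
  ext a v
  rw [Matrix.mul_apply]
  exact ex_hom φ.toMonoidHom a (ψ (gen G v))

omit [Fintype V] in
theorem exMat_one [DecidableEq V] : exMat (1 : MulAut (RAAG G)) = 1 := by
  ext a v
  simp [exMat, ex_gen, Matrix.one_apply, eq_comm]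

theorem exMat_support {c : V} (hF : Focused G c) (hT : TrivialAut G) (φ : MulAut (RAAG G)) {b v : V}
    (h : ex b (φ (gen G v)) ≠ 0) : b = v ∨ b = c ∧ Dominates G c v := by
  classical
  refine matrix_support hF hT (M := exMat φ) (N := exMat φ⁻¹) ?_ ?_ b v h
  · rw [← exMat_mul, inv_mul_cancel, exMat_one]
  · intro v d hvd a b hab hadj
    exact ex_mul_ex_of_commute hab hadj ((commute_gen hvd).map φ.toMonoidHom)

/-- The sign with which an automorphism acts on each generator, modulo the others. -/
theorem ex_diag_mul {c : V} (hF : Focused G c) (hT : TrivialAut G) (φ ψ : MulAut (RAAG G)) (v : V) :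
    ex v ((φ * ψ) (gen G v)) = ex v (φ (gen G v)) * ex v (ψ (gen G v)) := by
  classical
  have := ex_hom φ.toMonoidHom v (ψ (gen G v))
  refine this.trans (Finset.sum_eq_single v ?_ (by simp))
  intro d _ hd
  by_contra h
  have h1 := (exMat_support hF hT φ (left_ne_zero_of_mul h)).resolve_left (Ne.symm hd)
  have h2 := (exMat_support hF hT ψ (right_ne_zero_of_mul h)).resolve_left hd
  exact hd (h2.1.trans h1.1.symm)

/-- The sign character of an automorphism. -/
def signs {c : V} (hF : Focused G c) (hT : TrivialAut G) : MulAut (RAAG G) →* (V → ℤˣ) :=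
  MonoidHom.toHomUnits
    (M := V → ℤ)
    { toFun := fun φ v => ex v (φ (gen G v))
      map_one' := by ext v; simp
      map_mul' := fun φ ψ => by ext v; exact ex_diag_mul hF hT φ ψ v } |> fun f =>
  (MulEquiv.piUnits (M := fun _ : V => ℤ)).toMonoidHom.comp f

theorem signs_apply {c : V} (hF : Focused G c) (hT : TrivialAut G) (φ : MulAut (RAAG G)) (v : V) :
    ((signs hF hT φ v : ℤˣ) : ℤ) = ex v (φ (gen G v)) := rfl

end Homology

section Crossed

variable {X : Type*} [AddCommGroup X] (ρ : RAAG G →* AddMonoid.End X) (d : V → X)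

omit [AddCommGroup X] in
theorem end_mul_apply [AddCommGroup X] (ρ : RAAG G →* AddMonoid.End X) (x y : RAAG G) (ξ : X) :
    ρ (x * y) ξ = ρ x (ρ y ξ) := by
  rw [map_mul]; rfl

omit [AddCommGroup X] in
theorem end_one_apply [AddCommGroup X] (ρ : RAAG G →* AddMonoid.End X) (ξ : X) : ρ 1 ξ = ξ := by
  rw [map_one]; rfl

/-- The affine permutation attached to a generator. -/
def affinePerm (v : V) : Equiv.Perm X where
  toFun ξ := d v + ρ (gen G v) ξ
  invFun ξ := ρ (gen G v)⁻¹ (ξ - d v)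
  left_inv ξ := by
    dsimp only
    rw [add_sub_cancel_left, ← end_mul_apply, inv_mul_cancel, end_one_apply]
  right_inv ξ := by
    dsimp only
    rw [← end_mul_apply, mul_inv_cancel, end_one_apply, add_sub_cancel]

theorem affinePerm_apply (v : V) (ξ : X) : affinePerm ρ d v ξ = d v + ρ (gen G v) ξ := rfl

/-- The affine action of a right-angled Artin group. -/
def affineHom (h : ∀ u v, G.Adj u v → d u + ρ (gen G u) (d v) = d v + ρ (gen G v) (d u)) :
    RAAG G →* Equiv.Perm X :=
  lift (affinePerm ρ d) fun u v huv => Equiv.ext fun ξ => by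
    simp only [Equiv.Perm.mul_apply, affinePerm_apply, map_add, ← add_assoc, h u v huv]
    rw [← end_mul_apply, ← end_mul_apply, (commute_gen huv).eq]

theorem affineHom_gen (h : ∀ u v, G.Adj u v → d u + ρ (gen G u) (d v) = d v + ρ (gen G v) (d u))
    (v : V) (ξ : X) : affineHom ρ d h (gen G v) ξ = d v + ρ (gen G v) ξ :=
  DFunLike.congr_fun (lift_gen (affinePerm ρ d) _ v) ξ

/-- The crossed homomorphism with prescribed values on the generators. -/
def crossed (h : ∀ u v, G.Adj u v → d u + ρ (gen G u) (d v) = d v + ρ (gen G v) (d u))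
    (x : RAAG G) : X :=
  affineHom ρ d h x 0

variable {ρ d} (h : ∀ u v, G.Adj u v → d u + ρ (gen G u) (d v) = d v + ρ (gen G v) (d u))

theorem crossed_gen (v : V) : crossed ρ d h (gen G v) = d v := by
  rw [crossed, affineHom_gen, map_zero, add_zero]

theorem crossed_mul (x y : RAAG G) :
    crossed ρ d h (x * y) = crossed ρ d h x + ρ x (crossed ρ d h y) := by
  have key : ∀ (x : RAAG G) (ξ : X), affineHom ρ d h x ξ = affineHom ρ d h x 0 + ρ x ξ := by
    intro x
    induction x using induction_left with
    | one => intro ξ; rw [map_one, end_one_apply]; simp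
    | mul v x ih =>
      intro ξ
      rw [map_mul, Equiv.Perm.mul_apply, Equiv.Perm.mul_apply, affineHom_gen, affineHom_gen, ih ξ,
        map_add, add_assoc, end_mul_apply]
    | inv v x ih =>
      intro ξ
      rw [map_mul, map_inv, Equiv.Perm.mul_apply, Equiv.Perm.mul_apply, Equiv.Perm.inv_eq_iff_eq,
        affineHom_gen, map_add, ← add_assoc, ← affineHom_gen ρ d h, ← Equiv.Perm.mul_apply,
        mul_inv_cancel, Equiv.Perm.one_apply, ← end_mul_apply, mul_inv_cancel_left, ih ξ]
  rw [crossed, map_mul, Equiv.Perm.mul_apply, key]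
  rfl

theorem crossed_one : crossed ρ d h 1 = 0 := by simp [crossed]

theorem crossed_inv (x : RAAG G) : crossed ρ d h x⁻¹ = -ρ x⁻¹ (crossed ρ d h x) := by
  have := crossed_mul h x⁻¹ x
  rw [inv_mul_cancel, crossed_one] at this
  exact eq_neg_of_add_eq_zero_left this.symm

end Crossed

section Cosets

/-- The link subgroup of a vertex. -/
def lkSub (G : SimpleGraph V) (v : V) : Subgroup (RAAG G) :=
  Subgroup.closure (gen G '' G.neighborSet v)

/-- The star subgroup of a vertex. -/
def stSub (G : SimpleGraph V) (v : V) : Subgroup (RAAG G) :=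
  Subgroup.closure (gen G '' star G v)

theorem gen_mem_lkSub {u v : V} (h : G.Adj u v) : gen G u ∈ lkSub G v :=
  Subgroup.subset_closure ⟨u, h.symm, rfl⟩

theorem gen_mem_stSub {u v : V} (h : u ∈ star G v) : gen G u ∈ stSub G v :=
  Subgroup.subset_closure ⟨u, h, rfl⟩

variable (K : V → Subgroup (RAAG G))

/-- Cosets of a family of subgroups indexed by the vertices. -/
abbrev Coset := Σ v, RAAG G ⧸ K v

/-- The coset of a group element, labelled by a vertex. -/
def coset (v : V) (x : RAAG G) : Coset K := ⟨v, x⟩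

theorem smul_coset (v : V) (x y : RAAG G) : x • coset K v y = coset K v (x * y) := rfl

theorem coset_eq_iff {u v : V} {x y : RAAG G} :
    coset K u x = coset K v y ↔ u = v ∧ x⁻¹ * y ∈ K u := by
  constructor
  · intro h
    obtain ⟨h1, h2⟩ := Sigma.mk.inj_iff.1 h
    subst h1
    exact ⟨rfl, QuotientGroup.eq.1 (eq_of_heq h2)⟩
  · rintro ⟨rfl, h⟩
    exact Sigma.ext rfl (heq_of_eq (QuotientGroup.eq.2 h))

theorem coset_eq_one_iff {u v : V} {x : RAAG G} :
    coset K u x = coset K v 1 ↔ u = v ∧ x ∈ K v := by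
  rw [coset_eq_iff]
  constructor
  · rintro ⟨rfl, h⟩; exact ⟨rfl, by simpa using h⟩
  · rintro ⟨rfl, h⟩; exact ⟨rfl, by simpa using h⟩

attribute [local instance] Finsupp.comapDistribMulAction

/-- The crossed homomorphism counting, with sign, crossings of cosets. -/
def cosetCount (h : ∀ u v, G.Adj u v → gen G u ∈ K v) : RAAG G → (Coset K →₀ ℤ) :=
  crossed (ρ := DistribMulAction.toAddMonoidEnd (RAAG G) (Coset K →₀ ℤ))
    (d := fun v => Finsupp.single (coset K v 1) 1) (by
    have key : ∀ u v, G.Adj u v → gen G u • Finsupp.single (coset K v 1) (1 : ℤ) =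
        Finsupp.single (coset K v 1) 1 := by
      intro u v huv
      rw [Finsupp.comapSMul_single, smul_coset, mul_one]
      congr 1
      exact (coset_eq_one_iff K).2 ⟨rfl, h u v huv⟩
    intro u v huv
    have h1 := key u v huv
    have h2 := key v u huv.symm
    exact (congrArg _ h1).trans ((add_comm _ _).trans (congrArg _ h2).symm))

variable {K} (h : ∀ u v, G.Adj u v → gen G u ∈ K v)

theorem cosetCount_mul (x y : RAAG G) :
    cosetCount K h (x * y) = cosetCount K h x + x • cosetCount K h y :=
  crossed_mul _ x y

theorem cosetCount_one : cosetCount K h 1 = 0 := crossed_one _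

theorem cosetCount_gen (v : V) : cosetCount K h (gen G v) = Finsupp.single (coset K v 1) 1 :=
  crossed_gen _ v

theorem cosetCount_mul_gen (x : RAAG G) (v : V) :
    cosetCount K h (x * gen G v) = cosetCount K h x + Finsupp.single (coset K v x) 1 := by
  rw [cosetCount_mul, cosetCount_gen, Finsupp.comapSMul_single, smul_coset, mul_one]

theorem cosetCount_mul_gen_inv (x : RAAG G) (v : V) :
    cosetCount K h (x * (gen G v)⁻¹) =
      cosetCount K h x - Finsupp.single (coset K v (x * (gen G v)⁻¹)) 1 := by
  have := cosetCount_mul_gen h (x * (gen G v)⁻¹) v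
  rw [inv_mul_cancel_right] at this
  rw [this, add_sub_cancel_right]

end Cosets

section Coord

attribute [local instance] Finsupp.comapDistribMulAction

/-- The signed count of crossings of the star coset of a vertex on the way to an element. -/
def coord (v : V) (x : RAAG G) : ℤ :=
  cosetCount (stSub G) (fun _ _ h => gen_mem_stSub (Or.inr h.symm)) x (coset (stSub G) v 1)

@[simp] theorem coord_one (v : V) : coord v (1 : RAAG G) = 0 := by
  simp [coord, cosetCount_one]

theorem coord_mul_left {v : V} {s : RAAG G} (hs : s ∈ stSub G v) (z : RAAG G) :
    coord v (s * z) = coord v s + coord v z := by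
  rw [coord, cosetCount_mul, Finsupp.add_apply, Finsupp.comapSMul_apply, smul_coset, mul_one]
  congr 2
  exact (coset_eq_one_iff _).2 ⟨rfl, inv_mem hs⟩

open Classical in
theorem coord_mul_gen (v u : V) (x : RAAG G) :
    coord v (x * gen G u) = coord v x + if u = v ∧ x ∈ stSub G v then 1 else 0 := by
  rw [coord, cosetCount_mul_gen, Finsupp.add_apply, Finsupp.single_apply]
  simp only [coset_eq_one_iff]
  rfl

open Classical in
theorem coord_mul_gen_inv (v u : V) (x : RAAG G) :
    coord v (x * (gen G u)⁻¹) = coord v x - if u = v ∧ x ∈ stSub G v then 1 else 0 := by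
  have := coord_mul_gen v u (x * (gen G u)⁻¹)
  rw [inv_mul_cancel_right] at this
  rw [this, eq_sub_iff_add_eq]
  congr 2
  refine propext (and_congr_right ?_)
  rintro rfl
  rw [Subgroup.mul_mem_cancel_right _ (inv_mem (gen_mem_stSub (mem_star_self _)))]

theorem coord_gen_self (v : V) : coord v (gen G v) = 1 := by
  simpa [one_mem] using coord_mul_gen v v (1 : RAAG G)

theorem coord_gen_ne {u v : V} (h : u ≠ v) : coord v (gen G u) = 0 := by
  simpa [h] using coord_mul_gen v u (1 : RAAG G)

theorem coord_mul_of_mem_closure {S : Set V} {w : V} (hw : w ∉ S) (y : RAAG G) {s : RAAG G}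
    (hs : s ∈ Subgroup.closure (gen G '' S)) : coord w (y * s) = coord w y := by
  induction hs using Subgroup.closure_induction_right with
  | one => simp
  | mul_right x hx z hz ih =>
    obtain ⟨v, hv, rfl⟩ := hz
    have : v ≠ w := fun h => hw (h ▸ hv)
    simpa [← mul_assoc, coord_mul_gen, this] using ih
  | mul_inv_cancel x hx z hz ih =>
    obtain ⟨v, hv, rfl⟩ := hz
    have : v ≠ w := fun h => hw (h ▸ hv)
    simpa [← mul_assoc, coord_mul_gen_inv, this] using ih

theorem coord_of_mem {v : V} {s : RAAG G} (hs : s ∈ stSub G v) : coord v s = ex v s := by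
  induction hs using Subgroup.closure_induction_left with
  | one => simp
  | mul_left x hx y hy ih =>
    obtain ⟨u, hu, rfl⟩ := hx
    rw [coord_mul_left (gen_mem_stSub hu), ih, ex_mul]
    by_cases h : u = v
    · subst h; simp [coord_gen_self]
    · simp [coord_gen_ne h, ex_gen_ne h]
  | inv_mul_cancel x hx y hy ih =>
    obtain ⟨u, hu, rfl⟩ := hx
    have h1 := coord_mul_left (gen_mem_stSub hu) ((gen G u)⁻¹ * y)
    rw [mul_inv_cancel_left, ih] at h1
    rw [ex_mul, ex_inv, h1]
    by_cases h : u = v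
    · subst h; simp [coord_gen_self]
    · simp [coord_gen_ne h, ex_gen_ne h]

theorem mem_stSub_of_commute {v : V} {x : RAAG G} (h : Commute x (gen G v)) : x ∈ stSub G v := by
  classical
  have h1 := coord_mul_gen v v x
  rw [h.eq, coord_mul_left (gen_mem_stSub (mem_star_self v)), coord_gen_self] at h1
  by_contra hx
  simp [hx] at h1

theorem commute_of_mem_stSub {v : V} {x : RAAG G} (h : x ∈ stSub G v) : Commute x (gen G v) := by
  have : stSub G v ≤ Subgroup.centralizer {gen G v} := by
    rw [stSub, Subgroup.closure_le]
    rintro _ ⟨u, hu, rfl⟩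
    rw [SetLike.mem_coe, Subgroup.mem_centralizer_singleton_iff]
    rcases hu with rfl | hu
    · rfl
    · exact (commute_gen hu).symm.eq
  have := this h
  rw [Subgroup.mem_centralizer_singleton_iff] at this
  exact this

end Coord

section Length

/-- The value of a letter. -/
def letter (G : SimpleGraph V) (l : V × Bool) : RAAG G :=
  if l.2 then gen G l.1 else (gen G l.1)⁻¹

/-- The value of a word. -/
def eval (G : SimpleGraph V) (L : List (V × Bool)) : RAAG G := (L.map (letter G)).prod

@[simp] theorem letter_true (v : V) : letter G (v, true) = gen G v := rfl

@[simp] theorem letter_false (v : V) : letter G (v, false) = (gen G v)⁻¹ := rfl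

@[simp] theorem eval_nil : eval G [] = 1 := rfl

@[simp] theorem eval_cons (l : V × Bool) (L : List (V × Bool)) :
    eval G (l :: L) = letter G l * eval G L := by simp [eval]

@[simp] theorem eval_append (L L' : List (V × Bool)) :
    eval G (L ++ L') = eval G L * eval G L' := by simp [eval]

theorem letter_ne_one (l : V × Bool) : letter G l ≠ 1 := by
  rcases l with ⟨v, _ | _⟩
  · simpa using gen_ne_one v
  · simpa using gen_ne_one v

theorem exists_eval (x : RAAG G) : ∃ L, eval G L = x := by
  induction x using induction_left with
  | one => exact ⟨[], rfl⟩
  | mul v x ih => obtain ⟨L, rfl⟩ := ih; exact ⟨(v, true) :: L, by simp⟩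
  | inv v x ih => obtain ⟨L, rfl⟩ := ih; exact ⟨(v, false) :: L, by simp⟩

/-- The word length with respect to the standard generators. -/
def len (x : RAAG G) : ℕ := sInf {n | ∃ L, eval G L = x ∧ L.length = n}

theorem exists_geodesic (x : RAAG G) : ∃ L, eval G L = x ∧ L.length = len x :=
  Nat.sInf_mem (s := {n | ∃ L, eval G L = x ∧ L.length = n})
    (let ⟨L, h⟩ := exists_eval x; ⟨L.length, L, h, rfl⟩)

theorem len_eval_le (L : List (V × Bool)) : len (eval G L) ≤ L.length :=
  Nat.sInf_le ⟨L, rfl, rfl⟩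

@[simp] theorem len_one : len (1 : RAAG G) = 0 := Nat.le_zero.1 (len_eval_le [])

theorem eq_one_of_len {x : RAAG G} (h : len x = 0) : x = 1 := by
  obtain ⟨L, rfl, hL⟩ := exists_geodesic x
  rw [h, List.length_eq_zero_iff] at hL
  rw [hL, eval_nil]

theorem exists_first_letter {x : RAAG G} (h : x ≠ 1) :
    ∃ l z, x = letter G l * z ∧ len z < len x := by
  obtain ⟨L, rfl, hL⟩ := exists_geodesic x
  cases L with
  | nil => exact absurd rfl h
  | cons l L =>
    refine ⟨l, eval G L, eval_cons _ _, ?_⟩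
    rw [← hL, List.length_cons]
    exact Nat.lt_succ_of_le (len_eval_le L)

theorem exists_increase (q : RAAG G → ℤ) (L : List (V × Bool)) :
    ∀ y, q y < q (y * eval G L) → ∃ L₁ l L₂, L = L₁ ++ l :: L₂ ∧
      q (y * eval G L₁) < q (y * eval G L₁ * letter G l) := by
  induction L with
  | nil => intro y h; simp at h
  | cons l L ih =>
    intro y h
    by_cases h1 : q y < q (y * letter G l)
    · exact ⟨[], l, L, rfl, by simpa using h1⟩
    · rw [eval_cons, ← mul_assoc] at h
      obtain ⟨L₁, l', L₂, rfl, h2⟩ := ih (y * letter G l) (lt_of_le_of_lt (not_lt.1 h1) h)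
      exact ⟨l :: L₁, l', L₂, rfl, by simpa [mul_assoc] using h2⟩

/-- If every step increasing `q` is also the left translation by `t`, then translating back an
element on which `q` exceeds `q 1` shortens it. -/
theorem len_lt_of_increase {q : RAAG G → ℤ} {t : RAAG G}
    (hq : ∀ y l, q y < q (y * letter G l) → y * letter G l = t * y) {y : RAAG G}
    (hy : q 1 < q y) : len (t⁻¹ * y) < len y := by
  obtain ⟨L, rfl, hL⟩ := exists_geodesic y
  obtain ⟨L₁, l, L₂, rfl, h⟩ := exists_increase q L 1 (by simpa using hy)
  rw [one_mul] at h
  have h1 : t⁻¹ * eval G (L₁ ++ l :: L₂) = eval G (L₁ ++ L₂) := by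
    rw [eval_append, eval_cons, ← mul_assoc (eval G L₁), hq _ _ h, eval_append]
    group
  rw [h1, ← hL]
  exact (len_eval_le _).trans_lt (by simp)

end Length

section Twist

/-- Parameters of a twist around `w`: conjugation exponents and multiplication exponents. -/
def TwistParam (G : SimpleGraph V) (w : V) : AddSubgroup ((V → ℤ) × (V → ℤ)) where
  carrier := {p | (∀ u v, G.Adj u v → u ∉ star G w → v ∉ star G w → p.1 u = p.1 v) ∧
    ∀ v, p.2 v ≠ 0 → v ≠ w ∧ Dominates G w v}
  zero_mem' := ⟨fun _ _ _ _ _ => rfl, fun _ h => absurd rfl h⟩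
  add_mem' := by
    rintro p p' ⟨h1, h2⟩ ⟨h1', h2'⟩
    refine ⟨fun u v h hu hv => ?_, fun v h => ?_⟩
    · simp [h1 u v h hu hv, h1' u v h hu hv]
    · by_cases h3 : p.2 v = 0
      · exact h2' v fun h4 => h (by simp [h3, h4])
      · exact h2 v h3
  neg_mem' := by
    rintro p ⟨h1, h2⟩
    exact ⟨fun u v h hu hv => by simp [h1 u v h hu hv], fun v h => h2 v (by simpa using h)⟩

/-- The image of a generator under a twist. -/
def twistFun (w : V) (p : (V → ℤ) × (V → ℤ)) (v : V) : RAAG G :=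
  gen G w ^ p.1 v * (gen G w ^ p.2 v * gen G v) * (gen G w ^ p.1 v)⁻¹

theorem twistFun_eq_of_commute {w v : V} (p : (V → ℤ) × (V → ℤ)) (h : v ∈ star G w) :
    twistFun w p v = gen G w ^ p.2 v * gen G v := by
  have h1 : Commute (gen G w) (gen G v) :=
    (commute_of_mem_stSub (gen_mem_stSub h)).symm
  rw [twistFun, mul_inv_eq_iff_eq_mul]
  exact ((((Commute.refl _).zpow_right _).mul_right h1).zpow_left _).eq

theorem twistFun_commute {w : V} {p : (V → ℤ) × (V → ℤ)} (hp : p ∈ TwistParam G w) {u v : V}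
    (huv : G.Adj u v) : Commute (twistFun (G := G) w p u) (twistFun w p v) := by
  have mixed : ∀ u v, G.Adj u v → u ∈ star G w → v ∉ star G w →
      Commute (twistFun (G := G) w p u) (twistFun w p v) := by
    intro u v huv hu hv
    have ha : p.2 u = 0 := by
      by_contra h
      exact hv ((hp.2 u h).2 huv)
    have h1 : Commute (gen G u) (gen G w) := commute_of_mem_stSub (gen_mem_stSub hu)
    rw [twistFun_eq_of_commute p hu, ha, zpow_zero, one_mul]
    exact (((h1.zpow_right _).mul_right ((h1.zpow_right _).mul_right
      (commute_gen huv))).mul_right (h1.zpow_right _).inv_right)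
  by_cases hu : u ∈ star G w
  · by_cases hv : v ∈ star G w
    · have h1 : Commute (gen G u) (gen G w) := commute_of_mem_stSub (gen_mem_stSub hu)
      have h2 : Commute (gen G v) (gen G w) := commute_of_mem_stSub (gen_mem_stSub hv)
      rw [twistFun_eq_of_commute p hu, twistFun_eq_of_commute p hv]
      exact ((((Commute.refl _).zpow_zpow _ _).mul_right (h2.symm.zpow_left _))).mul_left
        ((h1.zpow_right _).mul_right (commute_gen huv))
    · exact mixed u v huv hu hv
  · by_cases hv : v ∈ star G w
    · exact (mixed v u huv.symm hv hu).symm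
    · have ha : p.2 u = 0 := by
        by_contra h
        exact hv ((hp.2 u h).2 huv)
      have hb : p.2 v = 0 := by
        by_contra h
        exact hu ((hp.2 v h).2 huv.symm)
      simp only [twistFun, hp.1 u v huv hu hv, ha, hb, zpow_zero, one_mul]
      exact (Commute.conj_iff _).2 (commute_gen huv)

/-- The endomorphism underlying a twist. -/
def twistHom (w : V) (p : TwistParam G w) : RAAG G →* RAAG G :=
  lift (twistFun w p) fun _ _ h => twistFun_commute p.2 h

theorem twistHom_gen (w : V) (p : TwistParam G w) (v : V) :
    twistHom w p (gen G v) = twistFun w p v := lift_gen _ _ v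

theorem twistHom_comp (w : V) (p p' : TwistParam G w) :
    (twistHom w p).comp (twistHom w p') = twistHom w (p + p') := by
  have hw : twistHom w p (gen G w) = gen G w := by
    have : p.1.2 w = 0 := by
      by_contra h
      exact (p.2.2 w h).1 rfl
    rw [twistHom_gen, twistFun_eq_of_commute _ (mem_star_self w), this, zpow_zero, one_mul]
  refine hom_ext fun v => ?_
  rw [MonoidHom.comp_apply, twistHom_gen, twistFun]
  simp only [map_mul, map_inv, map_zpow, hw]
  rw [twistHom_gen, twistHom_gen]
  simp only [twistFun, AddSubgroup.coe_add, Prod.fst_add, Prod.snd_add, Pi.add_apply]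
  group

theorem twistHom_zero (w : V) : twistHom (G := G) w 0 = MonoidHom.id _ :=
  hom_ext fun v => by simp [twistHom_gen, twistFun]

/-- Twists around `w`, as a homomorphism from the group of parameters. -/
def twist (w : V) : Multiplicative (TwistParam G w) →* MulAut (RAAG G) where
  toFun p := MonoidHom.toMulEquiv (twistHom w p.toAdd) (twistHom w (-p.toAdd))
    (by rw [twistHom_comp, neg_add_cancel, twistHom_zero])
    (by rw [twistHom_comp, add_neg_cancel, twistHom_zero])
  map_one' := by ext x; exact DFunLike.congr_fun (twistHom_zero w) x
  map_mul' p p' := by ext x; exact (DFunLike.congr_fun (twistHom_comp w p.toAdd p'.toAdd) x).symm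

theorem twist_gen (w : V) (p : TwistParam G w) (v : V) :
    twist w (Multiplicative.ofAdd p) (gen G v) =
      gen G w ^ p.1.1 v * (gen G w ^ p.1.2 v * gen G v) * (gen G w ^ p.1.1 v)⁻¹ :=
  twistHom_gen w p v

end Twist

section Conjugating

/-- The automorphism `φ` conjugates each generator `v` by `g v`. -/
def IsConjData (φ : MulAut (RAAG G)) (g : V → RAAG G) : Prop :=
  ∀ v, φ (gen G v) = g v * gen G v * (g v)⁻¹

/-- The coordinate of the vertex `w`, seen from `g w`. -/
def relCoord (g : V → RAAG G) (w : V) (y : RAAG G) : ℤ := coord w ((g w)⁻¹ * y)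

variable {φ : MulAut (RAAG G)} {g : V → RAAG G}

theorem IsConjData.apply_eq_iff (hg : IsConjData φ g) {v : V} {y : RAAG G} :
    φ (gen G v) = y * gen G v * y⁻¹ ↔ (g v)⁻¹ * y ∈ stSub G v := by
  have : φ (gen G v) = y * gen G v * y⁻¹ ↔ Commute ((g v)⁻¹ * y) (gen G v) := by
    rw [hg v, commute_iff_eq, eq_mul_inv_iff_mul_eq, mul_assoc, mul_assoc, mul_assoc,
      ← eq_inv_mul_iff_mul_eq, eq_comm]
  rw [this]
  exact ⟨mem_stSub_of_commute, commute_of_mem_stSub⟩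

theorem IsConjData.ex_apply (hg : IsConjData φ g) (w : V) (z : RAAG G) : ex w (φ z) = ex w z := by
  induction z using induction_right with
  | one => simp
  | mul x v ih => simp [ih, hg v]
  | inv x v ih => simp [ih, hg v]

theorem IsConjData.relCoord_apply_mul (hg : IsConjData φ g) {w : V} {z : RAAG G}
    (hz : z ∈ stSub G w) (y : RAAG G) : relCoord g w (φ z * y) = relCoord g w y + ex w z := by
  have h1 : (g w)⁻¹ * φ z * g w ∈ stSub G w := by
    apply mem_stSub_of_commute
    have h2 : Commute (φ z) (φ (gen G w)) := (commute_of_mem_stSub hz).map φ.toMonoidHom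
    rw [hg w] at h2
    have := (Commute.conj_iff (g w)⁻¹).2 h2
    simpa [mul_assoc] using this
  have h2 : (g w)⁻¹ * (φ z * y) = ((g w)⁻¹ * φ z * g w) * ((g w)⁻¹ * y) := by group
  rw [relCoord, h2, coord_mul_left h1, coord_of_mem h1]
  simp only [ex_mul, ex_inv, hg.ex_apply, relCoord]
  ring

theorem relCoord_step {w : V} {y : RAAG G} {l : V × Bool}
    (h : relCoord g w (y * letter G l) ≠ relCoord g w y) : l.1 = w ∧ (g w)⁻¹ * y ∈ stSub G w := by
  by_contra hn
  apply h
  rcases l with ⟨u, _ | _⟩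
  · rw [letter_false, relCoord, ← mul_assoc, coord_mul_gen_inv, if_neg hn, sub_zero, relCoord]
  · rw [letter_true, relCoord, ← mul_assoc, coord_mul_gen, if_neg hn, add_zero, relCoord]

theorem IsConjData.len_lt_of_lt (hg : IsConjData φ g) {w : V} {y : RAAG G}
    (h : relCoord g w 1 < relCoord g w y) : len ((φ (gen G w))⁻¹ * y) < len y := by
  refine len_lt_of_increase (q := relCoord g w) (fun y l hl => ?_) h
  obtain ⟨h1, h2⟩ := relCoord_step hl.ne'
  rcases l with ⟨u, _ | _⟩
  · obtain rfl : u = w := h1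
    rw [letter_false, relCoord, relCoord, ← mul_assoc, coord_mul_gen_inv, if_pos ⟨rfl, h2⟩] at hl
    omega
  · obtain rfl : u = w := h1
    rw [letter_true, hg.apply_eq_iff.2 h2, inv_mul_cancel_right]

theorem IsConjData.len_lt_of_gt (hg : IsConjData φ g) {w : V} {y : RAAG G}
    (h : relCoord g w y < relCoord g w 1) : len (φ (gen G w) * y) < len y := by
  have := len_lt_of_increase (q := fun y => -relCoord g w y) (t := (φ (gen G w))⁻¹) (y := y)
    (fun y l hl => ?_) (by simpa using h)
  · rwa [inv_inv] at this
  obtain ⟨h1, h2⟩ := relCoord_step (neg_injective.ne_iff.1 hl.ne')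
  rcases l with ⟨u, _ | _⟩
  · obtain rfl : u = w := h1
    rw [letter_false, hg.apply_eq_iff.2 h2]
    group
  · obtain rfl : u = w := h1
    rw [letter_true, relCoord, relCoord, ← mul_assoc, coord_mul_gen, if_pos ⟨rfl, h2⟩] at hl
    omega

theorem IsConjData.relCoord_eq_of_mem (hg : IsConjData φ g) {v w : V} (hvw : v ∉ star G w)
    {y : RAAG G} (hy : φ (gen G v) = y * gen G v * y⁻¹) :
    relCoord g w y = relCoord g w (g v) := by
  have h1 := hg.apply_eq_iff.1 hy
  have := coord_mul_of_mem_closure (fun h => hvw (mem_star_comm.1 h)) ((g w)⁻¹ * g v) h1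
  rw [relCoord, relCoord, ← this]
  congr 1
  group

open Classical in
/-- The retraction onto a star subgroup. -/
def starRetract (G : SimpleGraph V) (v : V) : RAAG G →* RAAG G :=
  lift (fun u => if u ∈ star G v then gen G u else 1) fun a b h => by
    by_cases ha : a ∈ star G v <;> by_cases hb : b ∈ star G v <;>
      simp [ha, hb, commute_gen h]

theorem starRetract_mem (v : V) (x : RAAG G) : starRetract G v x ∈ stSub G v := by
  classical
  have h : ∀ u, starRetract G v (gen G u) ∈ stSub G v := fun u => by
    rw [starRetract, lift_gen]
    split_ifs with h
    · exact gen_mem_stSub h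
    · exact one_mem _
  induction x using induction_right with
  | one => simp
  | mul x u ih => rw [map_mul]; exact mul_mem ih (h u)
  | inv x u ih => rw [map_mul, map_inv]; exact mul_mem ih (inv_mem (h u))

theorem starRetract_of_mem {v : V} {x : RAAG G} (hx : x ∈ stSub G v) : starRetract G v x = x := by
  classical
  induction hx using Subgroup.closure_induction with
  | mem x hx => obtain ⟨u, hu, rfl⟩ := hx; rw [starRetract, lift_gen, if_pos hu]
  | one => simp
  | mul x y _ _ hx hy => rw [map_mul, hx, hy]
  | inv x _ hx => rw [map_inv, hx]

theorem IsConjData.relCoord_eq_of_adj (hg : IsConjData φ g) {w v v' : V} (hv : v ∉ star G w)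
    (hv' : v' ∉ star G w) (h : G.Adj v v') : relCoord g w (g v) = relCoord g w (g v') := by
  set a := (g v')⁻¹ * g v with ha
  have h1 : a * gen G v * a⁻¹ ∈ stSub G v' := by
    apply mem_stSub_of_commute
    have h2 : Commute (φ (gen G v)) (φ (gen G v')) := (commute_gen h).map φ.toMonoidHom
    rw [hg v, hg v'] at h2
    have := (Commute.conj_iff (g v')⁻¹).2 h2
    simpa [mul_assoc, ha] using this
  have h2 := starRetract_of_mem h1
  rw [map_mul, map_mul, map_inv, starRetract_of_mem (gen_mem_stSub (Or.inr h.symm))] at h2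
  set s := starRetract G v' a
  have h3 : φ (gen G v) = (g v' * s) * gen G v * (g v' * s)⁻¹ := by
    rw [hg v]
    have : (g v' * s) * gen G v * (g v' * s)⁻¹ = g v' * (s * gen G v * s⁻¹) * (g v')⁻¹ := by group
    rw [this, h2, ha]
    group
  have h4 : φ (gen G v') = (g v' * s) * gen G v' * (g v' * s)⁻¹ := by
    rw [hg.apply_eq_iff]
    simpa using starRetract_mem v' a
  rw [← hg.relCoord_eq_of_mem hv h3, hg.relCoord_eq_of_mem hv' h4]

end Conjugating

section Minimal

variable {φ : MulAut (RAAG G)} {g : V → RAAG G}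

theorem relCoord_eq_or_eq (hg : IsConjData φ g)
    (hsep : ∀ w v, v ∉ star G w → relCoord g w (g v) = relCoord g w 1) {u w : V}
    (huw : u ∉ star G w) (y : RAAG G) :
    relCoord g u y = relCoord g u 1 ∨ relCoord g w y = relCoord g w 1 := by
  have hwu : w ∉ star G u := fun h => huw (mem_star_comm.1 h)
  have aux : ∀ u w, u ∉ star G w → ∀ (y : RAAG G) l,
      relCoord g u (y * letter G l) ≠ relCoord g u y →
      relCoord g w y = relCoord g w 1 ∧ relCoord g w (y * letter G l) = relCoord g w 1 := by
    intro u w huw y l h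
    obtain ⟨h1, h2⟩ := relCoord_step h
    have h3 : (g u)⁻¹ * (y * letter G l) ∈ stSub G u := by
      rw [← mul_assoc]
      refine mul_mem h2 ?_
      rcases l with ⟨v, _ | _⟩
      · exact inv_mem (gen_mem_stSub (Or.inl h1))
      · exact gen_mem_stSub (Or.inl h1)
    rw [hg.relCoord_eq_of_mem huw (hg.apply_eq_iff.2 h2),
      hg.relCoord_eq_of_mem huw (hg.apply_eq_iff.2 h3)]
    exact ⟨hsep w u huw, hsep w u huw⟩
  have step : ∀ (y : RAAG G) l, (relCoord g u y = relCoord g u 1 ∨ relCoord g w y = relCoord g w 1) →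
      (relCoord g u (y * letter G l) = relCoord g u 1 ∨
        relCoord g w (y * letter G l) = relCoord g w 1) := by
    intro y l ih
    by_cases h1 : relCoord g u (y * letter G l) = relCoord g u y
    · by_cases h2 : relCoord g w (y * letter G l) = relCoord g w y
      · rwa [h1, h2]
      · exact Or.inl (aux w u hwu y l h2).2
    · exact Or.inr (aux u w huw y l h1).2
  induction y using induction_right with
  | one => exact Or.inl rfl
  | mul x v ih => exact step x (v, true) ih
  | inv x v ih => exact step x (v, false) ih

theorem isConjData_one : IsConjData (1 : MulAut (RAAG G)) (fun _ => 1) := fun v => by simp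

theorem coord_eq_zero_or {u w : V} (huw : u ∉ star G w) (y : RAAG G) :
    coord u y = 0 ∨ coord w y = 0 := by
  simpa [relCoord] using relCoord_eq_or_eq (isConjData_one (G := G)) (fun _ _ _ => rfl) huw y

/-- The sign of a letter. -/
def letterSign (l : V × Bool) : ℤ := if l.2 then 1 else -1

theorem letterSign_ne_zero (l : V × Bool) : letterSign l ≠ 0 := by
  rcases l with ⟨u, _ | _⟩ <;> simp [letterSign]

theorem ex_letter_self (l : V × Bool) : ex l.1 (letter G l) = letterSign l := by
  rcases l with ⟨u, _ | _⟩ <;> simp [letterSign]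

theorem letter_mem_stSub {l : V × Bool} {w : V} (h : l.1 ∈ star G w) : letter G l ∈ stSub G w := by
  rcases l with ⟨u, _ | _⟩
  · exact inv_mem (gen_mem_stSub h)
  · exact gen_mem_stSub h

theorem coord_ne_zero_of_geodesic {l : V × Bool} {z : RAAG G} (h : len z < len (letter G l * z)) :
    coord l.1 (letter G l * z) ≠ 0 := by
  intro h0
  rw [coord_mul_left (letter_mem_stSub (mem_star_self _)),
    coord_of_mem (letter_mem_stSub (mem_star_self _)), ex_letter_self] at h0
  rcases l with ⟨u, _ | _⟩
  · have := isConjData_one.len_lt_of_lt (G := G) (w := u) (y := z) (by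
      simp [relCoord]; simp [letterSign] at h0; omega)
    simp at this h
    omega
  · have := isConjData_one.len_lt_of_gt (G := G) (w := u) (y := z) (by
      simp [relCoord]; simp [letterSign] at h0; omega)
    simp at this h
    omega

theorem exists_coord_ne_zero {z : RAAG G} (hz : z ≠ 1) : ∃ w, coord w z ≠ 0 := by
  obtain ⟨l, z, rfl, h⟩ := exists_first_letter hz
  exact ⟨l.1, coord_ne_zero_of_geodesic h⟩

theorem relCoord_apply (hg : IsConjData φ g)
    (hsep : ∀ w v, v ∉ star G w → relCoord g w (g v) = relCoord g w 1) (z : RAAG G) (w : V) :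
    relCoord g w (φ z) = relCoord g w 1 + coord w z := by
  induction hn : len z using Nat.strong_induction_on generalizing z w with
  | _ n ih =>
  by_cases hz : z = 1
  · simp [hz]
  obtain ⟨l, z, rfl, h⟩ := exists_first_letter hz
  subst hn
  have main : ∀ w, l.1 ∈ star G w →
      relCoord g w (φ (letter G l * z)) = relCoord g w 1 + coord w (letter G l * z) := by
    intro w hw
    rw [map_mul, hg.relCoord_apply_mul (letter_mem_stSub hw), ih _ h _ _ rfl,
      coord_mul_left (letter_mem_stSub hw), coord_of_mem (letter_mem_stSub hw)]
    ring
  by_cases hw : l.1 ∈ star G w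
  · exact main w hw
  have h1 := main l.1 (mem_star_self _)
  have h2 := coord_ne_zero_of_geodesic h
  rw [(coord_eq_zero_or hw _).resolve_left h2, add_zero]
  refine (relCoord_eq_or_eq hg hsep hw _).resolve_left ?_
  rw [h1]
  omega

theorem conjugators_eq_one (hg : IsConjData φ g)
    (hsep : ∀ w v, v ∉ star G w → relCoord g w (g v) = relCoord g w 1)
    (hmin : ∀ v h, φ (gen G v) = h * gen G v * h⁻¹ → len (g v) ≤ len h) (v : V) : g v = 1 := by
  by_contra hv
  obtain ⟨l, y, hy, hlen⟩ := exists_first_letter hv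
  have hz : φ.symm (letter G l) ≠ 1 := fun h => letter_ne_one l (by simpa using congrArg φ h)
  obtain ⟨w, hw⟩ := exists_coord_ne_zero hz
  have h1 := relCoord_apply hg hsep (φ.symm (letter G l)) w
  rw [MulEquiv.apply_symm_apply] at h1
  have h2 : relCoord g w (1 * letter G l) ≠ relCoord g w 1 := by
    rw [one_mul, h1]
    omega
  obtain ⟨rfl, h3⟩ := relCoord_step h2
  have h4 : φ (gen G l.1) = gen G l.1 := by simpa using hg.apply_eq_iff.2 h3
  have h5 : φ (letter G l) = letter G l := by
    rcases l with ⟨u, _ | _⟩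
    · simpa using h4
    · exact h4
  rcases eq_or_ne v l.1 with rfl | hne
  · have := hmin l.1 1 (by simpa using h4)
    rw [len_one, Nat.le_zero] at this
    exact hv (eq_one_of_len this)
  by_cases hst : v ∈ star G l.1
  · have hc : Commute (letter G l) (φ (gen G v)) := by
      rw [← h5]
      have : Commute (letter G l) (gen G v) :=
        commute_of_mem_stSub (letter_mem_stSub (mem_star_comm.1 hst))
      exact this.map φ.toMonoidHom
    have := hmin v y (by
      have h6 := hg v
      rw [hy] at h6
      have h7 : φ (gen G v) = (letter G l)⁻¹ * φ (gen G v) * letter G l := by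
        rw [mul_assoc, ← hc.eq, inv_mul_cancel_left]
      rw [h7, h6]
      group)
    omega
  · have h6 := hsep _ _ hst
    have h7 := hg.relCoord_apply_mul (letter_mem_stSub (mem_star_self l.1)) y
    rw [h5, ← hy, h6, ex_letter_self] at h7
    rcases l with ⟨u, _ | _⟩
    · have h8 := hg.len_lt_of_lt (w := u) (y := y) (by simp [letterSign] at h7; omega)
      dsimp only at h4
      rw [h4] at h8
      rw [letter_false] at hy
      rw [← hy] at h8
      omega
    · have h8 := hg.len_lt_of_gt (w := u) (y := y) (by simp [letterSign] at h7; omega)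
      dsimp only at h4
      rw [h4] at h8
      rw [letter_true] at hy
      rw [← hy] at h8
      omega

end Minimal

section PartialConj

theorem _root_.IsCompOf.mem_of_adj {S P : Set V} (hP : IsCompOf G S P) {u v : V} (hu : u ∈ P)
    (h : G.Adj u v) (hv : v ∈ S) : v ∈ P := by
  obtain ⟨x, rfl⟩ := hP
  obtain ⟨y, hy, rfl⟩ := hu
  refine ⟨⟨v, hv⟩, hy.trans ?_, rfl⟩
  exact SimpleGraph.Adj.reachable h

theorem eq_of_reachable_induce {S : Set V} {X : Type*} {f : V → X}
    (hf : ∀ u v, G.Adj u v → u ∈ S → v ∈ S → f u = f v) {x y : S}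
    (h : (G.induce S).Reachable x y) : f x = f y := by
  obtain ⟨p⟩ := h
  induction p with
  | nil => rfl
  | cons h _ ih => exact (hf _ _ h (Subtype.coe_prop _) (Subtype.coe_prop _)).trans ih

theorem _root_.IsCompOf.eq_of_mem {S P : Set V} (hP : IsCompOf G S P) {X : Type*} {f : V → X}
    (hf : ∀ u v, G.Adj u v → u ∈ S → v ∈ S → f u = f v) {u v : V} (hu : u ∈ P) (hv : v ∈ P) :
    f u = f v := by
  obtain ⟨x, rfl⟩ := hP
  obtain ⟨y, hy, rfl⟩ := hu
  obtain ⟨z, hz, rfl⟩ := hv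
  exact (eq_of_reachable_induce hf hy).symm.trans (eq_of_reachable_induce hf hz)

open Classical in
/-- The twist parameter of a multiple of a partial conjugation. -/
def compParam {w : V} {P : Set V} (hP : IsCompOf G (star G w)ᶜ P) (e : ℤ) : TwistParam G w :=
  ⟨(fun v => if v ∈ P then e else 0, 0), fun u v h hu hv => by
    have : u ∈ P ↔ v ∈ P := ⟨fun hp => hP.mem_of_adj hp h hv, fun hp => hP.mem_of_adj hp h.symm hu⟩
    simp only [this], fun v h => absurd rfl h⟩

theorem isPartialConj_twist {w : V} {P : Set V} (hP : IsCompOf G (star G w)ᶜ P) :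
    IsPartialConj G (twist w (Multiplicative.ofAdd (compParam hP 1))) w P := by
  refine ⟨hP, fun u hu => ?_, fun u hu => ?_⟩ <;> simp [twist_gen, compParam, hu]

theorem twist_compParam_mem {w : V} {P : Set V} (hP : IsCompOf G (star G w)ᶜ P) (e : ℤ) :
    twist w (Multiplicative.ofAdd (compParam hP e)) ∈
      Subgroup.closure {χ : MulAut (RAAG G) | ∃ v P, IsPartialConj G χ v P} := by
  have : compParam hP e = e • compParam hP 1 := by
    ext v <;> simp [compParam]
  rw [this, ofAdd_zsmul, map_zpow]
  refine zpow_mem (Subgroup.subset_closure ?_) e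
  exact ⟨w, P, isPartialConj_twist hP⟩

theorem isCompOf_of_notMem {w v : V} (hv : v ∉ star G w) :
    ∃ P, IsCompOf G (star G w)ᶜ P ∧ v ∈ P :=
  let x : ((star G w)ᶜ : Set V) := ⟨v, hv⟩
  ⟨Subtype.val '' {y | (G.induce (star G w)ᶜ).Reachable x y}, ⟨x, rfl⟩,
    x, SimpleGraph.Reachable.refl _, rfl⟩

/-- An automorphism conjugating every generator is a product of partial conjugations. -/
theorem IsConjData.mem_closure [Fintype V] {φ : MulAut (RAAG G)} {g : V → RAAG G}
    (hg : IsConjData φ g) :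
    φ ∈ Subgroup.closure {χ : MulAut (RAAG G) | ∃ v P, IsPartialConj G χ v P} := by
  classical
  induction hn : ∑ v, len (g v) using Nat.strong_induction_on generalizing φ g with
  | _ n ih =>
  subst hn
  by_cases hmin : ∀ v h, φ (gen G v) = h * gen G v * h⁻¹ → len (g v) ≤ len h
  swap
  · push Not at hmin
    obtain ⟨v, h, hv, hlt⟩ := hmin
    refine ih _ ?_ (g := Function.update g v h) (fun u => ?_) rfl
    · refine Finset.sum_lt_sum (fun u _ => ?_) ⟨v, Finset.mem_univ v, by simpa using hlt⟩
      rcases eq_or_ne u v with rfl | hu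
      · simpa using hlt.le
      · simp [hu]
    · rcases eq_or_ne u v with rfl | hu
      · simpa using hv
      · simpa [hu] using hg u
  by_cases hsep : ∀ w v, v ∉ star G w → relCoord g w (g v) = relCoord g w 1
  · have h1 := conjugators_eq_one hg hsep hmin
    have : φ = 1 := mulAut_ext fun v => by simp [hg v, h1 v]
    rw [this]
    exact one_mem _
  push Not at hsep
  obtain ⟨w, v, hv, hne⟩ := hsep
  obtain ⟨P, hP, hvP⟩ := isCompOf_of_notMem hv
  have hconst : ∀ u ∈ P, relCoord g w (g u) = relCoord g w (g v) := fun u hu =>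
    hP.eq_of_mem (f := fun u => relCoord g w (g u))
      (fun a b hab ha hb => hg.relCoord_eq_of_adj ha hb hab) hu hvP
  obtain ⟨e, he⟩ : ∃ e : ℤ, ∀ u ∈ P, len (φ (gen G w) ^ e * g u) < len (g u) := by
    rcases lt_or_gt_of_ne hne with h | h
    · exact ⟨1, fun u hu => by
        rw [zpow_one]; exact hg.len_lt_of_gt ((hconst u hu).trans_lt h)⟩
    · exact ⟨-1, fun u hu => by
        rw [zpow_neg_one]; exact hg.len_lt_of_lt (h.trans_eq (hconst u hu).symm)⟩
  have key := ih _ ?_ (φ := φ * twist w (Multiplicative.ofAdd (compParam hP e)))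
    (g := fun u => if u ∈ P then φ (gen G w) ^ e * g u else g u) (fun u => ?_) rfl
  · exact (Subgroup.mul_mem_cancel_right _ (twist_compParam_mem hP e)).1 key
  · refine Finset.sum_lt_sum (fun u _ => ?_) ⟨v, Finset.mem_univ v, by simpa [hvP] using he v hvP⟩
    by_cases hu : u ∈ P
    · simpa [hu] using (he u hu).le
    · simp [hu]
  · rw [MulAut.mul_apply, twist_gen]
    by_cases hu : u ∈ P
    · simp [compParam, hu, hg u, mul_assoc]
    · simp [compParam, hu, hg u]

end PartialConj

section Path

/-- The partial products of a sequence of letters. -/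
def pathProd (G : SimpleGraph V) (f : ℕ → V × Bool) : ℕ → RAAG G
  | 0 => 1
  | k + 1 => pathProd G f k * letter G (f k)

/-- The index of the vertex of the path from which the wall crossed at step `k` is based. -/
def baseIdx (f : ℕ → V × Bool) (k : ℕ) : ℕ := if (f k).2 then k else k + 1

/-- The wall crossed at step `k`. -/
def wall (G : SimpleGraph V) (f : ℕ → V × Bool) (k : ℕ) : Coset (lkSub G) :=
  coset (lkSub G) (f k).1 (pathProd G f (baseIdx f k))

variable {f : ℕ → V × Bool}

theorem pathProd_zero : pathProd G f 0 = 1 := rfl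

theorem pathProd_succ (k : ℕ) : pathProd G f (k + 1) = pathProd G f k * letter G (f k) := rfl

theorem len_pathProd_le (a n : ℕ) : len ((pathProd G f a)⁻¹ * pathProd G f (a + n)) ≤ n := by
  have : ∃ L, eval G L = (pathProd G f a)⁻¹ * pathProd G f (a + n) ∧ L.length = n := by
    induction n with
    | zero => exact ⟨[], by simp, rfl⟩
    | succ n ih =>
      obtain ⟨L, h1, h2⟩ := ih
      refine ⟨L ++ [f (a + n)], ?_, by simp [h2]⟩
      rw [eval_append, h1, ← add_assoc, pathProd_succ]
      simp [mul_assoc]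
  obtain ⟨L, h1, h2⟩ := this
  rw [← h1]
  exact (len_eval_le L).trans_eq h2

attribute [local instance] Finsupp.comapDistribMulAction

/-- The signed count of link cosets. -/
def wallCount : RAAG G → (Coset (lkSub G) →₀ ℤ) := cosetCount (lkSub G) fun _ _ h => gen_mem_lkSub h

theorem wallCount_mul (x y : RAAG G) : wallCount (x * y) = wallCount x + x • wallCount y :=
  cosetCount_mul _ x y

theorem wallCount_succ (k : ℕ) : wallCount (pathProd G f (k + 1)) =
    wallCount (pathProd G f k) + Finsupp.single (wall G f k) (letterSign (f k)) := by
  rcases h : f k with ⟨v, _ | _⟩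
  · rw [pathProd_succ, h, letter_false, wallCount, cosetCount_mul_gen_inv, wall, baseIdx, h]
    simp [letterSign, sub_eq_add_neg, pathProd_succ, h]
  · rw [pathProd_succ, h, letter_true, wallCount, cosetCount_mul_gen, wall, baseIdx, h]
    simp [letterSign]

theorem wallCount_add (a n : ℕ) : wallCount (pathProd G f (a + n)) = wallCount (pathProd G f a) +
    ∑ k ∈ Finset.range n, Finsupp.single (wall G f (a + k)) (letterSign (f (a + k))) := by
  induction n with
  | zero => simp
  | succ n ih => rw [← add_assoc, wallCount_succ, ih, Finset.sum_range_succ, add_assoc]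

theorem sum_single_apply {X : Type*} {n : ℕ} {F : ℕ → X} {s : ℕ → ℤ}
    (hF : ∀ i < n, ∀ j < n, F i = F j → i = j) {k : ℕ} (hk : k < n) :
    (∑ i ∈ Finset.range n, Finsupp.single (F i) (s i)) (F k) = s k := by
  classical
  rw [Finsupp.finsetSum_apply, Finset.sum_eq_single k]
  · simp
  · intro i hi hik
    rw [Finsupp.single_apply, if_neg fun h => hik (hF i (Finset.mem_range.1 hi) k hk h)]
  · intro h
    exact absurd (Finset.mem_range.2 hk) h

theorem wallCount_support {S : Set V} {m : RAAG G} (hm : m ∈ Subgroup.closure (gen G '' S))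
    {X : Coset (lkSub G)} (hX : wallCount m X ≠ 0) : X.1 ∈ S := by
  classical
  by_contra hn
  apply hX
  clear hX
  induction hm using Subgroup.closure_induction_right with
  | one => simp [wallCount, cosetCount_one]
  | mul_right x hx z hz ih =>
    obtain ⟨v, hv, rfl⟩ := hz
    rw [wallCount, cosetCount_mul_gen, Finsupp.add_apply, Finsupp.single_apply, if_neg, add_zero]
    · exact ih
    · rintro rfl; exact hn hv
  | mul_inv_cancel x hx z hz ih =>
    obtain ⟨v, hv, rfl⟩ := hz
    rw [wallCount, cosetCount_mul_gen_inv, Finsupp.sub_apply, Finsupp.single_apply, if_neg, sub_zero]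
    · exact ih
    · rintro rfl; exact hn hv

theorem adj_of_mem_lkSub {v : V} {a n : ℕ}
    (hm : (pathProd G f a)⁻¹ * pathProd G f (a + n) ∈ lkSub G v)
    (hinj : ∀ i < n, ∀ j < n, wall G f (a + i) = wall G f (a + j) → i = j) {k : ℕ} (hk : k < n) :
    G.Adj v (f (a + k)).1 := by
  have h1 := wallCount_mul (pathProd G f a) ((pathProd G f a)⁻¹ * pathProd G f (a + n))
  rw [mul_inv_cancel_left, wallCount_add, add_right_inj] at h1
  have h2 := sum_single_apply (s := fun i => letterSign (f (a + i))) hinj hk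
  rw [h1, Finsupp.comapSMul_apply] at h2
  have h3 := wallCount_support hm (by rw [h2]; exact letterSign_ne_zero _)
  exact h3

theorem mem_lkSub_of_wall_eq {i j : ℕ} (h : wall G f i = wall G f j) :
    (f i).1 = (f j).1 ∧
      (pathProd G f (baseIdx f i))⁻¹ * pathProd G f (baseIdx f j) ∈ lkSub G (f i).1 :=
  (coset_eq_iff _).1 h

theorem commute_of_mem_lkSub {v : V} {x : RAAG G} (h : x ∈ lkSub G v) : Commute x (gen G v) :=
  commute_of_mem_stSub (Subgroup.closure_mono (Set.image_mono fun _ hu => Or.inr hu) h)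

/-- Two closest crossings of the same wall are in opposite directions, with all the letters in
between commuting with them. -/
theorem closest_crossings {i n : ℕ} (h : wall G f i = wall G f (i + 1 + n))
    (hmin : ∀ a b, a < b → b - a < n + 1 → wall G f a ≠ wall G f b) :
    (f i).1 = (f (i + 1 + n)).1 ∧ (f i).2 ≠ (f (i + 1 + n)).2 ∧
      (pathProd G f (i + 1))⁻¹ * pathProd G f (i + 1 + n) ∈ lkSub G (f i).1 ∧
      ∀ k < n, G.Adj (f i).1 (f (i + 1 + k)).1 := by
  have hinj : ∀ a, ∀ i < n + 1, ∀ j < n + 1, wall G f (a + i) = wall G f (a + j) → i = j := by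
    intro a i hi j hj hij
    rcases lt_trichotomy i j with h | h | h
    · exact absurd hij (hmin _ _ (by omega) (by omega))
    · exact h
    · exact absurd hij.symm (hmin _ _ (by omega) (by omega))
  obtain ⟨h1, h2⟩ := mem_lkSub_of_wall_eq h
  have hmid : (pathProd G f (i + 1))⁻¹ * pathProd G f (i + 1 + n) ∈ lkSub G (f i).1 →
      ∀ k < n, G.Adj (f i).1 (f (i + 1 + k)).1 := fun hm k hk =>
    adj_of_mem_lkSub hm (fun i hi j hj => hinj _ i (by omega) j (by omega)) hk
  refine ⟨h1, ?_⟩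
  rcases hi : (f i).2 with _ | _ <;> rcases hj : (f (i + 1 + n)).2 with _ | _
  · simp only [baseIdx, hi, hj] at h2
    have := adj_of_mem_lkSub (a := i + 1) (n := n + 1) h2 (hinj _) (Nat.lt_succ_self n)
    rw [h1] at this
    exact absurd this (G.irrefl)
  · simp only [baseIdx, hi, hj] at h2
    exact ⟨by simp, h2, hmid h2⟩
  · simp only [baseIdx, hi, hj] at h2
    change (pathProd G f i)⁻¹ * pathProd G f (i + 1 + n + 1) ∈ _ at h2
    have h3 : (pathProd G f (i + 1))⁻¹ * pathProd G f (i + 1 + n) ∈ lkSub G (f i).1 := by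
      have hl : letter G (f i) = gen G (f i).1 := by simp [letter, hi]
      have hl' : letter G (f (i + 1 + n)) = (gen G (f i).1)⁻¹ := by simp [letter, hj, h1]
      have h4 := (commute_of_mem_lkSub h2).eq
      have h5 : (pathProd G f i)⁻¹ * pathProd G f (i + 1 + n + 1) = gen G (f i).1 *
          ((pathProd G f (i + 1))⁻¹ * pathProd G f (i + 1 + n)) * (gen G (f i).1)⁻¹ := by
        rw [pathProd_succ (i + 1 + n), pathProd_succ i, hl, hl']
        group
      have h6 : (pathProd G f (i + 1))⁻¹ * pathProd G f (i + 1 + n) =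
          (gen G (f i).1)⁻¹ * ((pathProd G f i)⁻¹ * pathProd G f (i + 1 + n + 1) *
            gen G (f i).1) := by
        rw [h5]
        group
      rw [h6, h4, inv_mul_cancel_left]
      exact h2
    exact ⟨by simp, h3, hmid h3⟩
  · simp only [baseIdx, hi, hj] at h2
    have := adj_of_mem_lkSub (a := i) (n := n + 1) (v := (f i).1)
      (by simpa [add_assoc, add_comm 1 n] using h2) (hinj _) (Nat.succ_pos n)
    exact absurd this (G.irrefl)

end Path

theorem len_mul_le (x y : RAAG G) : len (x * y) ≤ len x + len y := by
  obtain ⟨L, rfl, hL⟩ := exists_geodesic x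
  obtain ⟨L', rfl, hL'⟩ := exists_geodesic y
  rw [← eval_append, ← hL, ← hL', ← List.length_append]
  exact len_eval_le _

theorem letter_mul_letter {l l' : V × Bool} (h1 : l.1 = l'.1) (h2 : l.2 ≠ l'.2) :
    letter G l * letter G l' = 1 := by
  rcases l with ⟨u, _ | _⟩ <;> rcases l' with ⟨u', _ | _⟩ <;> simp_all

section Periodic

variable {f : ℕ → V × Bool} {ℓ : ℕ} (hf : ∀ k, f (k + ℓ) = f k)

include hf

theorem pathProd_add_period (k : ℕ) :
    pathProd G f (k + ℓ) = pathProd G f ℓ * pathProd G f k := by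
  induction k with
  | zero => simp [pathProd_zero]
  | succ k ih => rw [add_right_comm, pathProd_succ, ih, hf, pathProd_succ, mul_assoc]

theorem wall_add_period (k : ℕ) : wall G f (k + ℓ) = pathProd G f ℓ • wall G f k := by
  rw [wall, wall, smul_coset, ← pathProd_add_period hf, hf, baseIdx, hf, baseIdx]
  congr 2
  split_ifs <;> omega

theorem wall_add_mul_period (k a : ℕ) :
    wall G f (k + a * ℓ) = pathProd G f ℓ ^ a • wall G f k := by
  induction a with
  | zero => simp
  | succ a ih => rw [add_mul, one_mul, ← add_assoc, wall_add_period hf, ih, pow_succ', mul_smul]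

variable (hℓ : 0 < ℓ) (hmin : ∀ h, ℓ ≤ len (h⁻¹ * pathProd G f ℓ * h))

include hℓ hmin

theorem wall_injective : Function.Injective (wall G f) := by
  classical
  have key : ¬∃ n i, wall G f i = wall G f (i + 1 + n) := by
    intro hex
    obtain ⟨i, hi⟩ := Nat.find_spec hex
    have hn := fun m hm => Nat.find_min hex (m := m) hm
    generalize Nat.find hex = n at hi hn
    obtain ⟨h1, h2, h3, h4⟩ := closest_crossings hi fun a b hab hlt h =>
      hn (b - a - 1) (by omega) ⟨a, by rw [h]; congr 1; omega⟩
    rcases lt_trichotomy (n + 1) ℓ with hlt | heq | hgt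
    · have h5 : (pathProd G f i)⁻¹ * pathProd G f ℓ * pathProd G f i =
          ((pathProd G f (i + 1))⁻¹ * pathProd G f (i + 1 + n)) *
          ((pathProd G f (i + 1 + n + 1))⁻¹ *
            pathProd G f (i + 1 + n + 1 + (ℓ - n - 2))) := by
        have e1 : i + 1 + n + 1 + (ℓ - n - 2) = i + ℓ := by omega
        have e2 : Commute ((pathProd G f (i + 1))⁻¹ * pathProd G f (i + 1 + n))
            (letter G (f i)) := by
          have := commute_of_mem_lkSub h3
          rcases hl : f i with ⟨u, _ | _⟩
          · rw [hl] at this h3; exact this.inv_right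
          · rw [hl] at this; exact this
        have e3 := letter_mul_letter (G := G) h1 h2
        rw [e1, pathProd_add_period hf, pathProd_succ (i + 1 + n)]
        have e4 : (pathProd G f (i + 1))⁻¹ * pathProd G f (i + 1 + n) =
            (pathProd G f i)⁻¹ * pathProd G f (i + 1 + n) * letter G (f (i + 1 + n)) := by
          have e5 : (pathProd G f i)⁻¹ = letter G (f i) * (pathProd G f (i + 1))⁻¹ := by
            rw [pathProd_succ]; group
          rw [e5, mul_assoc (letter G (f i)), ← e2.eq, mul_assoc, e3, mul_one]
        rw [e4]
        group
      have h6 := hmin (pathProd G f i)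
      rw [h5] at h6
      have := len_mul_le ((pathProd G f (i + 1))⁻¹ * pathProd G f (i + 1 + n))
        ((pathProd G f (i + 1 + n + 1))⁻¹ * pathProd G f (i + 1 + n + 1 + (ℓ - n - 2)))
      have := len_pathProd_le (G := G) (f := f) (i + 1) n
      have := len_pathProd_le (G := G) (f := f) (i + 1 + n + 1) (ℓ - n - 2)
      omega
    · apply h2
      rw [add_assoc, add_comm 1 n, heq, hf]
    · have := h4 (ℓ - 1) (by omega)
      rw [show i + 1 + (ℓ - 1) = i + ℓ by omega, hf] at this
      exact G.irrefl this
  intro i j hij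
  by_contra hne
  rcases lt_or_gt_of_ne hne with h | h
  · exact key ⟨j - i - 1, i, by rw [hij]; congr 1; omega⟩
  · exact key ⟨i - j - 1, j, by rw [← hij]; congr 1; omega⟩

attribute [local instance] Finsupp.comapDistribMulAction

/-- Some power of an element of the centralizer of a cyclically reduced element preserves, up to
translation along the axis, a given wall crossed by the axis. -/
theorem exists_pow_smul_wall {y : RAAG G} (hy : Commute y (pathProd G f ℓ)) {k : ℕ} (hk : k < ℓ) :
    ∃ m : ℕ, 0 < m ∧ ∃ a : ℤ, y ^ m • wall G f k = pathProd G f ℓ ^ a • wall G f k := by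
  classical
  set w := pathProd G f ℓ with hw
  let π : Coset (lkSub G) → MulAction.orbitRel.Quotient (Subgroup.zpowers w) (Coset (lkSub G)) :=
    Quotient.mk''
  have hπ : ∀ X Y, π X = π Y → ∃ a : ℤ, X = w ^ a • Y := by
    intro X Y h
    obtain ⟨⟨_, a, rfl⟩, ha⟩ := Quotient.exact' h
    exact ⟨a, ha.symm⟩
  have hπw : ∀ X, π (w • X) = π X := fun X =>
    Quotient.sound' ⟨⟨w, Subgroup.mem_zpowers w⟩, rfl⟩
  have hinj : ∀ i < ℓ, ∀ j < ℓ, π (wall G f i) = π (wall G f j) → i = j := by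
    have aux : ∀ i < ℓ, ∀ j < ℓ, ∀ a : ℕ, wall G f i = w ^ a • wall G f j → i = j := by
      intro i hi j hj a h
      rw [← wall_add_mul_period hf] at h
      have := wall_injective hf hℓ hmin h
      rcases a with _ | a
      · simpa using this
      · rw [add_mul] at this; omega
    intro i hi j hj h
    obtain ⟨a, ha⟩ := hπ _ _ h
    obtain ⟨n, rfl | rfl⟩ := a.eq_nat_or_neg
    · exact aux i hi j hj n (by simpa using ha)
    · refine (aux j hj i hi n ?_).symm
      rw [ha, ← zpow_natCast, smul_smul, ← zpow_add, add_neg_cancel, zpow_zero, one_smul]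
  have hδ : wallCount w = ∑ i ∈ Finset.range ℓ,
      Finsupp.single (wall G f i) (letterSign (f i)) := by
    have := wallCount_add (G := G) (f := f) 0 ℓ
    simp only [zero_add, pathProd_zero] at this
    rw [hw, this]
    simp [wallCount, cosetCount_one]
  have hsum : ∀ n : ℕ, Finsupp.mapDomain π (wallCount w) =
      ∑ i ∈ Finset.range ℓ, Finsupp.single (π (y ^ n • wall G f i)) (letterSign (f i)) := by
    intro n
    have h1 := wallCount_mul (y ^ n) w
    rw [(hy.pow_left n).eq, wallCount_mul] at h1
    have h2 := congrArg (Finsupp.mapDomain π) h1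
    rw [Finsupp.mapDomain_add, Finsupp.mapDomain_add, Finsupp.comapSMul_def,
      ← Finsupp.mapDomain_comp, show π ∘ (w • ·) = π from funext hπw, add_comm,
      add_right_inj] at h2
    rw [h2, hδ, Finset.smul_sum, Finsupp.mapDomain_finsetSum]
    simp [Finsupp.comapSMul_single, Finsupp.mapDomain_single]
  have hex : ∀ n : ℕ, ∃ i : Fin ℓ, π (y ^ n • wall G f i) = π (wall G f k) := by
    intro n
    by_contra! hn
    have h1 := sum_single_apply (s := fun i => letterSign (f i)) hinj hk
    have h2 := (hsum 0).symm.trans (hsum n)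
    simp only [pow_zero, one_smul] at h2
    rw [h2, Finsupp.finsetSum_apply, Finset.sum_eq_zero] at h1
    · exact letterSign_ne_zero _ h1.symm
    · intro i hi
      rw [Finsupp.single_apply, if_neg (hn ⟨i, Finset.mem_range.1 hi⟩)]
  choose i hi using hex
  obtain ⟨n, n', hne, hnn⟩ : ∃ n n', n ≠ n' ∧ i n = i n' :=
    Finite.exists_ne_map_eq_of_infinite i
  wlog hlt : n < n' generalizing n n'
  · exact this n' n hne.symm hnn.symm (by omega)
  obtain ⟨a, ha⟩ := hπ _ _ (hi n)
  obtain ⟨a', ha'⟩ := hπ _ _ (hi n')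
  refine ⟨n' - n, by omega, a' - a, ?_⟩
  have hc : Commute (y ^ (n' - n)) (w ^ a) := (hy.pow_left _).zpow_right _
  have h1 : w ^ a • y ^ (n' - n) • wall G f k = w ^ a' • wall G f k := by
    rw [smul_smul, ← hc.eq, mul_smul, ← ha, ← ha', smul_smul, ← pow_add, hnn]
    congr 2; omega
  rw [sub_eq_add_neg, add_comm, zpow_add, mul_smul, ← h1, smul_smul, ← zpow_add, neg_add_cancel,
    zpow_zero, one_smul]

theorem exists_ex_eq_of_commute {y : RAAG G} (hy : Commute y (pathProd G f ℓ)) {k : ℕ}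
    (hk : k < ℓ) : ∃ m : ℕ, 0 < m ∧ ∃ a : ℤ, ∀ d, ¬G.Adj (f k).1 d →
      m * ex d y = a * ex d (pathProd G f ℓ) := by
  obtain ⟨m, hm, a, h⟩ := exists_pow_smul_wall hf hℓ hmin hy hk
  refine ⟨m, hm, a, fun d hd => ?_⟩
  rw [wall, smul_coset, smul_coset] at h
  have h1 := ex_eq_zero_of_mem_closure hd ((coset_eq_iff _).1 h).2
  simp only [ex_mul, ex_inv, ex_pow, ex_zpow] at h1
  linarith

end Periodic

/-- An automorphism acting trivially on the abelianization. -/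
def IsIA (φ : MulAut (RAAG G)) : Prop := ∀ a v, ex a (φ (gen G v)) = ex a (gen G v)

theorem exists_conj_minimal (x : RAAG G) : ∃ g w, x = g * w * g⁻¹ ∧ ∀ h, len w ≤ len (h⁻¹ * w * h) := by
  obtain ⟨g, hg⟩ := Nat.sInf_mem (Set.range_nonempty fun g => len (g⁻¹ * x * g))
  refine ⟨g, g⁻¹ * x * g, by group, fun h => ?_⟩
  dsimp only at hg
  rw [hg]
  exact Nat.sInf_le ⟨g * h, by dsimp only; congr 1; group⟩

theorem pathProd_eq_eval {L : List (V × Bool)} {f : ℕ → V × Bool}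
    (h : ∀ k (hk : k < L.length), f k = L[k]) : pathProd G f L.length = eval G L := by
  induction L using List.reverseRecOn with
  | nil => rfl
  | append_singleton L l ih =>
    rw [List.length_append, List.length_singleton, pathProd_succ, eval_append, ih, h _ (by simp)]
    · simp
    · intro k hk
      rw [h k (by simp; omega), List.getElem_append_left hk]

theorem IsIA.exists_conj {φ : MulAut (RAAG G)} (hφ : IsIA φ) (v : V) :
    ∃ g w, φ (gen G v) = g * w * g⁻¹ ∧
      w ∈ Subgroup.closure (gen G '' {b | G.neighborSet v ⊆ G.neighborSet b}) := by
  obtain ⟨g, w, hw, hmin⟩ := exists_conj_minimal (φ (gen G v))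
  refine ⟨g, w, hw, ?_⟩
  obtain ⟨L, hL, hlen⟩ := exists_geodesic w
  rcases Nat.eq_zero_or_pos L.length with h0 | hpos
  · rw [List.length_eq_zero_iff.1 h0, eval_nil] at hL
    rw [← hL]
    exact one_mem _
  let f : ℕ → V × Bool := fun k => L[k % L.length]'(Nat.mod_lt _ hpos)
  have hf : ∀ k, f (k + L.length) = f k := fun k => by simp [f]
  have hfL : ∀ k (hk : k < L.length), f k = L[k] := fun k hk => by simp [f, Nat.mod_eq_of_lt hk]
  have hpw : pathProd G f L.length = w := (pathProd_eq_eval hfL).trans hL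
  have hletter : ∀ k < L.length, G.neighborSet v ⊆ G.neighborSet (f k).1 := by
    intro k hk d hd
    have hcomm : Commute (g⁻¹ * φ (gen G d) * g) (pathProd G f L.length) := by
      have h1 : Commute (φ (gen G d)) (φ (gen G v)) := (commute_gen hd.symm).map φ.toMonoidHom
      have h2 := h1.map (MulAut.conj g⁻¹).toMonoidHom
      rw [hpw]
      simpa [hw, mul_assoc] using h2
    obtain ⟨m, hm, a, h⟩ := exists_ex_eq_of_commute hf hpos
      (fun h => by rw [hpw, hlen]; exact hmin h) hcomm hk
    by_contra hn
    have h1 := h d hn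
    have h2 : ex d w = 0 := by
      have := hφ d v
      rw [ex_gen_ne (G.ne_of_adj hd), hw] at this
      simpa using this
    have h3 := hφ d d
    simp [hpw, h2, h3] at h1
    omega
  rw [← hL]
  refine list_prod_mem ?_
  intro x hx
  obtain ⟨l, hl, rfl⟩ := List.mem_map.1 hx
  obtain ⟨k, hk, rfl⟩ := List.getElem_of_mem hl
  have h1 := hletter k hk
  rw [hfL k hk] at h1
  rcases hl : L[k] with ⟨u, _ | _⟩ <;> rw [hl] at h1
  · exact inv_mem (Subgroup.subset_closure ⟨u, h1, rfl⟩)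
  · exact Subgroup.subset_closure ⟨u, h1, rfl⟩

theorem IsIA.exists_conj_gen {φ : MulAut (RAAG G)} (hφ : IsIA φ) {v : V}
    (hv : ∀ b, G.neighborSet v ⊆ G.neighborSet b → b = v) :
    ∃ g, φ (gen G v) = g * gen G v * g⁻¹ := by
  obtain ⟨g, w, h, hw⟩ := hφ.exists_conj v
  have hle : Subgroup.closure (gen G '' {b | G.neighborSet v ⊆ G.neighborSet b}) ≤
      Subgroup.zpowers (gen G v) := by
    rw [Subgroup.closure_le]
    rintro _ ⟨b, hb, rfl⟩
    rw [hv b hb]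
    exact Subgroup.mem_zpowers _
  obtain ⟨n, rfl⟩ := hle hw
  refine ⟨g, ?_⟩
  have h1 := hφ v v
  rw [h] at h1
  have : n = 1 := by simpa using h1
  rw [h, this]
  simp

end RAAG

section UniqueProducts

theorem IsFreeGroup.exists_hom_ne_one {H : Type*} [Group H] [IsFreeGroup H] [Nontrivial H] :
    ∃ χ : H →* Multiplicative ℤ, χ ≠ 1 := by
  classical
  let e := (IsFreeGroup.toFreeGroup H)
  have hne : Nonempty (IsFreeGroup.Generators H) := by
    by_contra h
    rw [not_nonempty_iff] at h
    exact not_subsingleton H e.injective.subsingleton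
  obtain ⟨i⟩ := hne
  let χ : FreeGroup (IsFreeGroup.Generators H) →* Multiplicative ℤ :=
    FreeGroup.lift fun _ => Multiplicative.ofAdd 1
  refine ⟨χ.comp e.toMonoidHom, fun h => ?_⟩
  have := DFunLike.congr_fun h (e.symm (FreeGroup.of i))
  simp [χ] at this

theorem exists_subgroup_hom {F : Type*} [Group F] [IsFreeGroup F] {S : Set F} {s : F} (hs : s ∈ S)
    (hs1 : s ≠ 1) : ∃ χ : Subgroup.closure S →* Multiplicative ℤ,
      ∃ (t : F) (ht : t ∈ S), χ ⟨t, Subgroup.subset_closure ht⟩ ≠ 1 := by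
  have : Nontrivial (Subgroup.closure S) :=
    ⟨⟨s, Subgroup.subset_closure hs⟩, 1, fun h => hs1 (congrArg Subtype.val h)⟩
  obtain ⟨χ, hχ⟩ := IsFreeGroup.exists_hom_ne_one (H := Subgroup.closure S)
  refine ⟨χ, ?_⟩
  by_contra! h
  apply hχ
  ext ⟨x, hx⟩
  congr 1
  induction hx using Subgroup.closure_induction with
  | mem x hx => exact h x hx
  | one => exact map_one χ
  | mul x y hx hy h1 h2 =>
    have := map_mul χ ⟨x, hx⟩ ⟨y, hy⟩
    rw [h1, h2] at this
    exact this
  | inv x hx h1 =>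
    have := map_inv χ ⟨x, hx⟩
    rw [h1] at this
    exact this

theorem UniqueMul.of_translate {F : Type*} [Group F] [DecidableEq F] {A B : Finset F} {a b x y : F}
    (h : UniqueMul (A.image (a⁻¹ * ·)) (B.image (· * b⁻¹)) (a⁻¹ * x) (y * b⁻¹)) :
    UniqueMul A B x y := by
  intro p q hp hq hpq
  have := h (Finset.mem_image_of_mem (a⁻¹ * ·) hp) (Finset.mem_image_of_mem (· * b⁻¹) hq) (by
    rw [mul_assoc, ← mul_assoc p, hpq]
    group)
  exact ⟨mul_left_cancel this.1, mul_right_cancel this.2⟩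

theorem exists_uniqueMul {F : Type*} [Group F] [IsFreeGroup F] (n : ℕ) : ∀ A B : Finset F,
    A.card + B.card = n → A.Nonempty → B.Nonempty → ∃ a ∈ A, ∃ b ∈ B, UniqueMul A B a b := by
  classical
  induction n using Nat.strong_induction_on with
  | _ n ih =>
  intro A B hn hA hB
  obtain ⟨a, ha⟩ := hA
  obtain ⟨b, hb⟩ := hB
  have hcA : (A.image (a⁻¹ * ·)).card = A.card :=
    Finset.card_image_of_injective _ (mul_right_injective _)
  have hcB : (B.image (· * b⁻¹)).card = B.card :=
    Finset.card_image_of_injective _ (mul_left_injective _)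
  suffices h : ∃ x ∈ A.image (a⁻¹ * ·), ∃ y ∈ B.image (· * b⁻¹),
      UniqueMul (A.image (a⁻¹ * ·)) (B.image (· * b⁻¹)) x y by
    obtain ⟨x, hx, y, hy, h⟩ := h
    obtain ⟨x, hx', rfl⟩ := Finset.mem_image.1 hx
    obtain ⟨y, hy', rfl⟩ := Finset.mem_image.1 hy
    exact ⟨x, hx', y, hy', h.of_translate⟩
  have h1A : (1 : F) ∈ A.image (a⁻¹ * ·) := Finset.mem_image.2 ⟨a, ha, inv_mul_cancel a⟩
  have h1B : (1 : F) ∈ B.image (· * b⁻¹) := Finset.mem_image.2 ⟨b, hb, mul_inv_cancel b⟩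
  rw [← hcA, ← hcB] at hn
  generalize A.image (a⁻¹ * ·) = A' at *
  generalize B.image (· * b⁻¹) = B' at *
  by_cases htriv : ∀ s ∈ (A' ∪ B' : Set F), s = 1
  · exact ⟨1, h1A, 1, h1B, fun x y hx hy _ => ⟨htriv x (Or.inl hx), htriv y (Or.inr hy)⟩⟩
  push Not at htriv
  obtain ⟨s, hs, hs1⟩ := htriv
  obtain ⟨χ, t, ht, hχt⟩ := exists_subgroup_hom hs hs1
  let q : F → ℤ := fun x => if h : x ∈ Subgroup.closure (A' ∪ B' : Set F) then
    Multiplicative.toAdd (χ ⟨x, h⟩) else 0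
  have hmemA : ∀ x ∈ A', x ∈ Subgroup.closure (A' ∪ B' : Set F) :=
    fun x hx => Subgroup.subset_closure (Or.inl hx)
  have hmemB : ∀ x ∈ B', x ∈ Subgroup.closure (A' ∪ B' : Set F) :=
    fun x hx => Subgroup.subset_closure (Or.inr hx)
  have hq : ∀ x ∈ A', ∀ y ∈ B', q (x * y) = q x + q y := by
    intro x hx y hy
    simp only [q, dif_pos (hmemA x hx), dif_pos (hmemB y hy),
      dif_pos (mul_mem (hmemA x hx) (hmemB y hy))]
    exact congrArg Multiplicative.toAdd (map_mul χ ⟨x, hmemA x hx⟩ ⟨y, hmemB y hy⟩)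
  have hq1 : q 1 = 0 := by
    simp only [q, dif_pos (one_mem _)]
    exact congrArg Multiplicative.toAdd (map_one χ)
  have hqt : q t ≠ 0 := by
    have h : t ∈ Subgroup.closure (A' ∪ B' : Set F) := Subgroup.subset_closure ht
    simp only [q, dif_pos h]
    exact hχt
  obtain ⟨x₀, hx₀, hxmax⟩ := A'.exists_max_image q ⟨1, h1A⟩
  obtain ⟨y₀, hy₀, hymax⟩ := B'.exists_max_image q ⟨1, h1B⟩
  have hlt : (A'.filter (q · = q x₀)).card + (B'.filter (q · = q y₀)).card < n := by
    rw [← hn]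
    have hle1 := Finset.card_filter_le A' (q · = q x₀)
    have hle2 := Finset.card_filter_le B' (q · = q y₀)
    have : ∀ C : Finset F, ∀ z, (1 : F) ∈ C → t ∈ C → (C.filter (q · = z)).card < C.card := by
      intro C z h1 ht
      refine Finset.card_lt_card (Finset.filter_ssubset.2 ?_)
      by_contra! h
      exact hqt (by rw [h t ht, ← h 1 h1, hq1])
    rcases ht with ht | ht
    · have := this A' (q x₀) h1A ht
      omega
    · have := this B' (q y₀) h1B ht
      omega
  obtain ⟨x, hx, y, hy, h⟩ := ih _ hlt _ _ rfl ⟨x₀, Finset.mem_filter.2 ⟨hx₀, rfl⟩⟩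
    ⟨y₀, Finset.mem_filter.2 ⟨hy₀, rfl⟩⟩
  obtain ⟨hx, hqx⟩ := Finset.mem_filter.1 hx
  obtain ⟨hy, hqy⟩ := Finset.mem_filter.1 hy
  refine ⟨x, hx, y, hy, fun x' y' hx' hy' hxy => ?_⟩
  have h1 := hq x' hx' y' hy'
  rw [hxy, hq x hx y hy] at h1
  have h2 := hxmax x' hx'
  have h3 := hymax y' hy'
  exact h (Finset.mem_filter.2 ⟨hx', by omega⟩) (Finset.mem_filter.2 ⟨hy', by omega⟩) hxy

/-- Free groups have the unique products property. -/
instance IsFreeGroup.uniqueProds (F : Type*) [Group F] [IsFreeGroup F] : UniqueProds F :=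
  ⟨fun {A B} hA hB => exists_uniqueMul _ A B rfl hA hB⟩

/-- Units of integral group rings are trivial in the presence of unique products. -/
theorem exists_eq_single_of_mul_eq_one {F : Type*} [Group F] [UniqueProds F]
    {α β : MonoidAlgebra ℤ F} (h : α * β = 1) :
    ∃ g, β = MonoidAlgebra.single g 1 ∨ β = MonoidAlgebra.single g (-1) := by
  classical
  have : TwoUniqueProds F := UniqueProds.toTwoUniqueProds_of_group
  have hα : α ≠ 0 := by rintro rfl; simp at h
  have hβ : β ≠ 0 := by rintro rfl; simp at h
  have hA : 0 < α.coeff.support.card := Finset.card_pos.2 (Finsupp.support_nonempty_iff.2 (by simpa))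
  have hB : 0 < β.coeff.support.card := Finset.card_pos.2 (Finsupp.support_nonempty_iff.2 (by simpa))
  have hcoef : ∀ p ∈ α.coeff.support ×ˢ β.coeff.support,
      UniqueMul α.coeff.support β.coeff.support p.1 p.2 → p.1 * p.2 = 1 ∧
        α.coeff p.1 * β.coeff p.2 = 1 := by
    intro p hp hu
    have h1 := MonoidAlgebra.coeff_mul_mul_of_uniqueMul (R := ℤ) hu
    rw [h, MonoidAlgebra.one_def, MonoidAlgebra.coeff_single, Finsupp.single_apply] at h1
    obtain ⟨hp1, hp2⟩ := Finset.mem_product.1 hp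
    split_ifs at h1 with h2
    · exact ⟨h2.symm, h1.symm⟩
    · exact absurd h1.symm (mul_ne_zero (Finsupp.mem_support_iff.1 hp1) (Finsupp.mem_support_iff.1 hp2))
  have hcard : ¬1 < α.coeff.support.card * β.coeff.support.card := by
    intro hc
    obtain ⟨p, hp, p', hp', hne, hu, hu'⟩ := TwoUniqueProds.uniqueMul_of_one_lt_card hc
    have h1 := hcoef p hp hu
    have h2 := hcoef p' hp' hu'
    obtain ⟨h3, h4⟩ := hu (Finset.mem_product.1 hp').1 (Finset.mem_product.1 hp').2
      (h2.1.trans h1.1.symm)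
    exact hne (Prod.ext h3.symm h4.symm)
  have hB1 : β.coeff.support.card = 1 := by
    have := Nat.le_mul_of_pos_left β.coeff.support.card hA
    omega
  obtain ⟨g, e, -, hge⟩ := Finsupp.card_support_eq_one'.1 hB1
  obtain rfl : β = MonoidAlgebra.single g e := MonoidAlgebra.coeff_injective hge
  obtain ⟨a, ha, b, hb, hu⟩ := UniqueProds.uniqueMul_of_nonempty (Finset.card_pos.1 hA)
    (Finset.card_pos.1 hB)
  have h1 := (hcoef (a, b) (Finset.mem_product.2 ⟨ha, hb⟩) hu).2
  have hbg : b = g := by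
    by_contra hne
    simp [Ne.symm hne] at hb
  subst hbg
  simp only [MonoidAlgebra.coeff_single, Finsupp.single_eq_same] at h1
  refine ⟨b, ?_⟩
  rcases Int.eq_one_or_neg_one_of_mul_eq_one' h1 with h | h
  · exact Or.inl (by rw [h.2])
  · exact Or.inr (by rw [h.2])

end UniqueProducts

namespace RAAG

variable {V : Type} {G : SimpleGraph V}

section Fox

open MonoidAlgebra (single)

/-- The retraction onto the free group on two non-adjacent generators. -/
def pairRetract {v c : V} (hadj : ¬G.Adj v c) : RAAG G →* FreeGroup Bool :=
  open Classical in
  lift (fun u => if u = v then FreeGroup.of true else if u = c then FreeGroup.of false else 1) <| by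
    intro a b hab
    have h1 : ¬(a = v ∧ b = c) := fun h => hadj (h.1 ▸ h.2 ▸ hab)
    have h2 : ¬(a = c ∧ b = v) := fun h => hadj (h.1 ▸ h.2 ▸ hab.symm)
    have h3 := G.ne_of_adj hab
    split_ifs <;> first | exact Commute.one_left _ | exact Commute.one_right _ | simp_all

variable {v c : V} (hadj : ¬G.Adj v c)

theorem pairRetract_left : pairRetract hadj (gen G v) = FreeGroup.of true := by
  refine (lift_gen _ _ v).trans ?_
  simp

theorem pairRetract_right (hne : v ≠ c) : pairRetract hadj (gen G c) = FreeGroup.of false := by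
  refine (lift_gen _ _ c).trans ?_
  simp [hne.symm]

theorem pairRetract_other {u : V} (h1 : u ≠ v) (h2 : u ≠ c) :
    pairRetract hadj (gen G u) = 1 := by
  refine (lift_gen _ _ u).trans ?_
  simp [h1, h2]

/-- The action of a right-angled Artin group on the group ring of a rank two free quotient. -/
def foxAction : RAAG G →* AddMonoid.End (MonoidAlgebra ℤ (FreeGroup Bool)) :=
  (DistribMulAction.toAddMonoidEnd (MonoidAlgebra ℤ (FreeGroup Bool))
    (MonoidAlgebra ℤ (FreeGroup Bool))).comp
    ((MonoidAlgebra.of ℤ (FreeGroup Bool)).comp (pairRetract hadj))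

theorem foxAction_apply (x : RAAG G) (ξ : MonoidAlgebra ℤ (FreeGroup Bool)) :
    foxAction hadj x ξ = single (pairRetract hadj x) 1 * ξ := rfl

open Classical in
/-- The Fox derivative with respect to a generator. -/
def fox : RAAG G → MonoidAlgebra ℤ (FreeGroup Bool) :=
  crossed (foxAction hadj) (fun u => if u = v then 1 else 0) <| by
    intro a b hab
    have key : ∀ a b, G.Adj a b →
        foxAction hadj (gen G a) (if b = v then 1 else 0) = if b = v then 1 else 0 := by
      intro a b hab
      split_ifs with h
      · have h1 : a ≠ v := fun h' => G.ne_of_adj hab (h'.trans h.symm)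
        have h2 : a ≠ c := fun h' => hadj (h' ▸ h ▸ hab.symm)
        rw [foxAction_apply, pairRetract_other hadj h1 h2, ← MonoidAlgebra.one_def, one_mul]
      · exact map_zero _
    rw [key a b hab, key b a hab.symm, add_comm]

theorem fox_mul (x y : RAAG G) :
    fox hadj (x * y) = fox hadj x + single (pairRetract hadj x) 1 * fox hadj y :=
  crossed_mul _ x y

theorem fox_one : fox hadj 1 = 0 := crossed_one _

theorem fox_self : fox hadj (gen G v) = 1 := by
  refine (crossed_gen _ v).trans ?_
  simp

theorem fox_ne {u : V} (h : u ≠ v) : fox hadj (gen G u) = 0 := by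
  refine (crossed_gen _ u).trans ?_
  simp [h]

theorem fox_inv_of_eq_zero {x : RAAG G} (h : fox hadj x = 0) : fox hadj x⁻¹ = 0 := by
  refine (crossed_inv _ x).trans ?_
  exact (congrArg (fun ξ => -foxAction hadj x⁻¹ ξ) h).trans (by rw [map_zero, neg_zero])

theorem fox_conj_eq_zero (g : RAAG G) {w : RAAG G} (hw : pairRetract hadj w = 1)
    (h : fox hadj w = 0) : fox hadj (g * w * g⁻¹) = 0 := by
  have h1 := fox_mul hadj g g⁻¹
  rw [mul_inv_cancel, fox_one] at h1
  rw [fox_mul, fox_mul, h, map_mul, hw, mul_one, mul_zero, add_zero, ← h1]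

theorem pairRetract_eq_one_and_fox_eq_zero (hne : v ≠ c) {u : V} (h1 : u ≠ v) (h2 : u ≠ c)
    {w : RAAG G} (hw : w ∈ Subgroup.closure (gen G '' {u, c})) (hex : ex c w = 0) :
    pairRetract hadj w = 1 ∧ fox hadj w = 0 := by
  have key : pairRetract hadj w = FreeGroup.of false ^ ex c w ∧ fox hadj w = 0 := by
    clear hex
    induction hw using Subgroup.closure_induction with
    | mem x hx =>
      obtain ⟨b, rfl | rfl, rfl⟩ := hx
      · rw [pairRetract_other hadj h1 h2, ex_gen_ne h2, fox_ne hadj h1]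
        simp
      · rw [pairRetract_right hadj hne, ex_gen_self, fox_ne hadj hne.symm]
        simp
    | one => simp [fox_one]
    | mul x y _ _ hx hy => rw [map_mul, fox_mul, hx.1, hx.2, hy.1, hy.2, ex_mul, zpow_add]; simp
    | inv x _ hx => rw [map_inv, fox_inv_of_eq_zero hadj hx.2, ex_inv, hx.1, zpow_neg]; simp
  rw [hex, zpow_zero] at key
  exact key

variable {φ : MulAut (RAAG G)}

/-- The chain rule for Fox derivatives. -/
theorem fox_chain (θ : FreeGroup Bool →* FreeGroup Bool)
    (hθ : ∀ z, pairRetract hadj (φ z) = θ (pairRetract hadj z))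
    (hother : ∀ u, u ≠ v → fox hadj (φ (gen G u)) = 0) (z : RAAG G) :
    fox hadj (φ z) = MonoidAlgebra.mapDomainRingHom ℤ θ (fox hadj z) * fox hadj (φ (gen G v)) := by
  have hstep : ∀ x u, fox hadj (φ (x * gen G u)) - MonoidAlgebra.mapDomainRingHom ℤ θ
      (fox hadj (x * gen G u)) * fox hadj (φ (gen G v)) = fox hadj (φ x) -
      MonoidAlgebra.mapDomainRingHom ℤ θ (fox hadj x) * fox hadj (φ (gen G v)) := by
    intro x u
    rw [map_mul, fox_mul, fox_mul, hθ]
    by_cases h : u = v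
    · subst h
      rw [fox_self, mul_one, map_add, add_mul]
      simp
    · rw [fox_ne hadj h, hother u h]
      simp
  rw [← sub_eq_zero]
  induction z using induction_right with
  | one => simp [fox_one]
  | mul x u ih => rw [hstep, ih]
  | inv x u ih => rw [← hstep, inv_mul_cancel_right, ih]

/-- The boundary map to the permutation module of the cosets of the second generator. -/
def foxBoundary (ξ : MonoidAlgebra ℤ (FreeGroup Bool)) :
    (FreeGroup Bool ⧸ Subgroup.zpowers (FreeGroup.of false)) →₀ ℤ :=
  Finsupp.mapDomain (fun g => ((g * FreeGroup.of true : FreeGroup Bool) : _ ⧸ _)) ξ.coeff -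
    Finsupp.mapDomain (fun g : FreeGroup Bool => (g : _ ⧸ _)) ξ.coeff

theorem foxBoundary_add (ξ η : MonoidAlgebra ℤ (FreeGroup Bool)) :
    foxBoundary (ξ + η) = foxBoundary ξ + foxBoundary η := by
  simp only [foxBoundary, MonoidAlgebra.coeff_add, Finsupp.mapDomain_add]
  abel

theorem foxBoundary_single (g : FreeGroup Bool) (e : ℤ) : foxBoundary (single g e) =
    Finsupp.single ((g * FreeGroup.of true : FreeGroup Bool) : _ ⧸ _) e -
      Finsupp.single (g : _ ⧸ _) e := by
  simp only [foxBoundary, MonoidAlgebra.coeff_single, Finsupp.mapDomain_single]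

theorem foxBoundary_fox (hne : v ≠ c) (x : RAAG G) : foxBoundary (fox hadj x) =
    Finsupp.single ((pairRetract hadj x : FreeGroup Bool) : _ ⧸ _) 1 -
      Finsupp.single ((1 : FreeGroup Bool) : _ ⧸ _) 1 := by
  have hstep : ∀ x u, foxBoundary (fox hadj (x * gen G u)) -
      Finsupp.single ((pairRetract hadj (x * gen G u) : FreeGroup Bool) :
        _ ⧸ Subgroup.zpowers (FreeGroup.of false)) (1 : ℤ) =
      foxBoundary (fox hadj x) - Finsupp.single ((pairRetract hadj x : FreeGroup Bool) :
        _ ⧸ Subgroup.zpowers (FreeGroup.of false)) (1 : ℤ) := by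
    intro x u
    rw [fox_mul, map_mul]
    by_cases hv : u = v
    · subst hv
      rw [fox_self, mul_one, foxBoundary_add, foxBoundary_single, pairRetract_left]
      abel
    · rw [fox_ne hadj hv, mul_zero, add_zero]
      by_cases hc : u = c
      · subst hc
        rw [pairRetract_right hadj hne,
          QuotientGroup.mk_mul_of_mem _ (Subgroup.mem_zpowers (FreeGroup.of false))]
      · rw [pairRetract_other hadj hv hc, mul_one]
  rw [sub_eq_add_neg, ← sub_eq_iff_eq_add']
  induction x using induction_right with
  | one => rw [fox_one, map_one]; simp [foxBoundary]
  | mul x u ih => rw [hstep, ih]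
  | inv x u ih => rw [← hstep, inv_mul_cancel_right, ih]

theorem eq_and_eq_of_single_sub_single {X : Type*} {a b a' b' : X} (hab : a ≠ b)
    (h : Finsupp.single a (1 : ℤ) - Finsupp.single b 1 = Finsupp.single a' 1 - Finsupp.single b' 1) :
    a = a' ∧ b = b' := by
  classical
  have h1 := DFunLike.congr_fun h a
  have h2 := DFunLike.congr_fun h b
  simp only [Finsupp.sub_apply, Finsupp.single_apply, hab, hab.symm, if_true, if_false] at h1 h2
  constructor
  · by_contra hne
    rw [if_neg (Ne.symm hne)] at h1
    split_ifs at h1 <;> omega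
  · by_contra hne
    rw [if_neg (Ne.symm hne)] at h2
    split_ifs at h2 <;> omega

theorem of_true_mul_notMem (n : ℤ) :
    (FreeGroup.of true : FreeGroup Bool) ≠ FreeGroup.of false ^ n := by
  intro h
  have := congrArg (FreeGroup.lift fun b : Bool => Multiplicative.ofAdd (if b then (1 : ℤ) else 0)) h
  rw [map_zpow] at this
  simp at this

theorem eq_of_fox_eq_single (hne : v ≠ c) {x : RAAG G} {g : FreeGroup Bool}
    (h : fox hadj x = single g 1 ∨ fox hadj x = single g (-1)) :
    ∃ i j e : ℤ, pairRetract hadj x =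
      FreeGroup.of false ^ i * FreeGroup.of true ^ e * FreeGroup.of false ^ j := by
  have hb := foxBoundary_fox hadj hne x
  have hg : ((g * FreeGroup.of true : FreeGroup Bool) : _ ⧸ Subgroup.zpowers (FreeGroup.of false)) ≠
      (g : _ ⧸ Subgroup.zpowers (FreeGroup.of false)) := by
    intro h
    obtain ⟨n, hn⟩ := QuotientGroup.eq.1 h.symm
    rw [inv_mul_cancel_left] at hn
    exact of_true_mul_notMem n hn.symm
  rcases h with h | h
  · rw [h, foxBoundary_single] at hb
    obtain ⟨h1, h2⟩ := eq_and_eq_of_single_sub_single hg hb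
    obtain ⟨j, hj⟩ := QuotientGroup.eq.1 h1
    obtain ⟨i, hi⟩ := QuotientGroup.eq.1 h2.symm
    refine ⟨i, j, 1, ?_⟩
    simp only [inv_one, one_mul] at hi
    change FreeGroup.of false ^ j = _ at hj
    rw [hi, hj]
    group
  · rw [h, foxBoundary_single, Finsupp.single_neg, Finsupp.single_neg, sub_neg_eq_add,
      neg_add_eq_sub] at hb
    obtain ⟨h1, h2⟩ := eq_and_eq_of_single_sub_single hg.symm hb
    obtain ⟨j, hj⟩ := QuotientGroup.eq.1 h1
    obtain ⟨i, hi⟩ := QuotientGroup.eq.1 h2.symm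
    refine ⟨i, j, -1, ?_⟩
    simp only [inv_one, one_mul] at hi
    change FreeGroup.of false ^ j = _ at hj
    rw [hi, hj]
    group

theorem ex_eq_of_pairRetract (hne : v ≠ c) : ∃ p q : FreeGroup Bool →* Multiplicative ℤ,
    (∀ x, p (pairRetract hadj x) = Multiplicative.ofAdd (ex v x)) ∧
    (∀ x, q (pairRetract hadj x) = Multiplicative.ofAdd (ex c x)) ∧
    p (FreeGroup.of true) = Multiplicative.ofAdd 1 ∧ p (FreeGroup.of false) = 1 ∧
    q (FreeGroup.of true) = 1 ∧ q (FreeGroup.of false) = Multiplicative.ofAdd 1 := by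
  let p : FreeGroup Bool →* Multiplicative ℤ :=
    FreeGroup.lift fun b => if b then Multiplicative.ofAdd 1 else 1
  let q : FreeGroup Bool →* Multiplicative ℤ :=
    FreeGroup.lift fun b => if b then 1 else Multiplicative.ofAdd 1
  have hp : p.comp (pairRetract hadj) = expo v := hom_ext fun u => by
    by_cases h1 : u = v
    · subst h1
      refine (congrArg p (pairRetract_left hadj)).trans (Eq.trans ?_ (lift_gen _ _ u).symm)
      simp [p]
    · by_cases h2 : u = c
      · subst h2
        refine (congrArg p (pairRetract_right hadj hne)).trans (Eq.trans ?_ (lift_gen _ _ u).symm)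
        simp [p, h1]
      · refine (congrArg p (pairRetract_other hadj h1 h2)).trans (Eq.trans ?_ (lift_gen _ _ u).symm)
        simp [h1]
  have hq : q.comp (pairRetract hadj) = expo c := hom_ext fun u => by
    by_cases h1 : u = v
    · subst h1
      refine (congrArg q (pairRetract_left hadj)).trans (Eq.trans ?_ (lift_gen _ _ u).symm)
      simp [q, hne]
    · by_cases h2 : u = c
      · subst h2
        refine (congrArg q (pairRetract_right hadj hne)).trans (Eq.trans ?_ (lift_gen _ _ u).symm)
        simp [q]
      · refine (congrArg q (pairRetract_other hadj h1 h2)).trans (Eq.trans ?_ (lift_gen _ _ u).symm)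
        simp [h2]
  refine ⟨p, q, fun x => DFunLike.congr_fun hp x, fun x => DFunLike.congr_fun hq x, ?_⟩
  simp [p, q]

include hadj in
/-- An automorphism fixing `c` and sending every other generator `u`, up to conjugation, into the
subgroup generated by `u` and `c`, conjugates the generator `v`, provided that it acts trivially
on the abelianization. -/
theorem exists_conj_of_fixed (hφ : IsIA φ) (hne : v ≠ c) (hc : φ (gen G c) = gen G c)
    (hconj : ∀ u, u ≠ c → ∃ g w, φ (gen G u) = g * w * g⁻¹ ∧
      w ∈ Subgroup.closure (gen G '' {u, c})) : ∃ g, φ (gen G v) = g * gen G v * g⁻¹ := by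
  have hother : ∀ u, u ≠ v → u ≠ c →
      pairRetract hadj (φ (gen G u)) = 1 ∧ fox hadj (φ (gen G u)) = 0 := by
    intro u h1 h2
    obtain ⟨g, w, h, hw⟩ := hconj u h2
    have hex : ex c w = 0 := by
      have := hφ c u
      rw [ex_gen_ne h2, h] at this
      simpa using this
    obtain ⟨h3, h4⟩ := pairRetract_eq_one_and_fox_eq_zero hadj hne h1 h2 hw hex
    rw [h]
    exact ⟨by simp [h3], fox_conj_eq_zero hadj g h3 h4⟩
  let θ : FreeGroup Bool →* FreeGroup Bool := FreeGroup.lift fun b =>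
    if b then pairRetract hadj (φ (gen G v)) else FreeGroup.of false
  have hθ : ∀ z, pairRetract hadj (φ z) = θ (pairRetract hadj z) := by
    have : (pairRetract hadj).comp φ.toMonoidHom = θ.comp (pairRetract hadj) := hom_ext fun u => by
      change pairRetract hadj (φ (gen G u)) = θ (pairRetract hadj (gen G u))
      by_cases h1 : u = v
      · subst h1
        rw [pairRetract_left]
        simp [θ]
      · by_cases h2 : u = c
        · subst h2
          rw [hc, pairRetract_right hadj hne]
          simp [θ]
        · rw [(hother u h1 h2).1, pairRetract_other hadj h1 h2, map_one]
    exact DFunLike.congr_fun this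
  have hchain := fox_chain hadj θ hθ (fun u h1 => by
    by_cases h2 : u = c
    · subst h2
      rw [hc, fox_ne hadj h1]
    · exact (hother u h1 h2).2) (φ.symm (gen G v))
  rw [show φ (φ.symm (gen G v)) = gen G v from φ.apply_symm_apply _, fox_self] at hchain
  obtain ⟨g, hg⟩ := exists_eq_single_of_mul_eq_one hchain.symm
  obtain ⟨i, j, e, hx⟩ := eq_of_fox_eq_single hadj hne hg
  obtain ⟨p, q, hp, hq, p1, p2, q1, q2⟩ := ex_eq_of_pairRetract hadj hne
  have he : e = 1 := by
    have := hp (φ (gen G v))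
    rw [hx, hφ v v] at this
    have := congrArg Multiplicative.toAdd this
    simpa [p1, p2] using this
  have hij : j = -i := by
    have := hq (φ (gen G v))
    rw [hx, hφ c v, ex_gen_ne hne] at this
    have := congrArg Multiplicative.toAdd this
    simp [q1, q2] at this
    omega
  obtain ⟨k, w, hk, hw⟩ := hconj v hne
  let s : FreeGroup Bool →* RAAG G := FreeGroup.lift fun b => if b then gen G v else gen G c
  have hsw : s (pairRetract hadj w) = w := by
    clear hk
    induction hw using Subgroup.closure_induction with
    | mem x hx =>
      obtain ⟨b, rfl | rfl, rfl⟩ := hx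
      · rw [pairRetract_left]; simp [s]
      · rw [pairRetract_right hadj hne]; simp [s]
    | one => simp
    | mul x y _ _ hx hy => rw [map_mul, map_mul, hx, hy]
    | inv x _ hx => rw [map_inv, map_inv, hx]
  refine ⟨k * (s (pairRetract hadj k))⁻¹ * gen G c ^ i, ?_⟩
  rw [hk, map_mul, map_mul, map_inv, he, hij] at hx
  have h1 : pairRetract hadj w = (pairRetract hadj k)⁻¹ * (FreeGroup.of false ^ i *
      FreeGroup.of true ^ (1 : ℤ) * FreeGroup.of false ^ (-i)) * pairRetract hadj k := by
    rw [← hx]; group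
  rw [hk, ← hsw, h1]
  simp only [map_mul, map_inv, map_zpow]
  have s1 : s (FreeGroup.of true) = gen G v := by simp [s]
  have s2 : s (FreeGroup.of false) = gen G c := by simp [s]
  rw [s1, s2]
  group

end Fox

variable {c : V} {φ : MulAut (RAAG G)}

theorem IsIA.conj_mul (hφ : IsIA φ) (h : RAAG G) : IsIA (MulAut.conj h * φ) := fun a v => by
  rw [MulAut.mul_apply, MulAut.conj_apply]
  simp [hφ a v]

/-- In the RAAG of a focused graph an automorphism acting trivially on the abelianization
conjugates every generator. -/
theorem IsIA.exists_isConjData (hF : Focused G c) (hφ : IsIA φ) : ∃ g, IsConjData φ g := by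
  have dom : ∀ {b u : V}, G.neighborSet u ⊆ G.neighborSet b → b ≠ u → b = c := fun h hb =>
    hF.1 _ _ hb (h.trans (Set.subset_insert _ _))
  have hloop : ∀ {b u : V}, G.neighborSet u ⊆ G.neighborSet b → ¬G.Adj u b := fun h hub =>
    G.loopless.irrefl _ (h hub)
  have key : ∀ v, ∃ g, φ (gen G v) = g * gen G v * g⁻¹ := by
    by_cases hd : ∀ b, G.neighborSet c ⊆ G.neighborSet b → b = c
    swap
    · push Not at hd
      obtain ⟨b, hb, hbc⟩ := hd
      exact absurd (dom hb hbc) hbc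
    obtain ⟨h, hh⟩ := hφ.exists_conj_gen hd
    have hψ := hφ.conj_mul h⁻¹
    have hψc : (MulAut.conj h⁻¹ * φ) (gen G c) = gen G c := by
      rw [MulAut.mul_apply, hh, MulAut.conj_apply]
      group
    have hconj : ∀ u, u ≠ c → ∃ g w, (MulAut.conj h⁻¹ * φ) (gen G u) = g * w * g⁻¹ ∧
        w ∈ Subgroup.closure (gen G '' {u, c}) := fun u _ => by
      obtain ⟨g, w, hg, hw⟩ := hψ.exists_conj u
      refine ⟨g, w, hg, Subgroup.closure_mono (Set.image_mono fun b hb => ?_) hw⟩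
      by_cases hbu : b = u
      · exact Or.inl hbu
      · exact Or.inr (dom hb hbu)
    intro v
    by_cases hv : v = c
    · exact ⟨h, by rw [hv, hh]⟩
    by_cases hvc : G.neighborSet v ⊆ G.neighborSet c
    · obtain ⟨g, hg⟩ := exists_conj_of_fixed (hloop hvc) hψ hv hψc hconj
      rw [MulAut.mul_apply, MulAut.conj_apply, inv_inv] at hg
      refine ⟨h * g, ?_⟩
      rw [mul_inv_rev, show h * g * gen G v * (g⁻¹ * h⁻¹) = h * (g * gen G v * g⁻¹) * h⁻¹ by group,
        ← hg]
      group
    · refine hφ.exists_conj_gen fun b hb => ?_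
      by_contra hbv
      exact hvc (dom hb hbv ▸ hb)
  choose g hg using key
  exact ⟨g, hg⟩

section Kernel

/-- The twist parameter of a product of transvections by `w`. -/
def transParam {w : V} (a : V → ℤ) (ha : ∀ v, a v ≠ 0 → v ≠ w ∧ Dominates G w v) :
    TwistParam G w :=
  ⟨(0, a), fun _ _ _ _ _ => rfl, ha⟩

/-- The twist parameter of a product of partial conjugations by `w`. -/
def conjParam {w : V} (a : V → ℤ)
    (ha : ∀ u v, G.Adj u v → u ∉ star G w → v ∉ star G w → a u = a v) : TwistParam G w :=
  ⟨(a, 0), ha, fun _ h => absurd rfl h⟩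

open Classical in
theorem single_dominated {w v : V} (hvw : v ≠ w) (hd : Dominates G w v) (u : V)
    (hu : (Pi.single v 1 : V → ℤ) u ≠ 0) : u ≠ w ∧ Dominates G w u := by
  by_cases h : u = v
  · exact h ▸ ⟨hvw, hd⟩
  · simp [h] at hu

open Classical in
theorem _root_.IsTransvection.eq_twist {w v : V} (h : IsTransvection G φ w v) :
    φ = twist w (Multiplicative.ofAdd
      (transParam (Pi.single v 1) (single_dominated h.1.symm h.2.1))) := by
  refine mulAut_ext fun u => ?_
  rw [twist_gen]
  by_cases hu : u = v
  · subst hu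
    simp [transParam, h.2.2.1]
  · simp [transParam, h.2.2.2 u hu, hu]

open Classical in
theorem isTransvection_twist {w v : V} (hvw : v ≠ w) (hd : Dominates G w v) :
    IsTransvection G (twist w (Multiplicative.ofAdd
      (transParam (Pi.single v 1) (single_dominated hvw hd)))) w v := by
  refine ⟨hvw.symm, hd, ?_, fun u hu => ?_⟩ <;> rw [twist_gen]
  · simp [transParam]
  · simp [transParam, hu]

theorem closure_partialConj_le :
    Subgroup.closure {χ : MulAut (RAAG G) | ∃ v P, IsPartialConj G χ v P} ≤ PCT G :=
  Subgroup.closure_mono fun _ h => Or.inr h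

theorem twist_mem_PCT [Fintype V] (w : V) (p : TwistParam G w) :
    twist w (Multiplicative.ofAdd p) ∈ PCT G := by
  classical
  let S : AddSubgroup (TwistParam G w) := ((PCT G).comap (twist w)).toAddSubgroup'
  change p ∈ S
  have h1 : conjParam p.1.1 p.2.1 ∈ S := by
    have : IsConjData (twist w (Multiplicative.ofAdd (conjParam p.1.1 p.2.1)))
        fun v => gen G w ^ p.1.1 v := fun v => by
      rw [twist_gen]
      simp [conjParam]
    exact closure_partialConj_le this.mem_closure
  have h2 : ∀ v, (if h : v ≠ w ∧ Dominates G w v then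
      p.1.2 v • transParam (Pi.single v 1) (single_dominated h.1 h.2) else 0 : TwistParam G w) ∈ S := by
    intro v
    split_ifs with h
    · have : twist w (Multiplicative.ofAdd
          (transParam (Pi.single v 1) (single_dominated h.1 h.2))) ∈ PCT G :=
        Subgroup.subset_closure (Or.inl ⟨w, v, isTransvection_twist h.1 h.2⟩)
      exact S.zsmul_mem this _
    · exact zero_mem _
  have h3 : p = conjParam p.1.1 p.2.1 +
      ∑ v, (if h : v ≠ w ∧ Dominates G w v then
      p.1.2 v • transParam (Pi.single v 1) (single_dominated h.1 h.2) else 0 :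
        TwistParam G w) := by
    have h4 : ∀ v, ((if h : v ≠ w ∧ Dominates G w v then
      p.1.2 v • transParam (Pi.single v 1) (single_dominated h.1 h.2) else 0 : TwistParam G w) :
        (V → ℤ) × (V → ℤ)) = (0, Pi.single v (p.1.2 v)) := by
      intro v
      split_ifs with h
      · ext u <;> simp [transParam, Pi.single_apply]
      · have : p.1.2 v = 0 := by
          by_contra hv
          exact h (p.2.2 v hv)
        simp [this, Prod.zero_eq_mk]
    refine Subtype.ext ?_
    rw [AddSubgroup.coe_add, AddSubgroup.val_finsetSum]
    simp only [h4]
    refine Prod.ext ?_ ?_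
    · simp [conjParam, Prod.fst_sum]
    · simp [conjParam, Prod.snd_sum, Finset.univ_sum_single]
  rw [h3]
  exact add_mem h1 (sum_mem fun v _ => h2 v)

variable [Fintype V] (hF : Focused G c) (hT : TrivialAut G)

theorem signs_conj (g : RAAG G) : signs hF hT (MulAut.conj g) = 1 := by
  ext v
  rw [signs_apply, MulAut.conj_apply]
  simp

theorem PCT_eq_ker_signs : PCT G = (signs hF hT).ker := by
  refine le_antisymm ?_ fun φ hφ => ?_
  · rw [PCT, Subgroup.closure_le]
    rintro φ (⟨u, w, h⟩ | ⟨w, P, h⟩) <;> refine MonoidHom.mem_ker.2 (funext fun v => Units.ext ?_) <;>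
      rw [signs_apply]
    · by_cases hv : v = w
      · subst hv
        simp [h.2.2.1, ex_gen_ne h.1]
      · simp [h.2.2.2 v hv]
    · by_cases hv : v ∈ P
      · simp [h.2.1 v hv]
      · simp [h.2.2 v hv]
  · have hs : ∀ v, ex v (φ (gen G v)) = 1 := fun v => by
      rw [← signs_apply hF hT, MonoidHom.mem_ker.1 hφ]
      rfl
    have h0 : ∀ b v, b ≠ c → b ≠ v → ex b (φ (gen G v)) = 0 := fun b v h1 h2 => by
      by_contra h
      rcases exMat_support hF hT φ h with h | h
      · exact h2 h
      · exact h1 h.1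
    classical
    have ha : ∀ v, (if v = c then 0 else -ex c (φ (gen G v))) ≠ 0 → v ≠ c ∧ Dominates G c v := by
      intro v hv
      split_ifs at hv with h
      · exact absurd rfl hv
      · exact ⟨h, ((exMat_support hF hT φ (neg_ne_zero.1 hv)).resolve_left (Ne.symm h)).2⟩
    let p : TwistParam G c := transParam _ ha
    have hψ : IsIA (φ * twist c (Multiplicative.ofAdd p)) := by
      intro b v
      rw [MulAut.mul_apply, twist_gen]
      by_cases hv : v = c
      · subst hv
        by_cases hb : b = v
        · subst hb
          simp [p, transParam, hs]
        · simp [p, transParam, h0 b v hb hb, ex_gen_ne (Ne.symm hb)]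
      · by_cases hb : b = c
        · subst hb
          simp [p, transParam, hs, hv, ex_gen_ne hv]
        · by_cases hbv : b = v
          · subst hbv
            simp [p, transParam, hv, hs, h0 b c hb hb]
          · simp [p, transParam, hv, h0 b c hb hb, h0 b v hb hbv, ex_gen_ne (Ne.symm hbv)]
    obtain ⟨g, hg⟩ := hψ.exists_isConjData hF
    exact (Subgroup.mul_mem_cancel_right _ (twist_mem_PCT c p)).1
      (closure_partialConj_le hg.mem_closure)

end Kernel

section Inversions

/-- The automorphism raising each generator to a given sign. -/
def invertHom (G : SimpleGraph V) (s : V → ℤˣ) : RAAG G →* RAAG G :=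
  lift (fun v => gen G v ^ (s v : ℤ)) fun _ _ h => (commute_gen h).zpow_zpow _ _

theorem invertHom_gen (s : V → ℤˣ) (v : V) : invertHom G s (gen G v) = gen G v ^ (s v : ℤ) :=
  lift_gen _ _ v

theorem invertHom_comp (s t : V → ℤˣ) :
    (invertHom G s).comp (invertHom G t) = invertHom G (s * t) := hom_ext fun v => by
  rw [MonoidHom.comp_apply, invertHom_gen, map_zpow, invertHom_gen, invertHom_gen, ← zpow_mul]
  rfl

theorem invertHom_one : invertHom G 1 = MonoidHom.id _ := hom_ext fun v => by
  simp [invertHom_gen]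

/-- The products of inversions, parametrized by the signs. -/
def invert (G : SimpleGraph V) : (V → ℤˣ) →* MulAut (RAAG G) where
  toFun s := MonoidHom.toMulEquiv (invertHom G s) (invertHom G s⁻¹)
    (by rw [invertHom_comp, inv_mul_cancel, invertHom_one])
    (by rw [invertHom_comp, mul_inv_cancel, invertHom_one])
  map_one' := by ext x; exact DFunLike.congr_fun invertHom_one x
  map_mul' s t := by ext x; exact (DFunLike.congr_fun (invertHom_comp s t) x).symm

theorem invert_gen (s : V → ℤˣ) (v : V) : invert G s (gen G v) = gen G v ^ (s v : ℤ) :=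
  invertHom_gen s v

theorem range_invert [Fintype V] : (invert G).range = InvSubgroup G := by
  classical
  apply le_antisymm
  · rw [MonoidHom.range_eq_map, Subgroup.map_le_iff_le_comap]
    intro s _
    rw [← Finset.univ_prod_mulSingle s]
    refine prod_mem fun v _ => ?_
    rcases Int.units_eq_one_or (s v) with h | h
    · rw [h, Pi.mulSingle_one]
      exact one_mem _
    · refine Subgroup.subset_closure ⟨v, ?_, fun w hw => ?_⟩ <;> rw [invert_gen, h]
      · simp
      · simp [hw]
  · rw [InvSubgroup, Subgroup.closure_le]
    rintro φ ⟨v, h⟩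
    refine ⟨Pi.mulSingle v (-1), mulAut_ext fun w => ?_⟩
    rw [invert_gen]
    by_cases hw : w = v
    · subst hw
      simp [h.1]
    · simp [hw, h.2 w hw]

theorem signs_invert [Fintype V] (hF : Focused G c) (hT : TrivialAut G) (s : V → ℤˣ) :
    signs hF hT (invert G s) = s := by
  ext v
  rw [signs_apply, invert_gen]
  simp

end Inversions

section Outer

/-- The indices of a basis of the group of outer twists around `c`: the components of the
complement of the star of `c` other than `C₀`, and the vertices dominated by `c`. -/
abbrev TwistIdx (G : SimpleGraph V) (c : V)
    (C₀ : (G.induce (star G c)ᶜ).ConnectedComponent) : Type :=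
  {C : (G.induce (star G c)ᶜ).ConnectedComponent // C ≠ C₀} ⊕ {v : V | v ≠ c ∧ Dominates G c v}

theorem card_twistIdx [Finite V] (C₀ : (G.induce (star G c)ᶜ).ConnectedComponent) :
    Nat.card (TwistIdx G c C₀) = kInv G c + mInv G c - 1 := by
  classical
  have := Fintype.ofFinite (G.induce (star G c)ᶜ).ConnectedComponent
  have h : Nat.card {C : (G.induce (star G c)ᶜ).ConnectedComponent // C ≠ C₀} = kInv G c - 1 := by
    rw [kInv, Nat.card_eq_fintype_card, Nat.card_eq_fintype_card]
    exact Set.card_ne_eq C₀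
  have : 0 < kInv G c := by
    have : Nonempty (G.induce (star G c)ᶜ).ConnectedComponent := ⟨C₀⟩
    exact Nat.card_pos
  rw [Nat.card_sum, h, mInv]
  omega

variable (C₀ : (G.induce (star G c)ᶜ).ConnectedComponent)

open Classical in
/-- The twist parameter with given coordinates. -/
def idxParam : (TwistIdx G c C₀ → ℤ) →+ TwistParam G c where
  toFun q := ⟨(fun v => if h : ∃ hv : v ∉ star G c,
      (G.induce (star G c)ᶜ).connectedComponentMk ⟨v, hv⟩ ≠ C₀ then q (Sum.inl ⟨_, h.2⟩) else 0,
      fun v => if h : v ≠ c ∧ Dominates G c v then q (Sum.inr ⟨v, h⟩) else 0),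
    fun u v huv hu hv => by
      have : (G.induce (star G c)ᶜ).connectedComponentMk ⟨u, hu⟩ =
          (G.induce (star G c)ᶜ).connectedComponentMk ⟨v, hv⟩ :=
        SimpleGraph.ConnectedComponent.eq.2 (SimpleGraph.Adj.reachable huv)
      simp only [hu, hv, not_false_eq_true, exists_true_left, this],
    fun v hv => by
      by_contra h
      exact hv (dif_neg h)⟩
  map_zero' := by ext v <;> simp
  map_add' q q' := by
    ext v
    · by_cases h : ∃ hv : v ∉ star G c,
        (G.induce (star G c)ᶜ).connectedComponentMk ⟨v, hv⟩ ≠ C₀ <;> simp [h]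
    · by_cases h : v ≠ c ∧ Dominates G c v <;> simp [h]

theorem idxParam_of_mem (q : TwistIdx G c C₀ → ℤ) {v : V} (hv : v ∉ star G c)
    (h : (G.induce (star G c)ᶜ).connectedComponentMk ⟨v, hv⟩ = C₀) : (idxParam C₀ q).1.1 v = 0 :=
  dif_neg fun h' => h'.2 h

theorem idxParam_of_ne (q : TwistIdx G c C₀ → ℤ) {v : V} (hv : v ∉ star G c)
    (h : (G.induce (star G c)ᶜ).connectedComponentMk ⟨v, hv⟩ ≠ C₀) :
    (idxParam C₀ q).1.1 v = q (Sum.inl ⟨_, h⟩) :=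
  dif_pos ⟨hv, h⟩

theorem idxParam_of_dominated (q : TwistIdx G c C₀ → ℤ) {v : V} (h : v ≠ c ∧ Dominates G c v) :
    (idxParam C₀ q).1.2 v = q (Sum.inr ⟨v, h⟩) :=
  dif_pos h

theorem twist_eq_conj {p : TwistParam G c} {g : RAAG G}
    (h : twist c (Multiplicative.ofAdd p) = MulAut.conj g) :
    (∀ v, p.1.2 v = 0) ∧ ∀ v, v ∉ star G c → p.1.1 v = ex c g := by
  have h1 : ∀ v, gen G c ^ p.1.1 v * (gen G c ^ p.1.2 v * gen G v) * (gen G c ^ p.1.1 v)⁻¹ =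
      g * gen G v * g⁻¹ := fun v => by
    rw [← twist_gen, h, MulAut.conj_apply]
  have h2 : ∀ v, p.1.2 v = 0 := fun v => by simpa using congrArg (ex c) (h1 v)
  refine ⟨h2, fun v hv => ?_⟩
  have h3 : Commute (g⁻¹ * gen G c ^ p.1.1 v) (gen G v) := by
    have := h1 v
    rw [h2, zpow_zero, one_mul, mul_inv_eq_iff_eq_mul] at this
    rw [commute_iff_eq, mul_assoc, this]
    group
  have h4 := ex_eq_zero_of_mem_closure (fun h => hv (mem_star_comm.1 h)) (mem_stSub_of_commute h3)
  simp at h4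
  omega

/-- The outer automorphism given by a twist around `c` with given coordinates. -/
def outerTwist : Multiplicative (TwistIdx G c C₀ → ℤ) →* Out (RAAG G) :=
  (QuotientGroup.mk' (Inn (RAAG G))).comp ((twist c).comp (idxParam C₀).toMultiplicative)

theorem outerTwist_injective : Function.Injective (outerTwist C₀) := by
  rw [injective_iff_map_eq_one]
  intro q hq
  obtain ⟨g, hg⟩ := (QuotientGroup.eq_one_iff _).1 hq
  obtain ⟨h1, h2⟩ := twist_eq_conj (p := idxParam C₀ q.toAdd) hg.symm
  obtain ⟨⟨x₀, hx₀⟩, hx⟩ := C₀.exists_rep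
  have h3 := h2 x₀ hx₀
  rw [idxParam_of_mem C₀ _ hx₀ hx] at h3
  refine Multiplicative.toAdd.injective (funext ?_)
  rintro (⟨C, hC⟩ | ⟨v, hv⟩)
  · obtain ⟨⟨v, hv⟩, rfl⟩ := C.exists_rep
    exact (idxParam_of_ne C₀ _ hv hC).symm.trans ((h2 v hv).trans h3.symm)
  · exact (idxParam_of_dominated C₀ _ hv).symm.trans (h1 v)

theorem mk_twist_mem_range (p : TwistParam G c) :
    QuotientGroup.mk' (Inn (RAAG G)) (twist c (Multiplicative.ofAdd p)) ∈
      (outerTwist C₀).range := by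
  obtain ⟨x₀, hx⟩ := C₀.exists_rep
  let q : TwistIdx G c C₀ → ℤ := Sum.elim (fun C => p.1.1 C.1.out - p.1.1 x₀) fun v => p.1.2 v
  have hreach : ∀ x y : ((star G c)ᶜ : Set V), (G.induce (star G c)ᶜ).connectedComponentMk x =
      (G.induce (star G c)ᶜ).connectedComponentMk y → p.1.1 x = p.1.1 y := fun x y h =>
    eq_of_reachable_induce (fun u v huv hu hv => p.2.1 u v huv hu hv)
      (SimpleGraph.ConnectedComponent.eq.1 h)
  have hq1 : ∀ v, v ∉ star G c → (idxParam C₀ q).1.1 v = p.1.1 v - p.1.1 x₀ := by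
    intro v hv
    by_cases h : (G.induce (star G c)ᶜ).connectedComponentMk ⟨v, hv⟩ = C₀
    · rw [idxParam_of_mem C₀ q hv h, hreach x₀ ⟨v, hv⟩ (hx.trans h.symm), sub_self]
    · rw [idxParam_of_ne C₀ q hv h]
      exact congrArg (· - p.1.1 x₀) (hreach _ ⟨v, hv⟩ (Quot.out_eq _))
  have hq2 : ∀ v, (idxParam C₀ q).1.2 v = p.1.2 v := by
    intro v
    by_cases h : v ≠ c ∧ Dominates G c v
    · exact idxParam_of_dominated C₀ q h
    · rw [show p.1.2 v = 0 by by_contra h'; exact h (p.2.2 v h')]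
      exact dif_neg h
  have key : twist c (Multiplicative.ofAdd p) =
      MulAut.conj (gen G c ^ p.1.1 x₀) * twist c (Multiplicative.ofAdd (idxParam C₀ q)) := by
    refine mulAut_ext fun v => ?_
    rw [MulAut.mul_apply, twist_gen, twist_gen, MulAut.conj_apply, hq2]
    by_cases hv : v ∈ star G c
    · have h1 : ∀ n : ℤ, Commute (gen G c ^ n) (gen G c ^ p.1.2 v * gen G v) := fun n =>
        (((Commute.refl _).zpow_right _).mul_right
          (commute_of_mem_stSub (gen_mem_stSub hv)).symm).zpow_left _
      simp only [(h1 _).eq, mul_inv_cancel_right]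
    · rw [hq1 v hv]
      group
  refine ⟨Multiplicative.ofAdd q, ?_⟩
  rw [key, map_mul]
  have h1 : QuotientGroup.mk' (Inn (RAAG G)) (MulAut.conj (gen G c ^ p.1.1 x₀)) = 1 :=
    (QuotientGroup.eq_one_iff _).2 ⟨_, rfl⟩
  rw [h1, one_mul]
  rfl

theorem range_outerTwist [Fintype V] (hF : Focused G c) :
    (outerTwist C₀).range = Subgroup.map (QuotientGroup.mk' (Inn (RAAG G))) (PCT G) := by
  apply le_antisymm
  · rintro _ ⟨q, rfl⟩
    exact ⟨_, twist_mem_PCT c _, rfl⟩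
  · rw [Subgroup.map_le_iff_le_comap, PCT, Subgroup.closure_le]
    rintro φ (⟨u, v, h⟩ | ⟨v, P, h⟩)
    · obtain rfl := hF.1 u v h.1 h.2.1
      rw [h.eq_twist]
      exact mk_twist_mem_range C₀ _
    · by_cases hv : v = c
      · subst hv
        have : φ = twist v (Multiplicative.ofAdd (compParam h.1 1)) := by
          have h' := isPartialConj_twist h.1
          refine mulAut_ext fun u => ?_
          by_cases hu : u ∈ P
          · rw [h.2.1 u hu, h'.2.1 u hu]
          · rw [h.2.2 u hu, h'.2.2 u hu]
        rw [this]
        exact mk_twist_mem_range C₀ _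
      · have : φ = MulAut.conj (gen G v) := by
          refine mulAut_ext fun u => ?_
          rw [MulAut.conj_apply]
          by_cases hu : u ∈ P
          · exact h.2.1 u hu
          · rw [h.2.2 u hu]
            have hus : u ∈ star G v := by
              by_contra hus
              obtain ⟨x, rfl⟩ := h.1
              exact hu ⟨⟨u, hus⟩, (hF.2 v hv).preconnected _ _, rfl⟩
            rw [← (commute_of_mem_stSub (gen_mem_stSub hus)).eq, mul_inv_cancel_right]
        have h1 : QuotientGroup.mk' (Inn (RAAG G)) φ = 1 :=
          (QuotientGroup.eq_one_iff φ).2 ⟨gen G v, this.symm⟩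
        refine Subgroup.mem_comap.2 ?_
        rw [h1]
        exact one_mem _

end Outer

end RAAG

/-- Proposition: for a focused graph, `Out(A_Γ) ≅ ℤ^{k+m-1} ⋊ (ℤ/2)^n`. -/
theorem stmt3 {V : Type} [Fintype V] (G : SimpleGraph V) (c : V)
    (hF : Focused G c) (hT : TrivialAut G)
    (hne : ((star G c)ᶜ : Set V).Nonempty) :
    (Subgroup.map (QuotientGroup.mk' (Inn (RAAG G))) (PCT G)).Normal ∧
    Nonempty (Subgroup.map (QuotientGroup.mk' (Inn (RAAG G))) (PCT G) ≃*
      Multiplicative (Fin (kInv G c + mInv G c - 1) → ℤ)) ∧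
    Nonempty (Subgroup.map (QuotientGroup.mk' (Inn (RAAG G))) (InvSubgroup G) ≃*
      Multiplicative (Fin (Nat.card V) → ZMod 2)) ∧
    Subgroup.map (QuotientGroup.mk' (Inn (RAAG G))) (PCT G) ⊓
      Subgroup.map (QuotientGroup.mk' (Inn (RAAG G))) (InvSubgroup G) = ⊥ ∧
    Subgroup.map (QuotientGroup.mk' (Inn (RAAG G))) (PCT G) ⊔
      Subgroup.map (QuotientGroup.mk' (Inn (RAAG G))) (InvSubgroup G) = ⊤ := by
  classical
  have hker := RAAG.PCT_eq_ker_signs hF hT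
  let σ : Out (RAAG G) →* (V → ℤˣ) := QuotientGroup.lift (Inn (RAAG G)) (RAAG.signs hF hT) (by
    rintro _ ⟨g, rfl⟩
    exact RAAG.signs_conj hF hT g)
  let ι : (V → ℤˣ) →* Out (RAAG G) := (QuotientGroup.mk' (Inn (RAAG G))).comp (RAAG.invert G)
  have hσι : ∀ s, σ (ι s) = s := RAAG.signs_invert hF hT
  have hιr : ι.range = Subgroup.map (QuotientGroup.mk' (Inn (RAAG G))) (InvSubgroup G) := by
    rw [← RAAG.range_invert, MonoidHom.range_comp]
  have hmap : ∀ x ∈ Subgroup.map (QuotientGroup.mk' (Inn (RAAG G))) (PCT G), σ x = 1 := by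
    rintro _ ⟨φ, hφ, rfl⟩
    rw [hker] at hφ
    exact hφ
  refine ⟨?_, ?_, ?_, ?_, ?_⟩
  · rw [hker]
    exact Subgroup.Normal.map inferInstance _ (QuotientGroup.mk'_surjective _)
  · obtain ⟨x₀, hx₀⟩ := hne
    let C₀ := (G.induce (star G c)ᶜ).connectedComponentMk ⟨x₀, hx₀⟩
    let e : RAAG.TwistIdx G c C₀ ≃ Fin (kInv G c + mInv G c - 1) :=
      Finite.equivFinOfCardEq (RAAG.card_twistIdx C₀)
    exact ⟨(MulEquiv.subgroupCongr (RAAG.range_outerTwist C₀ hF)).symm.trans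
      ((MonoidHom.ofInjective (RAAG.outerTwist_injective C₀)).symm.trans
      (LinearEquiv.funCongrLeft ℤ ℤ e.symm).toAddEquiv.toMultiplicative)⟩
  · have hι : Function.Injective ι := Function.LeftInverse.injective hσι
    let e : ℤˣ ≃* Multiplicative (ZMod 2) := mulEquivOfPrimeCardEq (p := 2) (by simp) (by simp)
    let f : (V → ℤˣ) ≃* (V → Multiplicative (ZMod 2)) := MulEquiv.piCongrRight fun _ => e
    let f' : (V → Multiplicative (ZMod 2)) ≃* Multiplicative (V → ZMod 2) :=
      { Equiv.refl _ with map_mul' := fun _ _ => rfl }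
    exact ⟨(MulEquiv.subgroupCongr hιr).symm.trans ((MonoidHom.ofInjective hι).symm.trans
      (f.trans (f'.trans
      (LinearEquiv.funCongrLeft (ZMod 2) (ZMod 2)
        (Finite.equivFin V).symm).toAddEquiv.toMultiplicative)))⟩
  · rw [eq_bot_iff, ← hιr]
    rintro _ ⟨hx, s, rfl⟩
    have := hmap _ hx
    rw [hσι] at this
    rw [this, map_one]
    exact one_mem _
  · rw [eq_top_iff, ← hιr]
    intro x _
    rw [← inv_mul_cancel_right x (ι (σ x))]
    refine Subgroup.mul_mem_sup ?_ ⟨_, rfl⟩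
    obtain ⟨φ, rfl⟩ := QuotientGroup.mk'_surjective _ x
    refine ⟨φ * (RAAG.invert G (RAAG.signs hF hT φ))⁻¹, ?_, rfl⟩
    rw [hker]
    refine MonoidHom.mem_ker.2 ?_
    rw [map_mul, map_inv, RAAG.signs_invert, mul_inv_cancel]
end
end
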